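/- arXiv:0704.2560 — 2 statements merged into one kernel-verified Lean document; each statement's English description precedes it below -/
import Mathlib

section
/- (The interlacement set is connected.) Let d ≥ 3, u > 0, and let Q be a vacant-set law at level u on {0,1}^{ℤ^d}. Then Q-almost surely the set {x ∈ ℤ^d : Y_x = 0} is infinite and nearest-neighbor connected. -/
open MeasureTheory
open scoped ENNReal

abbrev Zd (d : ℕ) := Fin d → ℤ

/-- Nearest-neighbor adjacency on `ℤ^d`. -/
def adj {d : ℕ} (x y : Zd d) : Prop := (∑ i, (x i - y i).natAbs) = 1

instance {d : ℕ} (x y : Zd d) : Decidable (adj x y) := by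
  unfold adj; infer_instance

/-- `P` is the family of laws of simple random walk on `ℤ^d`, characterized by its
finite-dimensional (cylinder) distributions. -/
def IsSRW (d : ℕ) (P : Zd d → Measure (ℕ → Zd d)) : Prop :=
  (∀ x, IsProbabilityMeasure (P x)) ∧
  ∀ (x : Zd d) (N : ℕ) (γ : ℕ → Zd d), γ 0 = x →
    P x {w | ∀ k ≤ N, w k = γ k} =
      if ∀ k < N, adj (γ (k + 1)) (γ k) then ((2 * d : ℝ≥0∞))⁻¹ ^ N else 0

/-- The event `{H̃_K = ∞}`. -/
def escSet (d : ℕ) (K : Finset (Zd d)) : Set (ℕ → Zd d) :=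
  {ω | ∀ n : ℕ, 1 ≤ n → ω n ∉ K}

/-- The equilibrium measure `e_K`. -/
noncomputable def eqm (d : ℕ) (P : Zd d → Measure (ℕ → Zd d)) (K : Finset (Zd d))
    (x : Zd d) : ℝ≥0∞ :=
  if x ∈ K then P x (escSet d K) else 0

/-- The capacity `cap(K) = Σ_x e_K(x)`. -/
noncomputable def capa (d : ℕ) (P : Zd d → Measure (ℕ → Zd d)) (K : Finset (Zd d)) : ℝ≥0∞ :=
  ∑ x ∈ K, eqm d P K x

/-- `Q` is a vacant-set law at level `u`:
`Q[Y_z = 1 for z ∈ K] = exp(−u·cap(K))` for every finite `K`. -/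
def IsVacantLaw (d : ℕ) (P : Zd d → Measure (ℕ → Zd d)) (u : ℝ)
    (Q : Measure (Zd d → Bool)) : Prop :=
  IsProbabilityMeasure Q ∧
  ∀ K : Finset (Zd d),
    Q {ω | ∀ z ∈ K, ω z = true} = ENNReal.ofReal (Real.exp (-(u * (capa d P K).toReal)))

/-- `x` and `y` are connected by a nearest-neighbor path inside `S`. -/
def connectedIn {d : ℕ} (S : Set (Zd d)) (x y : Zd d) : Prop :=
  ∃ (n : ℕ) (γ : ℕ → Zd d), γ 0 = x ∧ γ n = y ∧ (∀ k ≤ n, γ k ∈ S) ∧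
    ∀ k < n, adj (γ (k + 1)) (γ k)

namespace RI

lemma adj_symm {d : ℕ} {x y : Zd d} (h : adj x y) : adj y x := by
  unfold adj at *
  rw [← h]
  refine Finset.sum_congr rfl fun i _ => ?_
  omega

def stp {d : ℕ} (s : Fin d × Bool) : Zd d := Pi.single s.1 (if s.2 then 1 else -1)

lemma stp_inj {d : ℕ} : Function.Injective (stp (d := d)) := by
  rintro ⟨i, b⟩ ⟨j, c⟩ h
  have h1 := congrFun h i
  simp only [stp, Pi.single_eq_same] at h1
  by_cases hij : i = j
  · subst hij
    simp only [Pi.single_eq_same] at h1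
    cases b <;> cases c <;> simp_all
  · rw [Pi.single_eq_of_ne hij] at h1
    cases b <;> simp at h1

lemma adj_stp {d : ℕ} (x : Zd d) (s : Fin d × Bool) : adj (x + stp s) x := by
  unfold adj
  rw [Finset.sum_eq_single s.1]
  · simp only [stp, Pi.add_apply, Pi.single_eq_same]
    cases s.2 <;> simp
  · intro j _ hj
    simp [stp, Pi.single_eq_of_ne hj]
  · simp

lemma adj_iff {d : ℕ} (x y : Zd d) : adj y x ↔ ∃ s, y = x + stp s := by
  constructor
  · intro h
    unfold adj at h
    have h0 : ∃ i ∈ Finset.univ, (y i - x i).natAbs ≠ 0 := by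
      by_contra hc
      push Not at hc
      rw [Finset.sum_eq_zero hc] at h
      omega
    obtain ⟨i, hi, hne⟩ := h0
    rw [← Finset.add_sum_erase _ _ hi] at h
    have h1 : (y i - x i).natAbs = 1 := by omega
    have h2 : ∑ j ∈ Finset.univ.erase i, (y j - x j).natAbs = 0 := by omega
    rw [Finset.sum_eq_zero_iff] at h2
    refine ⟨(i, decide (y i - x i = 1)), ?_⟩
    funext j
    by_cases hj : j = i
    · subst hj
      simp only [stp, Pi.add_apply, Pi.single_eq_same, decide_eq_true_eq]
      split_ifs <;> omega
    · have := h2 j (by simp [hj])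
      simp only [stp, Pi.add_apply, Pi.single_eq_of_ne hj]
      omega
  · rintro ⟨s, rfl⟩
    exact adj_stp x s

def cyl {d : ℕ} (N : ℕ) (γ : ℕ → Zd d) : Set (ℕ → Zd d) := {w | ∀ k ≤ N, w k = γ k}

lemma meas_coord {d : ℕ} (k : ℕ) (a : Zd d) : MeasurableSet {w : ℕ → Zd d | w k = a} := by
  have h : Measurable (fun w : ℕ → Zd d => w k) := measurable_pi_apply k
  exact h (measurableSet_singleton a)

lemma meas_cyl {d : ℕ} (N : ℕ) (γ : ℕ → Zd d) : MeasurableSet (cyl N γ) := by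
  have : cyl N γ = ⋂ k, ⋂ (_ : k ≤ N), {w : ℕ → Zd d | w k = γ k} := by
    ext w; simp [cyl]
  rw [this]
  exact MeasurableSet.iInter fun k => MeasurableSet.iInter fun _ => meas_coord k _

lemma ext_cyl {d : ℕ} {μ ν : Measure (ℕ → Zd d)} [IsFiniteMeasure μ]
    (h : ∀ N γ, μ (cyl N γ) = ν (cyl N γ)) (hu : μ Set.univ = ν Set.univ) : μ = ν := by
  let C : Set (Set (ℕ → Zd d)) := {s | s = ∅ ∨ ∃ N γ, s = cyl N γ}
  refine MeasureTheory.ext_of_generate_finite C ?_ ?_ ?_ hu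
  · apply le_antisymm
    · rw [MeasurableSpace.pi]
      refine iSup_le fun k => ?_
      rintro _ ⟨t, -, rfl⟩
      have h1 : (fun w : ℕ → Zd d => w k) ⁻¹' t
          = ⋃ (p : Fin (k+1) → Zd d), ⋃ (_ : p (Fin.last k) ∈ t),
              cyl k (fun j => if hj : j < k+1 then p ⟨j, hj⟩ else 0) := by
        ext w
        simp only [Set.mem_preimage, Set.mem_iUnion, cyl, Set.mem_ofPred_eq, exists_prop]
        constructor
        · intro hw
          refine ⟨fun j => w j, by simpa using hw, ?_⟩
          intro j hj
          rw [dif_pos (by omega)]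
        · rintro ⟨p, hp, hw⟩
          have := hw k le_rfl
          rw [dif_pos (by omega)] at this
          rw [this]; exact hp
      rw [h1]
      refine MeasurableSet.iUnion fun p => MeasurableSet.iUnion fun _ => ?_
      exact MeasurableSpace.measurableSet_generateFrom (Or.inr ⟨_, _, rfl⟩)
    · refine MeasurableSpace.generateFrom_le ?_
      rintro s (rfl | ⟨N, γ, rfl⟩)
      · exact MeasurableSet.empty
      · exact meas_cyl N γ
  · rintro s (rfl | ⟨N, γ, rfl⟩) t (rfl | ⟨M, γ', rfl⟩) hst
    · left; simp
    · left; simp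
    · left; simp
    · right
      obtain ⟨w, hw1, hw2⟩ := hst
      refine ⟨max N M, w, ?_⟩
      ext v
      simp only [cyl, Set.mem_inter_iff, Set.mem_ofPred_eq] at *
      constructor
      · rintro ⟨h1, h2⟩ k hk
        rcases le_max_iff.1 hk with hk | hk
        · rw [h1 k hk, hw1 k hk]
        · rw [h2 k hk, hw2 k hk]
      · intro hv
        exact ⟨fun k hk => by rw [hv k (le_max_of_le_left hk), hw1 k hk],
          fun k hk => by rw [hv k (le_max_of_le_right hk), hw2 k hk]⟩
  · rintro s (rfl | ⟨N, γ, rfl⟩)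
    · simp
    · exact h N γ

def cns {d : ℕ} (x : Zd d) (w : ℕ → Zd d) : ℕ → Zd d
  | 0 => x
  | n + 1 => w n

def sh {d : ℕ} (N : ℕ) (w : ℕ → Zd d) : ℕ → Zd d := fun n => w (n + N)

lemma meas_cns {d : ℕ} (x : Zd d) : Measurable (cns x) := by
  refine measurable_pi_lambda _ fun n => ?_
  cases n with
  | zero => exact measurable_const
  | succ n => exact measurable_pi_apply n

lemma meas_sh {d : ℕ} (N : ℕ) : Measurable (sh (d := d) N) :=
  measurable_pi_lambda _ fun n => measurable_pi_apply _

lemma sh_cns {d : ℕ} (N : ℕ) (x : Zd d) (w : ℕ → Zd d) : sh (N+1) (cns x w) = sh N w := by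
  funext n; rfl

lemma cns_mem_cyl {d : ℕ} (N : ℕ) (x : Zd d) (γ w : ℕ → Zd d) :
    cns x w ∈ cyl (N+1) γ ↔ x = γ 0 ∧ w ∈ cyl N (fun k => γ (k+1)) := by
  constructor
  · intro h
    exact ⟨h 0 (by omega), fun k hk => h (k+1) (by omega)⟩
  · rintro ⟨h0, h⟩ k hk
    cases k with
    | zero => exact h0
    | succ k => exact h k (by omega)

lemma two_d_ne {d : ℕ} (hd : 3 ≤ d) : ((2 * d : ℝ≥0∞)) ≠ 0 := by
  have : d ≠ 0 := by omega
  simp [this]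

lemma two_d_ne_top {d : ℕ} : ((2 * d : ℝ≥0∞)) ≠ ⊤ := by
  finiteness

lemma P_start {d : ℕ} {P : Zd d → Measure (ℕ → Zd d)} (hP : IsSRW d P) (x : Zd d) :
    ∀ᵐ w ∂P x, w 0 = x := by
  have := hP.1 x
  rw [MeasureTheory.ae_iff]
  have h := hP.2 x 0 (fun _ => x) rfl
  have hm := meas_coord 0 x
  have h1 : P x {w | w 0 = x} = 1 := by
    simpa using h
  have := prob_compl_eq_zero_iff hm (μ := P x)
  rw [← Set.compl_ofPred] 
  exact this.2 h1

lemma P_cyl {d : ℕ} {P : Zd d → Measure (ℕ → Zd d)} (hP : IsSRW d P) (x : Zd d) (N γ) :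
    P x (cyl N γ) = if γ 0 = x ∧ ∀ k < N, adj (γ (k + 1)) (γ k) then
      ((2 * d : ℝ≥0∞))⁻¹ ^ N else 0 := by
  by_cases h : γ 0 = x
  · simp only [h, true_and]
    exact hP.2 x N γ h
  · simp only [h, false_and, if_false]
    refine measure_mono_null ?_ (MeasureTheory.ae_iff.1 (P_start hP x))
    intro w hw hw0
    exact h (by rw [← hw 0 (by omega), hw0])

lemma P_step {d : ℕ} (hd : 3 ≤ d) {P : Zd d → Measure (ℕ → Zd d)} (hP : IsSRW d P) (x : Zd d)
    {E : Set (ℕ → Zd d)} (hE : MeasurableSet E) :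
    P x E = ((2 * d : ℝ≥0∞))⁻¹ * ∑ s : Fin d × Bool, P (x + stp s) (cns x ⁻¹' E) := by
  have := hP.1
  have h2 := two_d_ne hd
  have key : P x = ((2 * d : ℝ≥0∞))⁻¹ •
      ∑ s : Fin d × Bool, (P (x + stp s)).map (cns x) := by
    apply ext_cyl
    · intro N γ
      simp only [Measure.smul_apply, Measure.finsetSum_apply, smul_eq_mul]
      simp_rw [Measure.map_apply (meas_cns x) (meas_cyl N γ)]
      cases N with
      | zero =>
        rw [P_cyl hP]
        by_cases h : γ 0 = x
        · have : cns x ⁻¹' cyl 0 γ = Set.univ := by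
            ext w; simp [cyl, cns, h]
          simp [h, this]
          rw [mul_comm (d : ℝ≥0∞) 2, ENNReal.inv_mul_cancel h2 two_d_ne_top]
        · have : cns x ⁻¹' cyl 0 γ = ∅ := by
            ext w; simp [cyl, cns, Ne.symm h]
          simp [h, this]
      | succ N =>
        rw [P_cyl hP]
        by_cases h : γ 0 = x
        · have : cns x ⁻¹' cyl (N+1) γ = cyl N (fun k => γ (k+1)) := by
            ext w
            rw [Set.mem_preimage, cns_mem_cyl]
            simp [h]
          simp_rw [this, P_cyl hP]
          by_cases ha : adj (γ 1) (γ 0)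
          · obtain ⟨s, hs⟩ := (adj_iff _ _).1 ha
            rw [Finset.sum_eq_single s]
            · rw [h] at hs
              simp only [h, zero_add, hs, true_and]
              by_cases hn : ∀ k < N, adj (γ (k+1+1)) (γ (k+1))
              · rw [if_pos, if_pos hn, pow_succ']
                intro k hk
                cases k with
                | zero => exact ha
                | succ k => exact hn k (by omega)
              · rw [if_neg, if_neg hn, mul_zero]
                exact fun hc => hn fun k hk => hc (k+1) (by omega)
            · intro t _ hts
              rw [if_neg]
              rintro ⟨hc, -⟩
              apply hts
              apply stp_inj
              rw [h] at hs
              have hc : γ 1 = x + stp t := hc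
              rw [hs] at hc
              exact (add_left_cancel hc).symm
            · simp
          · rw [if_neg (fun hc => ha (hc.2 0 (by omega))), Finset.sum_eq_zero, mul_zero]
            intro t _
            rw [if_neg]
            rintro ⟨hc, -⟩
            apply ha
            have hc : γ 1 = x + stp t := hc
            rw [h, hc]
            exact adj_stp x t
        · have : cns x ⁻¹' cyl (N+1) γ = ∅ := by
            ext w
            rw [Set.mem_preimage, cns_mem_cyl]
            simp [Ne.symm h]
          simp [h, this]
    · simp only [Measure.smul_apply, Measure.finsetSum_apply, smul_eq_mul]
      simp_rw [Measure.map_apply (meas_cns x) MeasurableSet.univ]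
      simp
      rw [mul_comm (d : ℝ≥0∞) 2, ENNReal.inv_mul_cancel h2 two_d_ne_top]
  conv_lhs => rw [key]
  simp only [Measure.smul_apply, Measure.finsetSum_apply, smul_eq_mul]
  simp_rw [Measure.map_apply (meas_cns x) hE]

lemma P_path {d : ℕ} (hd : 3 ≤ d) {P : Zd d → Measure (ℕ → Zd d)} (hP : IsSRW d P)
    {E : Set (ℕ → Zd d)} (hE : MeasurableSet E) (N : ℕ) : ∀ (γ : ℕ → Zd d),
    (∀ k < N, adj (γ (k + 1)) (γ k)) →
    P (γ 0) (cyl N γ ∩ sh N ⁻¹' E) = ((2 * d : ℝ≥0∞))⁻¹ ^ N * P (γ N) E := by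
  induction N with
  | zero =>
    intro γ _
    simp only [pow_zero, one_mul]
    apply measure_congr
    filter_upwards [P_start hP (γ 0)] with w hw
    apply propext
    constructor
    · rintro ⟨-, h⟩; exact h
    · intro h
      refine ⟨fun k hk => ?_, h⟩
      have : k = 0 := by omega
      rw [this, hw]
  | succ N ih =>
    intro γ hγ
    rw [P_step hd hP _ ((meas_cyl _ _).inter (meas_sh _ hE))]
    have hset : cns (γ 0) ⁻¹' (cyl (N+1) γ ∩ sh (N+1) ⁻¹' E)
        = cyl N (fun k => γ (k+1)) ∩ sh N ⁻¹' E := by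
      ext w
      simp only [Set.mem_preimage, Set.mem_inter_iff, cns_mem_cyl, sh_cns, true_and]
    rw [hset]
    obtain ⟨s, hs⟩ := (adj_iff _ _).1 (hγ 0 (by omega))
    rw [Finset.sum_eq_single s]
    · rw [← hs]
      have := ih (fun k => γ (k+1)) (fun k hk => hγ (k+1) (by omega))
      simp only [zero_add] at this ⊢
      rw [this, pow_succ', mul_assoc]
    · intro t _ hts
      refine measure_mono_null ?_ (MeasureTheory.ae_iff.1 (P_start hP (γ 0 + stp t)))
      rintro w ⟨hw, -⟩ hw0
      apply hts
      apply stp_inj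
      have h1 : w 0 = γ 1 := hw 0 (by omega)
      rw [hw0] at h1
      rw [zero_add] at hs
      rw [hs] at h1
      exact add_left_cancel h1
    · simp

end RI

namespace RI

lemma P_real {d : ℕ} (hd : 3 ≤ d) {P : Zd d → Measure (ℕ → Zd d)} (hP : IsSRW d P) (x : Zd d)
    {E : Set (ℕ → Zd d)} (hE : MeasurableSet E) :
    (2 * d : ℝ) * (P x).real E = ∑ s : Fin d × Bool, (P (x + stp s)).real (cns x ⁻¹' E) := by
  have := hP.1
  have h : (P x).real E = (2 * d : ℝ)⁻¹ *
      ∑ s : Fin d × Bool, (P (x + stp s)).real (cns x ⁻¹' E) := by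
    unfold Measure.real
    rw [P_step hd hP x hE, ENNReal.toReal_mul, ENNReal.toReal_sum (fun _ _ => measure_ne_top _ _)]
    simp
  have hd0 : (d : ℝ) ≠ 0 := by
    have : d ≠ 0 := by omega
    exact_mod_cast this
  rw [h]
  field_simp

lemma stp_flip {d : ℕ} (i : Fin d) (b : Bool) : stp (i, !b) = - stp (i, b) := by
  unfold stp
  rw [← Pi.single_neg]
  cases b <;> simp

lemma zd_induct {d : ℕ} {p : Zd d → Prop} (h0 : p 0) (hs : ∀ x s, p x → p (x + stp s)) (x : Zd d) :
    p x := by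
  have h1 : ∀ (i : Fin d) (n : ℤ) (y : Zd d), p y → p (y + Pi.single i n) := by
    intro i n
    induction n using Int.induction_on with
    | zero => intro y hy; simpa using hy
    | succ n ih =>
      intro y hy
      have := hs _ (i, true) (ih y hy)
      simp only [stp, if_true, add_assoc, ← Pi.single_add] at this
      exact this
    | pred n ih =>
      intro y hy
      have := hs _ (i, false) (ih y hy)
      simp only [stp, add_assoc, ← Pi.single_add] at this
      simpa [sub_eq_add_neg] using this
  have h2 : ∀ T : Finset (Fin d), p (∑ i ∈ T, Pi.single i (x i)) := by
    intro T
    induction T using Finset.induction_on with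
    | empty => simpa using h0
    | insert a T ha ih =>
      rw [Finset.sum_insert ha, add_comm]
      exact h1 _ _ _ ih
  have := h2 Finset.univ
  rwa [Finset.univ_sum_single] at this

lemma liouville_aux {d : ℕ} (hd : 3 ≤ d) (f : Zd d → ℝ) (h0 : ∀ x, 0 ≤ f x) (h1 : ∀ x, f x ≤ 1)
    (hf : ∀ x, (2 * d : ℝ) * f x = ∑ s : Fin d × Bool, f (x + stp s)) (s : Fin d × Bool)
    (x : Zd d) : f (x + stp s) ≤ f x := by
  by_contra hc
  push Not at hc
  let g : Zd d → ℝ := fun x => f (x + stp s) - f x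
  have hbd : BddAbove (Set.range g) := by
    refine ⟨1, ?_⟩
    rintro _ ⟨y, rfl⟩
    have := h1 (y + stp s); have := h0 y
    simp only [g]; linarith
  set M := ⨆ y, g y with hM
  have hgM : ∀ y, g y ≤ M := fun y => le_ciSup hbd y
  have hMpos : 0 < M := lt_of_lt_of_le (sub_pos.2 hc) (hgM x)
  have hg : ∀ y, (2 * d : ℝ) * g y = ∑ t : Fin d × Bool, g (y + stp t) := by
    intro y
    simp only [g, mul_sub, hf, Finset.sum_sub_distrib]
    congr 1
    refine Finset.sum_congr rfl fun t _ => ?_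
    rw [add_right_comm]
  have hd' : (3 : ℝ) ≤ d := by exact_mod_cast hd
  have hstep : ∀ y ε, M - ε ≤ g y → M - (2 * d) * ε ≤ g (y + stp s) := by
    intro y ε hy
    have h2 := hg y
    rw [← Finset.add_sum_erase _ _ (Finset.mem_univ s)] at h2
    have h3 : ∑ t ∈ Finset.univ.erase s, g (y + stp t) ≤ (2 * d - 1) * M := by
      refine (Finset.sum_le_card_nsmul _ _ M fun t _ => hgM _).trans (le_of_eq ?_)
      rw [Finset.card_erase_of_mem (Finset.mem_univ _), nsmul_eq_mul]
      rw [Nat.cast_sub (by simp; omega)]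
      simp; left; ring
    nlinarith
  have hiter : ∀ k : ℕ, ∀ y ε, M - ε ≤ g y → M - (2 * d) ^ k * ε ≤ g (y + k • stp s) := by
    intro k
    induction k with
    | zero => intro y ε h; simpa using h
    | succ k ih =>
      intro y ε h
      have := hstep _ _ (ih y ε h)
      rw [add_assoc, ← succ_nsmul] at this
      rw [pow_succ']
      linarith
  have htel : ∀ (m : ℕ) y, f (y + m • stp s) - f y = ∑ k ∈ Finset.range m, g (y + k • stp s) := by
    intro m y
    induction m with
    | zero => simp
    | succ m ih =>
      rw [Finset.sum_range_succ, ← ih]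
      simp only [g]
      rw [add_assoc y, ← succ_nsmul]
      ring
  obtain ⟨m, hm⟩ := exists_nat_gt (4 / M)
  have hm' : 4 < m * M := by rwa [div_lt_iff₀ hMpos] at hm
  have hpow : (0 : ℝ) < (2 * d) ^ m := by positivity
  obtain ⟨y, hy⟩ := exists_lt_of_lt_ciSup
    (show M - M / (2 * (2 * d) ^ m) < M by
      have : 0 < M / (2 * (2 * d) ^ m) := by positivity
      linarith)
  have h4 : ∀ k ∈ Finset.range m, M / 2 ≤ g (y + k • stp s) := by
    intro k hk
    have h5 := hiter k y _ hy.le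
    have h6 : ((2 : ℝ) * d) ^ k ≤ (2 * d) ^ m :=
      pow_le_pow_right₀ (by linarith) (Finset.mem_range.1 hk).le
    have h7 : ((2 : ℝ) * d) ^ k * (M / (2 * (2 * d) ^ m)) ≤ M / 2 := by
      calc ((2 : ℝ) * d) ^ k * (M / (2 * (2 * d) ^ m))
          ≤ (2 * d) ^ m * (M / (2 * (2 * d) ^ m)) := by
            apply mul_le_mul_of_nonneg_right h6; positivity
        _ = M / 2 := by field_simp
    linarith
  have h8 := Finset.card_nsmul_le_sum _ _ _ h4
  rw [← htel, Finset.card_range, nsmul_eq_mul] at h8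
  have := h1 (y + m • stp s); have := h0 y
  linarith

lemma liouville {d : ℕ} (hd : 3 ≤ d) (f : Zd d → ℝ) (h0 : ∀ x, 0 ≤ f x) (h1 : ∀ x, f x ≤ 1)
    (hf : ∀ x, (2 * d : ℝ) * f x = ∑ s : Fin d × Bool, f (x + stp s)) (x : Zd d) :
    f x = f 0 := by
  have h : ∀ x s, f (x + stp s) = f x := by
    rintro x ⟨i, b⟩
    apply le_antisymm (liouville_aux hd f h0 h1 hf _ x)
    have := liouville_aux hd f h0 h1 hf (i, !b) (x + stp (i, b))
    rw [stp_flip] at this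
    simpa using this
  exact zd_induct (p := fun x => f x = f 0) rfl (fun x s hx => by rw [h, hx]) x

lemma sh_inv {d : ℕ} {E : Set (ℕ → Zd d)} (hinv : ∀ w, sh 1 w ∈ E ↔ w ∈ E) (N : ℕ) (w : ℕ → Zd d) :
    sh N w ∈ E ↔ w ∈ E := by
  induction N generalizing w with
  | zero => rfl
  | succ N ih =>
    rw [← hinv w, ← ih (sh 1 w)]
    have : sh (N+1) w = sh N (sh 1 w) := by
      funext n; simp only [sh]; congr 1
    rw [this]

lemma zero_one {d : ℕ} (hd : 3 ≤ d) {P : Zd d → Measure (ℕ → Zd d)} (hP : IsSRW d P)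
    {E : Set (ℕ → Zd d)} (hE : MeasurableSet E) (hinv : ∀ w, sh 1 w ∈ E ↔ w ∈ E) :
    (∀ x, P x E = 0) ∨ (∀ x, P x E = 1) := by
  have := hP.1
  have hconst : ∀ x, P x E = P 0 E := by
    intro x
    have := liouville hd (fun x => (P x).real E) (fun _ => measureReal_nonneg)
      (fun x => measureReal_le_one) (fun x => by
        rw [P_real hd hP x hE]
        have : cns x ⁻¹' E = E := by
          ext w
          rw [Set.mem_preimage, ← hinv]
          rfl
        rw [this]) x
    exact (ENNReal.toReal_eq_toReal_iff' (measure_ne_top _ _) (measure_ne_top _ _)).1 this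
  have hr : (P 0).restrict E = (P 0 E) • P 0 := by
    apply ext_cyl
    · intro N γ
      rw [Measure.restrict_apply (meas_cyl _ _), Measure.smul_apply, smul_eq_mul]
      by_cases h : γ 0 = 0 ∧ ∀ k < N, adj (γ (k+1)) (γ k)
      · have h1 := P_path hd hP hE N γ h.2
        have h2 : sh N ⁻¹' E = E := by
          ext w; exact sh_inv hinv N w
        rw [h2, h.1, hconst] at h1
        rw [h1, P_cyl hP, if_pos h, mul_comm]
      · have h0 : P 0 (cyl N γ) = 0 := by rw [P_cyl hP, if_neg h]
        rw [h0, mul_zero]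
        exact measure_mono_null Set.inter_subset_left h0
    · simp
  have h2 : P 0 E = P 0 E * P 0 E := by
    conv_lhs => rw [← Measure.restrict_apply_self, hr]
    simp
  by_cases h : P 0 E = 0
  · left; intro x; rw [hconst, h]
  · right; intro x; rw [hconst]
    have h3 : P 0 E * P 0 E = P 0 E * 1 := by rw [← h2, mul_one]
    exact (ENNReal.mul_right_inj h (measure_ne_top _ _)).1 h3

lemma rp4 {y : ℝ} (hy : 0 < y) : (y ^ (-(1/4) : ℝ)) ^ 4 = y⁻¹ := by
  rw [← Real.rpow_natCast, ← Real.rpow_mul hy.le]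
  norm_num
  rw [Real.rpow_neg_one]

lemma q_ineq {t : ℝ} (h1 : -(1/4) ≤ t) (h2 : t ≤ 1/4) :
    (1 + t) ^ (-(1/4) : ℝ) ≤ 1 - t/4 + 3*t^2/16 - t^3/8 := by
  have hq : 0 ≤ 1 - t/4 + 3*t^2/16 - t^3/8 := by nlinarith [sq_nonneg t]
  have hpos : 0 < 1 + t := by linarith
  rw [← pow_le_pow_iff_left₀ (by positivity) hq (n := 4) (by norm_num), rp4 hpos]
  rw [inv_le_iff_one_le_mul₀ hpos]
  have hs : 1 - t/2 + 7*t^2/16 - 11*t^3/32 ≤ (1 - t/4 + 3*t^2/16 - t^3/8)^2 := by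
    nlinarith [mul_nonneg (sq_nonneg t) (sq_nonneg t), mul_nonneg (mul_nonneg (sq_nonneg t) (sq_nonneg t)) (sub_nonneg.2 h2), sq_nonneg (t^3)]
  have hs0 : 0 ≤ 1 - t/2 + 7*t^2/16 - 11*t^3/32 := by nlinarith [sq_nonneg t]
  have h3 : (1 - t/2 + 7*t^2/16 - 11*t^3/32)^2 ≤ (1 - t/4 + 3*t^2/16 - t^3/8)^4 := by
    have := pow_le_pow_left₀ hs0 hs 2
    nlinarith
  have h4 : 1 ≤ (1 + t) * (1 - t/2 + 7*t^2/16 - 11*t^3/32)^2 := by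
    have e : (1 + t) * (1 - t/2 + 7*t^2/16 - 11*t^3/32)^2 - 1 =
      t^2 * (1/8 - 151/256*t^2 + t^2*(60/256*t) - 187/1024*(t^2*t^2) + t^2*t^2*(121/1024*t)) := by
        ring
    have ht2 : t^2 ≤ 1/16 := by nlinarith
    have ht0 : 0 ≤ t^2 := sq_nonneg t
    have b1 : -(1/16 * (1/16)) ≤ t^2*(60/256*t) := by nlinarith
    have b2 : t^2*t^2 ≤ 1/16 * (1/16) := by nlinarith
    have b3 : -(1/16 * (1/16)) ≤ t^2*t^2*(121/1024*t) := by nlinarith [mul_nonneg ht0 ht0]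
    have : 0 ≤ t^2 * (1/8 - 151/256*t^2 + t^2*(60/256*t) - 187/1024*(t^2*t^2)
        + t^2*t^2*(121/1024*t)) := by
      apply mul_nonneg ht0
      linarith
    linarith
  nlinarith

noncomputable def ff {d : ℕ} (x : Zd d) : ℝ := (∑ i, ((x i : ℝ))^2 + 15) ^ (-(1/4) : ℝ)

lemma ff_pos {d : ℕ} (x : Zd d) : 0 < ff x := by
  unfold ff; positivity

lemma ff_super {d : ℕ} (hd : 3 ≤ d) (x : Zd d) :
    ∑ s : Fin d × Bool, ff (x + stp s) ≤ (2 * d : ℝ) * ff x := by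
  set r : ℝ := ∑ i, ((x i : ℝ))^2 + 16 with hr
  have hn : 0 ≤ ∑ i, ((x i : ℝ))^2 := by positivity
  have hr16 : 16 ≤ r := by linarith
  have hr0 : 0 < r := by linarith
  have hd' : (3 : ℝ) ≤ d := by exact_mod_cast hd
  have hsq : ∀ (i : Fin d) (b : Bool), ∑ j, (((x + stp (i, b)) j : ℤ) : ℝ)^2 + 15
      = r + (if b then 1 else -1) * (2 * (x i : ℝ)) := by
    intro i b
    have h1 : ∀ j, (((x + stp (i, b)) j : ℤ) : ℝ)^2
        = (x j : ℝ)^2 + if j = i then ((if b then 1 else -1) * (2 * (x i : ℝ)) + 1) else 0 := by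
      intro j
      by_cases hj : j = i
      · subst hj
        simp only [stp, Pi.add_apply, Pi.single_eq_same, if_true]
        cases b <;> push_cast <;> simp <;> ring
      · simp [stp, hj]
    simp_rw [h1, Finset.sum_add_distrib]
    simp only [Finset.sum_ite_eq', Finset.mem_univ, if_true]
    rw [hr]; ring
  have hxi : ∀ i, (x i : ℝ)^2 ≤ r - 16 := by
    intro i
    have := Finset.single_le_sum (f := fun i => ((x i : ℝ))^2) (fun i _ => sq_nonneg _)
      (Finset.mem_univ i)
    linarith
  have ht : ∀ i, -(1/4) ≤ 2 * (x i : ℝ) / r ∧ 2 * (x i : ℝ) / r ≤ 1/4 := by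
    intro i
    have h := hxi i
    have : (8 * (x i : ℝ))^2 ≤ r^2 := by nlinarith [sq_nonneg (r - 32)]
    have h2 := abs_le_of_sq_le_sq' this hr0.le
    rw [le_div_iff₀ hr0, div_le_iff₀ hr0]
    constructor <;> linarith
  have hpt : ∀ i : Fin d, ff (x + stp (i, true)) + ff (x + stp (i, false))
      ≤ r ^ (-(1/4) : ℝ) * (2 + 3/8 * (2 * (x i : ℝ) / r)^2) := by
    intro i
    obtain ⟨h1, h2⟩ := ht i
    unfold ff
    rw [hsq, hsq]
    set t := 2 * (x i : ℝ) / r with htd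
    have e1 : r + (if true then 1 else -1) * (2 * (x i : ℝ)) = r * (1 + t) := by
      rw [htd]; field_simp; simp
    have e2 : r + (if false then 1 else -1) * (2 * (x i : ℝ)) = r * (1 + -t) := by
      rw [htd]; field_simp; simp
    rw [e1, e2, Real.mul_rpow hr0.le (by linarith), Real.mul_rpow hr0.le (by linarith), ← mul_add]
    apply mul_le_mul_of_nonneg_left _ (by positivity)
    have a1 := q_ineq h1 h2
    have a2 := q_ineq (t := -t) (by linarith) (by linarith)
    nlinarith
  have hff : r ^ (-(1/4) : ℝ) * (1 + 1/(4*r)) ≤ ff x := by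
    have e : ff x = (r * (1 - 1/r)) ^ (-(1/4) : ℝ) := by
      unfold ff
      congr 1
      rw [mul_sub, mul_one, mul_one_div_cancel hr0.ne', hr]; ring
    have hρ : 1/r ≤ 1/16 := by
      apply one_div_le_one_div_of_le <;> linarith
    have hρ0 : 0 < 1/r := by positivity
    rw [e, Real.mul_rpow hr0.le (by linarith)]
    apply mul_le_mul_of_nonneg_left _ (by positivity)
    have hpos : 0 < 1 - 1/r := by linarith
    rw [← pow_le_pow_iff_left₀ (by positivity) (by positivity) (n := 4) (by norm_num), rp4 hpos]
    rw [inv_eq_one_div (1 - 1/r), le_div_iff₀ hpos]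
    have e3 : 1/(4*r) = (1/r)/4 := by field_simp
    rw [e3]
    set ρ := 1/r
    have : (1 + ρ/4)^4 * (1 - ρ) = 1 - ρ^2 * (5/8 + 5/16 * ρ + 15/256*ρ^2 + ρ^3/256) := by ring
    rw [this]
    have : 0 ≤ ρ^2 * (5/8 + 5/16 * ρ + 15/256*ρ^2 + ρ^3/256) := by positivity
    linarith
  rw [Fintype.sum_prod_type]
  simp only [Fintype.sum_bool]
  calc ∑ i : Fin d, (ff (x + stp (i, true)) + ff (x + stp (i, false)))
      ≤ ∑ i : Fin d, r ^ (-(1/4) : ℝ) * (2 + 3/8 * (2 * (x i : ℝ) / r)^2) :=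
        Finset.sum_le_sum fun i _ => hpt i
    _ = r ^ (-(1/4) : ℝ) * (2 * d + 3/8 * (4 * (r - 16) / r^2)) := by
        rw [← Finset.mul_sum, Finset.sum_add_distrib, ← Finset.mul_sum]
        congr 2
        · simp [mul_comm]
        · simp_rw [div_pow, mul_pow]
          rw [← Finset.sum_div, ← Finset.mul_sum]
          rw [hr]; norm_num
    _ ≤ r ^ (-(1/4) : ℝ) * ((2 * d) * (1 + 1/(4*r))) := by
        apply mul_le_mul_of_nonneg_left _ (by positivity)
        have h1 : 4 * (r - 16) / r^2 ≤ 4 / r := by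
          rw [div_le_div_iff₀ (by positivity) hr0]
          nlinarith
        have h2 : (2 * d : ℝ) * (1/(4*r)) = d / 8 * (4 / r) := by field_simp; norm_num
        have h3 : 0 < 4 / r := by positivity
        nlinarith
    _ ≤ (2 * d : ℝ) * ff x := by
        have : (2 * d : ℝ) * (r ^ (-(1/4) : ℝ) * (1 + 1/(4*r))) ≤ 2 * d * ff x :=
          mul_le_mul_of_nonneg_left hff (by positivity)
        linarith

def hitS {d : ℕ} (y : Zd d) : Set (ℕ → Zd d) := {w | ∃ n, w n = y}

lemma meas_hitN {d : ℕ} (y : Zd d) (N : ℕ) :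
    MeasurableSet {w : ℕ → Zd d | ∃ n ≤ N, w n = y} := by
  have : {w : ℕ → Zd d | ∃ n ≤ N, w n = y} = ⋃ n, ⋃ (_ : n ≤ N), {w | w n = y} := by
    ext w; simp
  rw [this]
  exact MeasurableSet.iUnion fun n => MeasurableSet.iUnion fun _ => meas_coord n y

lemma meas_hitS {d : ℕ} (y : Zd d) : MeasurableSet (hitS y) := by
  have : hitS y = ⋃ n, {w | w n = y} := by
    ext w; simp [hitS]
  rw [this]
  exact MeasurableSet.iUnion fun n => meas_coord n y

lemma hit_bound {d : ℕ} (hd : 3 ≤ d) {P : Zd d → Measure (ℕ → Zd d)} (hP : IsSRW d P) (x y : Zd d) :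
    (P x).real (hitS y) ≤ ff (x - y) / ff (0 : Zd d) := by
  have := hP.1
  have h0 := ff_pos (0 : Zd d)
  have hd' : (3 : ℝ) ≤ d := by exact_mod_cast hd
  have key : ∀ N x, (P x).real {w : ℕ → Zd d | ∃ n ≤ N, w n = y} ≤ ff (x - y) / ff (0 : Zd d) := by
    intro N
    induction N with
    | zero =>
      intro x
      by_cases hxy : x = y
      · subst hxy
        rw [sub_self, div_self h0.ne']
        exact measureReal_le_one
      · have : (P x) {w : ℕ → Zd d | ∃ n ≤ 0, w n = y} = 0 := by
          refine measure_mono_null ?_ (MeasureTheory.ae_iff.1 (P_start hP x))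
          rintro w ⟨n, hn, hw⟩ hw0
          have : n = 0 := by omega
          subst this
          exact hxy (by rw [← hw0, hw])
        rw [Measure.real, this]
        have := ff_pos (x - y)
        simp only [ENNReal.toReal_zero]
        positivity
    | succ N ih =>
      intro x
      by_cases hxy : x = y
      · subst hxy
        rw [sub_self, div_self h0.ne']
        exact measureReal_le_one
      · have h1 := P_real hd hP x (meas_hitN y (N+1))
        have h2 : cns x ⁻¹' {w : ℕ → Zd d | ∃ n ≤ N + 1, w n = y}
            = {w : ℕ → Zd d | ∃ n ≤ N, w n = y} := by
          ext w
          constructor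
          · rintro ⟨n, hn, hw⟩
            cases n with
            | zero => exact absurd hw hxy
            | succ n => exact ⟨n, by omega, hw⟩
          · rintro ⟨n, hn, hw⟩
            exact ⟨n+1, by omega, hw⟩
        rw [h2] at h1
        have h3 := Finset.sum_le_sum (s := Finset.univ) (fun s _ => ih (x + stp s))
        rw [← h1, ← Finset.sum_div] at h3
        have h4 := ff_super hd (x - y)
        have h5 : ∑ i : Fin d × Bool, ff (x + stp i - y) = ∑ i : Fin d × Bool, ff (x - y + stp i) := by
          refine Finset.sum_congr rfl fun i _ => ?_
          congr 1; abel
        rw [h5, le_div_iff₀ h0] at h3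
        rw [le_div_iff₀ h0]
        have := h3.trans h4
        rw [mul_assoc] at this
        exact le_of_mul_le_mul_left this (by positivity)
  have hU : hitS y = ⋃ N, {w : ℕ → Zd d | ∃ n ≤ N, w n = y} := by
    ext w
    simp only [hitS, Set.mem_ofPred_eq, Set.mem_iUnion]
    exact ⟨fun ⟨n, h⟩ => ⟨n, n, le_rfl, h⟩, fun ⟨_, n, _, h⟩ => ⟨n, h⟩⟩
  have hmono : Monotone fun N => {w : ℕ → Zd d | ∃ n ≤ N, w n = y} := by
    rintro a b hab w ⟨n, hn, h⟩
    exact ⟨n, hn.trans hab, h⟩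
  have ht := tendsto_measure_iUnion_atTop (μ := P x) hmono
  rw [← hU] at ht
  have ht2 := (ENNReal.tendsto_toReal (measure_ne_top (P x) (hitS y))).comp ht
  exact le_of_tendsto' ht2 fun N => key N x

end RI

namespace RI

lemma ff_small {d : ℕ} (hd : 3 ≤ d) (A : Finset (Zd d)) (ε : ℝ) (hε : 0 < ε) :
    ∃ x : Zd d, ∀ a ∈ A, ff (x - a) < ε := by
  let i0 : Fin d := ⟨0, by omega⟩
  have ht : ∀ a : Zd d, Filter.Tendsto (fun n : ℕ => ff (Pi.single i0 (n : ℤ) - a))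
      Filter.atTop (nhds 0) := by
    intro a
    unfold ff
    have hbase : Filter.Tendsto (fun n : ℕ =>
        ∑ i, (((Pi.single i0 (n : ℤ) - a : Zd d) i : ℤ) : ℝ)^2 + 15) Filter.atTop Filter.atTop := by
      have h1 : Filter.Tendsto (fun n : ℕ => (n : ℝ) + (-(a i0 : ℝ))) Filter.atTop Filter.atTop :=
        Filter.tendsto_atTop_add_const_right _ _ tendsto_natCast_atTop_atTop
      refine Filter.tendsto_atTop_mono (fun n => ?_) h1
      have h2 := Finset.single_le_sum
        (f := fun i => (((Pi.single i0 (n : ℤ) - a : Zd d) i : ℤ) : ℝ)^2)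
        (fun i _ => sq_nonneg _) (Finset.mem_univ i0)
      simp only [Pi.sub_apply, Pi.single_eq_same] at h2
      simp only [Pi.sub_apply]
      push_cast at h2 ⊢
      nlinarith [sq_nonneg ((n : ℝ) - a i0 - 1)]
    exact (tendsto_rpow_neg_atTop (y := 1/4) (by norm_num)).comp hbase
  have he : ∀ᶠ n : ℕ in Filter.atTop, ∀ a ∈ A, ff (Pi.single i0 (n : ℤ) - a) < ε := by
    rw [Filter.eventually_all_finset]
    exact fun a _ => (ht a).eventually (gt_mem_nhds hε)
  obtain ⟨n, hn⟩ := he.exists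
  exact ⟨_, hn⟩

lemma transient {d : ℕ} (hd : 3 ≤ d) {P : Zd d → Measure (ℕ → Zd d)} (hP : IsSRW d P) (x y : Zd d) :
    ∀ᵐ w ∂P x, ∃ n, ∀ m, n ≤ m → w m ≠ y := by
  have := hP.1
  let E : Set (ℕ → Zd d) := {w | ∀ n, ∃ m, n ≤ m ∧ w m = y}
  have hE : MeasurableSet E := by
    have : E = ⋂ n, ⋃ m, ⋃ (_ : n ≤ m), {w | w m = y} := by
      ext w; simp [E]
    rw [this]
    exact MeasurableSet.iInter fun n => MeasurableSet.iUnion fun m =>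
      MeasurableSet.iUnion fun _ => meas_coord m y
  have hz : ∀ x, P x E = 0 := by
    have hinv : ∀ w, sh 1 w ∈ E ↔ w ∈ E := by
      intro w
      constructor
      · intro h n
        obtain ⟨m, hm, h⟩ := h n
        exact ⟨m + 1, by omega, h⟩
      · intro h n
        obtain ⟨m, hm, h⟩ := h (n + 1)
        refine ⟨m - 1, by omega, ?_⟩
        simp only [sh]
        rw [Nat.sub_add_cancel (by omega)]
        exact h
    rcases zero_one hd hP hE hinv with h | h
    · exact h
    · exfalso
      obtain ⟨z, hz⟩ := ff_small hd {y} (ff (0 : Zd d)) (ff_pos _)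
      have h1 := hit_bound hd hP z y
      have h2 : (P z).real E ≤ (P z).real (hitS y) := by
        apply measureReal_mono
        · intro w hw
          obtain ⟨m, -, hm⟩ := hw 0
          exact ⟨m, hm⟩
        · exact measure_ne_top _ _
      rw [Measure.real, h z, ENNReal.toReal_one] at h2
      have h3 := hz y (by simp)
      have h4 : ff (z - y) / ff (0 : Zd d) < 1 := by
        rw [div_lt_one (ff_pos _)]; exact h3
      linarith
  rw [ae_iff, ← hz x]
  congr 1
  ext w
  simp [E]

lemma transient_fin {d : ℕ} (hd : 3 ≤ d) {P : Zd d → Measure (ℕ → Zd d)} (hP : IsSRW d P) (x : Zd d) :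
    ∀ᵐ w ∂P x, ∀ A : Finset (Zd d), ∃ n, ∀ m, n ≤ m → w m ∉ A := by
  have h : ∀ᵐ w ∂P x, ∀ y, ∃ n, ∀ m, n ≤ m → w m ≠ y := by
    rw [ae_all_iff]; exact transient hd hP x
  filter_upwards [h] with w hw A
  choose N hN using hw
  refine ⟨A.sup N, fun m hm hA => ?_⟩
  exact hN _ m ((Finset.le_sup hA).trans hm) rfl

lemma meas_esc {d : ℕ} (K : Finset (Zd d)) : MeasurableSet (escSet d K) := by
  have : escSet d K = ⋂ n : ℕ, ⋂ (_ : 1 ≤ n), ⋂ z ∈ K, {w | w n = z}ᶜ := by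
    ext w
    simp only [escSet, Set.mem_ofPred_eq, Set.mem_iInter, Set.mem_compl_iff]
    exact ⟨fun h n hn z hz hw => h n hn (hw ▸ hz), fun h n hn hw => h n hn _ hw rfl⟩
  rw [this]
  exact MeasurableSet.iInter fun n => MeasurableSet.iInter fun _ =>
    Finset.measurableSet_biInter _ fun z _ => (meas_coord n z).compl

lemma esc_pos {d : ℕ} (hd : 3 ≤ d) {P : Zd d → Measure (ℕ → Zd d)} (hP : IsSRW d P) (x : Zd d) :
    P x (escSet d {x}) ≠ 0 := by
  have := hP.1
  intro h0
  let s : Fin d × Bool := (⟨0, by omega⟩, true)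
  have h1 := P_real hd hP x (meas_esc {x})
  rw [Measure.real, h0, ENNReal.toReal_zero, mul_zero] at h1
  have h2 := (Finset.sum_eq_zero_iff_of_nonneg (fun s _ => measureReal_nonneg)).1 h1.symm s
    (Finset.mem_univ _)
  have h3 : (P (x + stp s)).real (hitS x)ᶜ ≤ 0 := by
    rw [← h2]
    refine measureReal_mono ?_ (measure_ne_top _ _)
    intro w hw n hn
    cases n with
    | zero => omega
    | succ n =>
      intro hc
      exact hw ⟨n, Finset.mem_singleton.1 hc⟩
  rw [measureReal_compl (meas_hitS x)] at h3
  have h4 := hit_bound hd hP (x + stp s) x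
  have h5 : ff (x + stp s - x) / ff (0 : Zd d) < 1 := by
    rw [div_lt_one (ff_pos _), add_sub_cancel_left]
    unfold ff
    apply Real.rpow_lt_rpow_of_neg
    · positivity
    · have : (0 : ℝ) < ∑ i, ((stp s i : ℤ) : ℝ)^2 := by
        apply Finset.sum_pos' (fun i _ => sq_nonneg _)
        exact ⟨s.1, Finset.mem_univ _, by simp [stp, s]⟩
      simpa using this
    · norm_num
  simp at h3
  linarith

noncomputable def pk {d : ℕ} (a b : Zd d) : ℝ≥0∞ := if adj b a then ((2 * d : ℝ≥0∞))⁻¹ else 0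

lemma pk_symm {d : ℕ} (a b : Zd d) : pk a b = pk b a := by
  unfold pk
  congr 1
  exact propext ⟨adj_symm, adj_symm⟩

lemma P_step' {d : ℕ} (hd : 3 ≤ d) {P : Zd d → Measure (ℕ → Zd d)} (hP : IsSRW d P) (x : Zd d)
    {E : Set (ℕ → Zd d)} (hE : MeasurableSet E) :
    P x E = ∑' c, pk x c * P c (cns x ⁻¹' E) := by
  rw [P_step hd hP x hE, Finset.mul_sum]
  have h : ∀ c ∉ Finset.univ.image (fun s : Fin d × Bool => x + stp s),
      pk x c * P c (cns x ⁻¹' E) = 0 := by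
    intro c hc
    rw [pk, if_neg, zero_mul]
    intro ha
    obtain ⟨s, rfl⟩ := (adj_iff _ _).1 ha
    exact hc (by simp)
  rw [tsum_eq_sum h, Finset.sum_image]
  · refine Finset.sum_congr rfl fun s _ => ?_
    rw [pk, if_pos (adj_stp x s)]
  · intro s _ t _ hst
    exact stp_inj (add_left_cancel hst)

noncomputable def kk {d : ℕ} (U : Finset (Zd d)) : ℕ → Zd d → Zd d → ℝ≥0∞
  | 0 => pk
  | n + 1 => fun a b => ∑' c, if c ∈ U then 0 else pk a c * kk U n c b

lemma kk_s {d : ℕ} (U : Finset (Zd d)) (n : ℕ) (a b : Zd d) :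
    kk U (n+1) a b = ∑' c, if c ∈ U then 0 else pk a c * kk U n c b := rfl

lemma kk_succ {d : ℕ} (U : Finset (Zd d)) (n : ℕ) : ∀ a b,
    kk U (n+1) a b = ∑' c, if c ∈ U then 0 else kk U n a c * pk c b := by
  induction n with
  | zero =>
    intro a b
    simp only [kk]
  | succ n ih =>
    intro a b
    have h1 : kk U (n+1+1) a b = ∑' c, ∑' e, if c ∈ U then 0 else
        (if e ∈ U then 0 else pk a c * (kk U n c e * pk e b)) := by
      rw [kk_s]
      congr 1
      funext c
      split_ifs with h
      · simp
      · rw [ih, ← ENNReal.tsum_mul_left]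
        congr 1; funext e
        split_ifs <;> simp
    have h2 : ∑' c, (if c ∈ U then 0 else kk U (n+1) a c * pk c b) = ∑' e, ∑' c, if c ∈ U then 0 else
        (if e ∈ U then 0 else pk a c * (kk U n c e * pk e b)) := by
      congr 1
      funext e
      split_ifs with h
      · simp
      · rw [kk_s, ← ENNReal.tsum_mul_right]
        congr 1; funext c
        by_cases hc : c ∈ U <;> simp [hc, mul_assoc]
    rw [h1, h2, ENNReal.tsum_comm]

lemma kk_symm {d : ℕ} (U : Finset (Zd d)) (n : ℕ) : ∀ a b, kk U n a b = kk U n b a := by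
  induction n with
  | zero => exact pk_symm
  | succ n ih =>
    intro a b
    rw [kk_succ, kk_s]
    congr 1; funext c
    rw [ih a c, pk_symm c b, mul_comm]

def frS {d : ℕ} (U : Finset (Zd d)) (n : ℕ) (b : Zd d) (E : Set (ℕ → Zd d)) : Set (ℕ → Zd d) :=
  {w | (∀ m, 1 ≤ m → m ≤ n → w m ∉ U) ∧ w (n+1) = b ∧ sh (n+1) w ∈ E}

lemma meas_fr {d : ℕ} (U : Finset (Zd d)) (n : ℕ) (b : Zd d) {E : Set (ℕ → Zd d)}
    (hE : MeasurableSet E) : MeasurableSet (frS U n b E) := by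
  have : frS U n b E = (⋂ m : ℕ, ⋂ (_ : 1 ≤ m), ⋂ (_ : m ≤ n), ⋂ z ∈ U, {w | w m = z}ᶜ)
      ∩ ({w | w (n+1) = b} ∩ sh (n+1) ⁻¹' E) := by
    ext w
    simp only [frS, Set.mem_ofPred_eq, Set.mem_iInter, Set.mem_compl_iff, Set.mem_inter_iff,
      Set.mem_preimage]
    constructor
    · rintro ⟨h, h2⟩
      exact ⟨fun m h1 h2 z hz hw => h m h1 h2 (hw ▸ hz), h2⟩
    · rintro ⟨h, h2⟩
      exact ⟨fun m h1 h2 hw => h m h1 h2 _ hw rfl, h2⟩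
  rw [this]
  refine MeasurableSet.inter ?_ ((meas_coord _ _).inter (meas_sh _ hE))
  exact MeasurableSet.iInter fun n => MeasurableSet.iInter fun _ => MeasurableSet.iInter fun _ =>
    Finset.measurableSet_biInter _ fun z _ => (meas_coord n z).compl

lemma P_fr {d : ℕ} (hd : 3 ≤ d) {P : Zd d → Measure (ℕ → Zd d)} (hP : IsSRW d P)
    (U : Finset (Zd d)) (b : Zd d) {E : Set (ℕ → Zd d)} (hE : MeasurableSet E) (n : ℕ) : ∀ a,
    P a (frS U n b E) = kk U n a b * P b E := by
  induction n with
  | zero =>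
    intro a
    rw [P_step' hd hP a (meas_fr U 0 b hE)]
    have h : ∀ c, P c (cns a ⁻¹' frS U 0 b E) = if c = b then P b E else 0 := by
      intro c
      split_ifs with hcb
      · subst hcb
        apply measure_congr
        filter_upwards [P_start hP c] with w hw
        apply propext
        constructor
        · rintro ⟨-, -, h⟩; exact h
        · intro h
          exact ⟨fun m h1 h2 => by omega, hw, h⟩
      · refine measure_mono_null ?_ (MeasureTheory.ae_iff.1 (P_start hP c))
        rintro w ⟨-, hw, -⟩ hw0
        exact hcb (by rw [← hw0, ← hw]; rfl)
    simp only [h, kk]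
    rw [tsum_eq_single b (by intro c hc; simp [hc])]
    simp
  | succ n ih =>
    intro a
    rw [P_step' hd hP a (meas_fr U (n+1) b hE), kk_s, ← ENNReal.tsum_mul_right]
    congr 1; funext c
    have h : P c (cns a ⁻¹' frS U (n+1) b E) = if c ∈ U then 0 else kk U n c b * P b E := by
      split_ifs with hcU
      · refine measure_mono_null ?_ (MeasureTheory.ae_iff.1 (P_start hP c))
        rintro w ⟨hw, -⟩ hw0
        apply hw 1 le_rfl (by omega)
        show w 0 ∈ U
        rw [hw0]; exact hcU
      · rw [← ih]
        apply measure_congr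
        filter_upwards [P_start hP c] with w hw
        apply propext
        constructor
        · rintro ⟨h1, h2, h3⟩
          exact ⟨fun m hm1 hm2 => h1 (m+1) (by omega) (by omega), h2, h3⟩
        · rintro ⟨h1, h2, h3⟩
          refine ⟨fun m hm1 hm2 => ?_, h2, h3⟩
          cases m with
          | zero => omega
          | succ m =>
            cases m with
            | zero =>
              show w 0 ∉ U
              rw [hw]; exact hcU
            | succ m => exact h1 (m+1) (by omega) (by omega)
    rw [h]
    by_cases hcU : c ∈ U <;> simp [hcU, mul_assoc]

lemma esc_decomp {d : ℕ} (hd : 3 ≤ d) {P : Zd d → Measure (ℕ → Zd d)} (hP : IsSRW d P)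
    (A : Finset (Zd d)) (x : Zd d) (hx : x ∉ A) (y : Zd d) :
    P y (escSet d A) = P y (escSet d (insert x A))
      + (∑' n, kk (insert x A) n y x) * P x (escSet d A) := by
  have hset : escSet d A = escSet d (insert x A) ∪ ⋃ n, frS (insert x A) n x (escSet d A) := by
    ext w
    simp only [Set.mem_union, Set.mem_iUnion]
    constructor
    · intro hw
      by_cases h : w ∈ escSet d (insert x A)
      · exact Or.inl h
      · right
        have h' : ∃ n, w (n+1) ∈ insert x A := by
          by_contra hc
          push Not at hc
          apply h
          intro n hn
          have := hc (n-1)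
          rwa [Nat.sub_add_cancel hn] at this
        refine ⟨Nat.find h', ?_, ?_, ?_⟩
        · intro m h1 h2
          have := Nat.find_min h' (m := m-1) (by omega)
          rwa [Nat.sub_add_cancel h1] at this
        · have := Nat.find_spec h'
          rcases Finset.mem_insert.1 this with h1 | h1
          · exact h1
          · exact absurd h1 (hw _ (by omega))
        · intro n hn
          exact hw _ (by omega)
    · rintro (h | ⟨n, h1, h2, h3⟩)
      · intro m hm hc
        exact h m hm (Finset.mem_insert_of_mem hc)
      · intro m hm
        rcases lt_trichotomy m (n+1) with h | h | h
        · exact fun hc => h1 m hm (by omega) (Finset.mem_insert_of_mem hc)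
        · rw [h, h2]; exact hx
        · have := h3 (m - (n+1)) (by omega)
          simp only [sh] at this
          rwa [Nat.sub_add_cancel h.le] at this
  have hdisj : Pairwise (Function.onFun Disjoint fun n => frS (insert x A) n x (escSet d A)) := by
    have key : ∀ i j, i < j → Disjoint (frS (insert x A) i x (escSet d A))
        (frS (insert x A) j x (escSet d A)) := by
      intro i j hij
      rw [Set.disjoint_left]
      rintro w ⟨-, h2, -⟩ ⟨h1, -, -⟩
      apply h1 (i+1) (by omega) (by omega)
      rw [h2]; simp
    intro i j hij
    rcases lt_or_gt_of_ne hij with h | h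
    · exact key i j h
    · exact (key j i h).symm
  have hm := fun n => meas_fr (insert x A) n x (meas_esc A)
  conv_lhs => rw [hset]
  rw [measure_union _ (MeasurableSet.iUnion hm), measure_iUnion hdisj hm, ← ENNReal.tsum_mul_right]
  · simp_rw [P_fr hd hP _ _ (meas_esc A)]
  · rw [Set.disjoint_left]
    rintro w h hw
    obtain ⟨n, -, h2, -⟩ := Set.mem_iUnion.1 hw
    apply h (n+1) (by omega)
    rw [h2]; simp

lemma total_decomp {d : ℕ} (hd : 3 ≤ d) {P : Zd d → Measure (ℕ → Zd d)} (hP : IsSRW d P)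
    (U : Finset (Zd d)) (y : Zd d) :
    1 = P y (escSet d U) + ∑ b ∈ U, ∑' n, kk U n y b := by
  have := hP.1
  have hset : (Set.univ : Set (ℕ → Zd d)) = escSet d U ∪ ⋃ b ∈ U, ⋃ n, frS U n b Set.univ := by
    symm
    rw [Set.eq_univ_iff_forall]
    intro w
    by_cases h : w ∈ escSet d U
    · exact Or.inl h
    · right
      have h' : ∃ n, w (n+1) ∈ U := by
        by_contra hc
        push Not at hc
        apply h
        intro n hn
        have := hc (n-1)
        rwa [Nat.sub_add_cancel hn] at this
      simp only [Set.mem_iUnion]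
      refine ⟨_, Nat.find_spec h', Nat.find h', ?_, rfl, trivial⟩
      intro m h1 h2
      have := Nat.find_min h' (m := m-1) (by omega)
      rwa [Nat.sub_add_cancel h1] at this
  have key : ∀ i j b c, b ∈ U → i < j → Disjoint (frS U i b Set.univ)
      (frS U j c Set.univ) := by
    intro i j b c hb hij
    rw [Set.disjoint_left]
    rintro w ⟨-, h2, -⟩ ⟨h1, -, -⟩
    apply h1 (i+1) (by omega) (by omega)
    rw [h2]; exact hb
  have hm := fun b n => meas_fr U n b MeasurableSet.univ
  have hb : ∀ b ∈ U, P y (⋃ n, frS U n b Set.univ) = ∑' n, kk U n y b := by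
    intro b hb
    rw [measure_iUnion _ (hm b)]
    · simp_rw [P_fr hd hP _ _ MeasurableSet.univ]
      simp
    · intro i j hij
      rcases lt_or_gt_of_ne hij with h | h
      · exact key i j b b hb h
      · exact (key j i b b hb h).symm
  rw [← measure_univ (μ := P y), hset, measure_union, measure_biUnion_finset]
  · congr 1
    exact Finset.sum_congr rfl hb
  · intro b hb c hc hbc
    show Disjoint (⋃ n, frS U n b Set.univ) (⋃ n, frS U n c Set.univ)
    rw [Set.disjoint_iUnion_left]
    intro i
    rw [Set.disjoint_iUnion_right]
    intro j
    rcases lt_trichotomy i j with h | h | h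
    · exact key i j b c hb h
    · subst h
      rw [Set.disjoint_left]
      rintro w ⟨-, h1, -⟩ ⟨-, h2, -⟩
      exact hbc (h1.symm.trans h2)
    · exact (key j i c b hc h).symm
  · exact fun b _ => MeasurableSet.iUnion (hm b)
  · rw [Set.disjoint_left]
    rintro w h hw
    simp only [Set.mem_iUnion] at hw
    obtain ⟨b, hb, n, -, h2, -⟩ := hw
    apply h (n+1) (by omega)
    rw [h2]; exact hb
  · exact Finset.measurableSet_biUnion _ fun b _ => MeasurableSet.iUnion (hm b)

lemma capa_insert {d : ℕ} (hd : 3 ≤ d) {P : Zd d → Measure (ℕ → Zd d)} (hP : IsSRW d P)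
    (A : Finset (Zd d)) (x : Zd d) (hx : x ∉ A) :
    capa d P (insert x A) = capa d P A + P x (escSet d A) * P x (escSet d (insert x A)) := by
  have := hP.1
  set ρ := P x (escSet d A) with hρ
  set ε := P x (escSet d (insert x A)) with hε
  set β := ∑' n, kk (insert x A) n x x with hβ
  set α := ∑ y ∈ A, ∑' n, kk (insert x A) n y x with hα
  have h1 : ρ = ε + β * ρ := esc_decomp hd hP A x hx x
  have h2 : 1 = ε + (β + α) := by
    have := total_decomp hd hP (insert x A) x
    rw [Finset.sum_insert hx] at this
    rw [hα, hβ, hε]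
    simp_rw [kk_symm (insert x A) _ _ x]
    exact this
  have h3 : capa d P (insert x A) = ε + ∑ y ∈ A, P y (escSet d (insert x A)) := by
    unfold capa
    rw [Finset.sum_insert hx]
    congr 1
    · simp [eqm, hε]
    · refine Finset.sum_congr rfl fun y hy => ?_
      simp [eqm, hy]
  have h4 : capa d P A = ∑ y ∈ A, P y (escSet d (insert x A)) + α * ρ := by
    unfold capa
    rw [hα, Finset.sum_mul, ← Finset.sum_add_distrib]
    refine Finset.sum_congr rfl fun y hy => ?_
    simp only [eqm, hy, if_true]
    exact esc_decomp hd hP A x hx y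
  have h5 : ε = α * ρ + ρ * ε := by
    have hfin : β * ρ ≠ ⊤ := by
      have : β * ρ ≤ ρ := by
        conv_rhs => rw [h1]
        exact le_add_self
      exact ne_top_of_le_ne_top (measure_ne_top _ _) this
    have h6 : ε + β * ρ = (α * ρ + ρ * ε) + β * ρ := by
      rw [← h1]
      calc ρ = 1 * ρ := (one_mul _).symm
        _ = (ε + (β + α)) * ρ := by rw [← h2]
        _ = _ := by ring
    exact (ENNReal.add_left_inj hfin).1 h6
  rw [h3, h4]
  conv_lhs => rw [h5]
  ring

lemma capa_ne_top {d : ℕ} {P : Zd d → Measure (ℕ → Zd d)} (hP : IsSRW d P)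
    (A : Finset (Zd d)) : capa d P A ≠ ⊤ := by
  have := hP.1
  unfold capa
  refine ENNReal.sum_ne_top.2 fun x hx => ?_
  unfold eqm
  split_ifs
  · exact measure_ne_top _ _

end RI

namespace RI

def mt {d : ℕ} (ω ω' : Zd d → Bool) : Zd d → Bool := fun z => ω z && ω' z

open Classical in
noncomputable def vac {d : ℕ} (w : ℕ → Zd d) : Zd d → Bool := fun z => decide (∀ n, w n ≠ z)

def VA {d : ℕ} (A : Finset (Zd d)) : Set (Zd d → Bool) := {ω | ∀ z ∈ A, ω z = true}

lemma meas_pt {d : ℕ} (z : Zd d) (b : Bool) : MeasurableSet {ω : Zd d → Bool | ω z = b} := by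
  have h : Measurable (fun ω : Zd d → Bool => ω z) := measurable_pi_apply z
  exact h (measurableSet_singleton b)

lemma meas_VA {d : ℕ} (A : Finset (Zd d)) : MeasurableSet (VA A) := by
  have : VA A = ⋂ z ∈ A, {ω | ω z = true} := by
    ext ω; simp [VA]
  rw [this]
  exact Finset.measurableSet_biInter _ fun z _ => meas_pt z true

lemma meas_mt {d : ℕ} : Measurable (fun p : (Zd d → Bool) × (Zd d → Bool) => mt p.1 p.2) := by
  refine measurable_pi_lambda _ fun z => ?_
  have h : Measurable (fun b : Bool × Bool => b.1 && b.2) := measurable_of_countable _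
  have h1 : Measurable (fun ω : Zd d → Bool => ω z) := measurable_pi_apply z
  exact h.comp ((h1.comp measurable_fst).prodMk (h1.comp measurable_snd))

lemma meas_vac {d : ℕ} : Measurable (vac (d := d)) := by
  refine measurable_pi_lambda _ fun z => ?_
  refine measurable_to_bool ?_
  have : (fun w : ℕ → Zd d => vac w z) ⁻¹' {true} = (hitS z)ᶜ := by
    ext w; simp [vac, hitS]
  rw [this]
  exact (meas_hitS z).compl

lemma ext_VA {d : ℕ} {μ ν : Measure (Zd d → Bool)} [IsFiniteMeasure μ]
    (h : ∀ A : Finset (Zd d), μ (VA A) = ν (VA A)) : μ = ν := by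
  classical
  have huniv : VA (∅ : Finset (Zd d)) = Set.univ := by ext ω; simp [VA]
  refine ext_of_generate_finite (Set.range (VA (d := d))) ?_ ?_ ?_ ?_
  · apply le_antisymm
    · have : (MeasurableSpace.pi : MeasurableSpace (Zd d → Bool)) =
        ⨆ z, MeasurableSpace.comap (fun ω => ω z) inferInstance := rfl
      rw [this]
      refine iSup_le fun z => ?_
      rw [← measurable_iff_comap_le]
      refine @measurable_to_bool _ (MeasurableSpace.generateFrom (Set.range VA)) _ ?_
      apply MeasurableSpace.measurableSet_generateFrom
      refine ⟨{z}, ?_⟩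
      ext ω; simp [VA]
    · refine MeasurableSpace.generateFrom_le ?_
      rintro _ ⟨A, rfl⟩
      exact meas_VA A
  · rintro _ ⟨A, rfl⟩ _ ⟨B, rfl⟩ -
    refine ⟨A ∪ B, ?_⟩
    ext ω
    simp only [VA, Finset.mem_union, Set.mem_ofPred_eq, Set.mem_inter_iff]
    exact ⟨fun h => ⟨fun z hz => h z (.inl hz), fun z hz => h z (.inr hz)⟩,
      fun h z hz => hz.elim (h.1 z) (h.2 z)⟩
  · rintro _ ⟨A, rfl⟩; exact h A
  · rw [← huniv]; exact h _

noncomputable def tau {d : ℕ} (P : Zd d → Measure (ℕ → Zd d)) (x : Zd d) : Measure (Zd d → Bool) :=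
  ((P x).prod ((P x).restrict (escSet d {x}))).map (fun p => mt (vac p.1) (vac p.2))

lemma meas_mv {d : ℕ} : Measurable
    (fun p : (ℕ → Zd d) × (ℕ → Zd d) => mt (vac p.1) (vac p.2)) :=
  meas_mt.comp ((meas_vac.comp measurable_fst).prodMk (meas_vac.comp measurable_snd))

lemma vac_VA {d : ℕ} (w : ℕ → Zd d) (A : Finset (Zd d)) : vac w ∈ VA A ↔ ∀ n, w n ∉ A := by
  simp only [vac, VA, Set.mem_ofPred_eq, decide_eq_true_eq]
  exact ⟨fun h n hn => h _ hn n rfl, fun h z hz n hn => h n (hn ▸ hz)⟩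

lemma tau_VA {d : ℕ} {P : Zd d → Measure (ℕ → Zd d)} (hP : IsSRW d P) (x : Zd d)
    (A : Finset (Zd d)) (hx : x ∉ A) :
    tau P x (VA A) = P x (escSet d A) * P x (escSet d (insert x A)) := by
  have := hP.1
  rw [tau, Measure.map_apply meas_mv (meas_VA A)]
  have h1 : (fun p : (ℕ → Zd d) × (ℕ → Zd d) => mt (vac p.1) (vac p.2)) ⁻¹' VA A
      = (vac ⁻¹' VA A) ×ˢ (vac ⁻¹' VA A) := by
    ext p
    simp only [VA, mt, Set.mem_preimage, Set.mem_ofPred_eq, Set.mem_prod, Bool.and_eq_true]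
    exact ⟨fun h => ⟨fun z hz => (h z hz).1, fun z hz => (h z hz).2⟩,
      fun h z hz => ⟨h.1 z hz, h.2 z hz⟩⟩
  rw [h1, Measure.prod_prod, Measure.restrict_apply (meas_vac (meas_VA A))]
  congr 1
  · refine measure_congr ?_
    filter_upwards [P_start hP x] with w hw
    refine propext ?_
    change vac w ∈ VA A ↔ w ∈ escSet d A
    rw [vac_VA]
    refine ⟨fun h n _ => h n, fun h n => ?_⟩
    rcases Nat.eq_zero_or_pos n with rfl | hn
    · rwa [hw]
    · exact h n hn
  · refine measure_congr ?_
    filter_upwards [P_start hP x] with w hw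
    refine propext ?_
    change (vac w ∈ VA A ∧ w ∈ escSet d {x}) ↔ w ∈ escSet d (insert x A)
    rw [vac_VA]
    simp only [escSet, Set.mem_ofPred_eq, Finset.mem_insert, Finset.mem_singleton]
    refine ⟨fun h n hn h' => h'.elim (h.2 n hn) (h.1 n), fun h => ⟨fun n => ?_, fun n hn h' => h n hn (.inl h')⟩⟩
    rcases Nat.eq_zero_or_pos n with rfl | hn
    · rwa [hw]
    · exact fun h' => h n hn (.inr h')

lemma tau_VA' {d : ℕ} {P : Zd d → Measure (ℕ → Zd d)} (hP : IsSRW d P) (x : Zd d)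
    (A : Finset (Zd d)) (hx : x ∈ A) : tau P x (VA A) = 0 := by
  have := hP.1
  rw [tau, Measure.map_apply meas_mv (meas_VA A)]
  refine measure_mono_null (t := {w | w 0 = x}ᶜ ×ˢ Set.univ) ?_ ?_
  · intro p hp
    refine ⟨fun h => ?_, trivial⟩
    have := hp x hx
    simp only [mt, vac, Bool.and_eq_true, decide_eq_true_eq] at this
    exact this.1 0 h
  · rw [Measure.prod_prod]
    have : P x {w | w 0 = x}ᶜ = 0 := P_start hP x
    rw [this, zero_mul]

instance tau_fin {d : ℕ} {P : Zd d → Measure (ℕ → Zd d)} [∀ x, IsProbabilityMeasure (P x)] (x : Zd d) :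
    IsFiniteMeasure (tau P x) := by
  unfold tau; infer_instance

noncomputable def nu {d : ℕ} (Q τ : Measure (Zd d → Bool)) (x : Zd d) : ℕ → Measure (Zd d → Bool)
  | 0 => Q.restrict {ω | ω x = true}
  | k+1 => ((nu Q τ x k).prod τ).map (fun p => mt p.1 p.2)

instance nu_fin {d : ℕ} (Q τ : Measure (Zd d → Bool)) [IsFiniteMeasure Q] [IsFiniteMeasure τ]
    (x : Zd d) (k : ℕ) : IsFiniteMeasure (nu Q τ x k) := by
  induction k with
  | zero => unfold nu; infer_instance
  | succ k ih => unfold nu; infer_instance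

lemma nu_VA {d : ℕ} (Q τ : Measure (Zd d → Bool)) [IsFiniteMeasure Q] [IsFiniteMeasure τ]
    (x : Zd d) (A : Finset (Zd d)) (k : ℕ) :
    nu Q τ x k (VA A) = Q (VA (insert x A)) * (τ (VA A)) ^ k := by
  induction k with
  | zero =>
    rw [nu, Measure.restrict_apply (meas_VA A), pow_zero, mul_one]
    congr 1
    ext ω
    simp [VA, and_comm]
  | succ k ih =>
    rw [nu, Measure.map_apply meas_mt (meas_VA A)]
    have h1 : (fun p : (Zd d → Bool) × (Zd d → Bool) => mt p.1 p.2) ⁻¹' VA A = VA A ×ˢ VA A := by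
      ext p
      simp only [VA, mt, Set.mem_preimage, Set.mem_ofPred_eq, Set.mem_prod, Bool.and_eq_true]
      exact ⟨fun h => ⟨fun z hz => (h z hz).1, fun z hz => (h z hz).2⟩,
        fun h z hz => ⟨h.1 z hz, h.2 z hz⟩⟩
    rw [h1, Measure.prod_prod, ih, pow_succ, mul_assoc]

lemma capa_tau {d : ℕ} (hd : 3 ≤ d) {P : Zd d → Measure (ℕ → Zd d)} (hP : IsSRW d P) (x : Zd d)
    (A : Finset (Zd d)) : capa d P (insert x A) = capa d P A + tau P x (VA A) := by
  by_cases hx : x ∈ A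
  · rw [tau_VA' hP x A hx, Finset.insert_eq_self.2 hx, add_zero]
  · rw [tau_VA hP x A hx, capa_insert hd hP A x hx]

lemma Q_sum {d : ℕ} (hd : 3 ≤ d) {P : Zd d → Measure (ℕ → Zd d)} (hP : IsSRW d P)
    {u : ℝ} (hu : 0 < u) {Q : Measure (Zd d → Bool)} (hQ : IsVacantLaw d P u Q) (x : Zd d) :
    Q = Measure.sum (fun k : ℕ => ENNReal.ofReal (u ^ k / k.factorial) • nu Q (tau P x) x k) := by
  have := hP.1
  have := hQ.1
  refine ext_VA fun A => ?_
  rw [Measure.sum_apply _ (meas_VA A)]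
  simp only [Measure.smul_apply, smul_eq_mul, nu_VA]
  have e1 : Q (VA A) = _ := hQ.2 A
  have e2 : Q (VA (insert x A)) = _ := hQ.2 (insert x A)
  have hcap := capa_tau hd hP x A
  set t := tau P x (VA A) with ht
  have htt : t ≠ ⊤ := measure_ne_top _ _
  rw [e1, e2, hcap, ENNReal.toReal_add (capa_ne_top hP A) htt]
  set c := (capa d P A).toReal
  obtain ⟨s, hs0, hs⟩ : ∃ s : ℝ, 0 ≤ s ∧ t = ENNReal.ofReal s :=
    ⟨t.toReal, ENNReal.toReal_nonneg, (ENNReal.ofReal_toReal htt).symm⟩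
  rw [hs, ENNReal.toReal_ofReal hs0]
  have hsum : HasSum (fun k : ℕ => u ^ k / k.factorial * (Real.exp (-(u * (c + s))) * s ^ k))
      (Real.exp (-(u * c))) := by
    have h := (NormedSpace.expSeries_div_hasSum_exp (u * s)).mul_left (Real.exp (-(u * (c + s))))
    rw [← Real.exp_eq_exp_ℝ, ← Real.exp_add] at h
    have e1 : (fun k : ℕ => u ^ k / k.factorial * (Real.exp (-(u * (c + s))) * s ^ k)) =
        fun i : ℕ => Real.exp (-(u * (c + s))) * ((u * s) ^ i / (i.factorial : ℝ)) := by
      funext k; rw [mul_pow]; ring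
    have e2 : -(u * c) = -(u * (c + s)) + u * s := by ring
    rw [e1, e2]
    exact h
  rw [← hsum.tsum_eq, ENNReal.ofReal_tsum_of_nonneg (fun k => by positivity) hsum.summable]
  congr 1; funext k
  rw [ENNReal.ofReal_mul (by positivity), ENNReal.ofReal_mul (by positivity), ENNReal.ofReal_pow hs0]

lemma ae_Q_iff {d : ℕ} (hd : 3 ≤ d) {P : Zd d → Measure (ℕ → Zd d)} (hP : IsSRW d P)
    {u : ℝ} (hu : 0 < u) {Q : Measure (Zd d → Bool)} (hQ : IsVacantLaw d P u Q) (x : Zd d)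
    (p : (Zd d → Bool) → Prop) :
    (∀ᵐ ω ∂Q, p ω) ↔ ∀ k, ∀ᵐ ω ∂(nu Q (tau P x) x k), p ω := by
  have h : ∀ Q' : Measure (Zd d → Bool), Q' = Measure.sum (fun k : ℕ => ENNReal.ofReal (u ^ k / k.factorial) • nu Q (tau P x) x k) → ((∀ᵐ ω ∂Q', p ω) ↔ ∀ k, ∀ᵐ ω ∂(nu Q (tau P x) x k), p ω) := by
    rintro Q' rfl
    rw [Measure.ae_sum_iff]
    refine forall_congr' fun k => ?_
    rw [Measure.ae_ennreal_smul_measure_iff]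
    simp only [ne_eq, ENNReal.ofReal_eq_zero, not_le]
    positivity
  exact h Q (Q_sum hd hP hu hQ x)

lemma ins1 {d : ℕ} (hd : 3 ≤ d) {P : Zd d → Measure (ℕ → Zd d)} (hP : IsSRW d P)
    {u : ℝ} (hu : 0 < u) {Q : Measure (Zd d → Bool)} (hQ : IsVacantLaw d P u Q) (x : Zd d)
    {p : (Zd d → Bool) → Prop} (h : ∀ᵐ ω ∂Q, p ω) :
    ∀ᵐ ω ∂Q, ∀ᵐ w ∂(P x), ∀ᵐ w' ∂((P x).restrict (escSet d {x})), p (mt ω (mt (vac w) (vac w'))) := by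
  have := hP.1
  have := hQ.1
  rw [ae_Q_iff hd hP hu hQ x] at h ⊢
  intro k
  have h1 := h (k+1)
  rw [nu] at h1
  have h2 := Measure.ae_ae_of_ae_prod (ae_of_ae_map meas_mt.aemeasurable h1)
  filter_upwards [h2] with ω hω
  rw [tau] at hω
  exact Measure.ae_ae_of_ae_prod (ae_of_ae_map meas_mv.aemeasurable hω)

lemma ins2 {d : ℕ} (hd : 3 ≤ d) {P : Zd d → Measure (ℕ → Zd d)} (hP : IsSRW d P)
    {u : ℝ} (hu : 0 < u) {Q : Measure (Zd d → Bool)} (hQ : IsVacantLaw d P u Q) (x : Zd d)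
    {p : (Zd d → Bool) → Prop} (hp : MeasurableSet {ω | p ω})
    (h : ∀ᵐ ω ∂Q, ∀ᵐ w ∂(P x), ∀ᵐ w' ∂((P x).restrict (escSet d {x})),
      p (mt ω (mt (vac w) (vac w')))) :
    ∀ᵐ ω ∂Q, ω x = false → p ω := by
  have := hP.1
  have := hQ.1
  have h' : ∀ᵐ ω ∂Q, ∀ᵐ ω' ∂(tau P x), p (mt ω ω') := by
    filter_upwards [h] with ω hω
    have hm : Measurable (fun ω' => mt ω ω') := meas_mt.comp measurable_prodMk_left
    rw [tau]
    refine (ae_map_iff meas_mv.aemeasurable (hm hp)).2 ?_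
    refine (Measure.ae_prod_iff_ae_ae ((hm.comp meas_mv) hp)).2 ?_
    exact hω
  rw [ae_Q_iff hd hP hu hQ x] at h' ⊢
  intro k
  cases k with
  | zero =>
    rw [nu]
    filter_upwards [ae_restrict_mem (meas_pt x true)] with ω hω h0
    rw [h0] at hω; cases hω
  | succ k =>
    have h1 := h' k
    rw [nu]
    have : ∀ᵐ ω ∂(((nu Q (tau P x) x k).prod (tau P x)).map (fun p => mt p.1 p.2)), p ω := by
      exact (ae_map_iff meas_mt.aemeasurable hp).2 ((Measure.ae_prod_iff_ae_ae (meas_mt hp)).2 h1)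
    filter_upwards [this] with ω hω _ using hω
end RI

namespace RI

def RR {d : ℕ} (S : Set (Zd d)) (a b : Zd d) : Prop :=
  a ∈ S ∧ Relation.ReflTransGen (fun p q => adj q p ∧ q ∈ S) a b

section
variable {d : ℕ} {S T : Set (Zd d)} {a b c : Zd d}

lemma RR.refl (h : a ∈ S) : RR S a a := ⟨h, .refl⟩

lemma RR.left (h : RR S a b) : a ∈ S := h.1

lemma RR.right (h : RR S a b) : b ∈ S := by
  obtain ⟨h1, h2⟩ := h
  cases h2 with
  | refl => exact h1
  | tail _ h => exact h.2

lemma RR.step (h : RR S a b) (hadj : adj c b) (hc : c ∈ S) : RR S a c := ⟨h.1, h.2.tail ⟨hadj, hc⟩⟩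

lemma RR.trans (h : RR S a b) (h' : RR S b c) : RR S a c := ⟨h.1, h.2.trans h'.2⟩

lemma RR.mono (h : RR S a b) (hST : S ⊆ T) : RR T a b :=
  ⟨hST h.1, h.2.lift id (fun _ _ h => ⟨h.1, hST h.2⟩)⟩

lemma RR.rec' {p : Zd d → Prop} (h : RR S a b) (h0 : a ∈ S → p a)
    (hs : ∀ b c, RR S a b → p b → adj c b → c ∈ S → p c) : p b := by
  obtain ⟨h1, h2⟩ := h
  induction h2 with
  | refl => exact h0 h1
  | tail h3 h4 ih => exact hs _ _ ⟨h1, h3⟩ ih h4.1 h4.2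

lemma RR.edge (ha : a ∈ S) (hb : b ∈ S) (h : adj b a) : RR S a b := (RR.refl ha).step h hb

lemma RR.symm (h : RR S a b) : RR S b a := by
  refine h.rec' (p := fun b => RR S b a) RR.refl ?_
  intro b c hb ih hadj hc
  exact (RR.edge hc hb.right (adj_symm hadj)).trans ih

lemma RR.path (w : ℕ → Zd d) (n m : ℕ) (hS : ∀ k, n ≤ k → k ≤ n + m → w k ∈ S)
    (hadj : ∀ k, n ≤ k → k < n + m → adj (w (k+1)) (w k)) : RR S (w n) (w (n+m)) := by
  induction m with
  | zero => exact RR.refl (hS n le_rfl le_rfl)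
  | succ m ih =>
    have := ih (fun k h1 h2 => hS k h1 (by omega)) (fun k h1 h2 => hadj k h1 (by omega))
    exact this.step (hadj (n+m) (by omega) (by omega)) (hS _ (by omega) (by omega))

lemma conn_iff : connectedIn S a b ↔ RR S a b := by
  constructor
  · rintro ⟨n, γ, rfl, rfl, h1, h2⟩
    have := RR.path (S := S) γ 0 n (fun k _ hk => h1 k (by omega)) (fun k _ hk => h2 k (by omega))
    simpa using this
  · intro h
    refine h.rec' (p := fun b => connectedIn S a b) ?_ ?_
    · intro ha
      exact ⟨0, fun _ => a, rfl, rfl, fun _ _ => ha, fun k hk => by omega⟩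
    · rintro b c - ⟨n, γ, h0, hn, h1, h2⟩ hadj hc
      refine ⟨n+1, fun k => if k ≤ n then γ k else c, by simpa using h0, by simp, ?_, ?_⟩
      · intro k hk
        dsimp only
        split_ifs with h
        · exact h1 k h
        · exact hc
      · intro k hk
        dsimp only
        rw [if_pos (by omega : k ≤ n)]
        split_ifs with h
        · exact h2 k (by omega)
        · have : k = n := by omega
          rw [this, hn]; exact hadj

end

lemma meas_RR {d : ℕ} {Ω : Type*} [MeasurableSpace Ω] (S : Ω → Set (Zd d))
    (hS : ∀ z, MeasurableSet {o | z ∈ S o}) (a b : Zd d) : MeasurableSet {o | RR (S o) a b} := by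
  let RN : ℕ → Zd d → Set Ω := fun n => Nat.rec (motive := fun _ => Zd d → Set Ω)
    (fun b => {o | a = b ∧ a ∈ S o})
    (fun _ f b => ⋃ c : Zd d, {o | o ∈ f c ∧ adj b c ∧ b ∈ S o}) n
  have hm : ∀ n b, MeasurableSet (RN n b) := by
    intro n
    induction n with
    | zero => intro b; exact (MeasurableSet.const _).inter (hS a)
    | succ n ih =>
      intro b
      exact MeasurableSet.iUnion fun c => (ih c).inter ((MeasurableSet.const _).inter (hS b))
  have : {o | RR (S o) a b} = ⋃ n, RN n b := by
    ext o
    simp only [Set.mem_ofPred_eq, Set.mem_iUnion]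
    constructor
    · intro h
      refine h.rec' (p := fun b => ∃ n, o ∈ RN n b) (fun ha => ⟨0, rfl, ha⟩) ?_
      rintro b c - ⟨n, hn⟩ hadj hc
      exact ⟨n+1, Set.mem_iUnion.2 ⟨b, hn, hadj, hc⟩⟩
    · rintro ⟨n, hn⟩
      revert b
      induction n with
      | zero =>
        rintro b ⟨rfl, h⟩; exact RR.refl h
      | succ n ih =>
        intro b hn
        obtain ⟨c, hc, h1, h2⟩ := Set.mem_iUnion.1 hn
        exact (ih c hc).step h1 h2
  rw [this]
  exact MeasurableSet.iUnion fun n => hm n b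

lemma counting {α : Type*} [DecidableEq α] (c : α → α → Prop) (r : α → α → α → Prop)
    (csym : ∀ a b, c a b → c b a) (ctr : ∀ a b e, c a b → c b e → c a e)
    (rsym : ∀ z a b, r z a b → r z b a) (rtr : ∀ z a b e, r z a b → r z b e → r z a e)
    (n : ℕ) : ∀ (S D : Finset α), S.card = n → Disjoint S D →
    (∀ z ∈ S, ∀ p ∈ S ∪ D, p ≠ z → c z p → r z p p) →
    (∀ z ∈ S, ∀ z' ∈ S, z ≠ z' → ∀ w ∈ S ∪ D, w ≠ z → w ≠ z' → c w z → c w z' →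
      r z w z' ∨ r z' w z) →
    (∀ z ∈ S, ∃ p : Fin 3 → α, (∀ i, p i ∈ D ∧ c z (p i)) ∧ ∀ i j, i ≠ j → ¬ r z (p i) (p j)) →
    S.card ≤ D.card := by
  classical
  induction n with
  | zero => intro S D h; omega
  | succ n ih =>
    intro S D hcard hdis hrefl H T
    let m : α × α → ℕ := fun q => (S.filter (fun s => s ≠ q.1 ∧ c q.1 s ∧ ¬ r q.1 q.2 s)).card
    let U := (S ×ˢ (S ∪ D)).filter (fun q => q.2 ≠ q.1 ∧ c q.1 q.2)
    have hne : U.Nonempty := by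
      obtain ⟨z, hz⟩ : S.Nonempty := by rw [← Finset.card_pos]; omega
      obtain ⟨p, hp, -⟩ := T z hz
      refine ⟨(z, p 0), ?_⟩
      simp only [U, Finset.mem_filter, Finset.mem_product, Finset.mem_union]
      exact ⟨⟨hz, .inr (hp 0).1⟩, fun h => Finset.disjoint_left.1 hdis hz (h ▸ (hp 0).1), (hp 0).2⟩
    obtain ⟨⟨z, p⟩, hU, hmin⟩ := Finset.exists_min_image U m hne
    simp only [U, Finset.mem_filter, Finset.mem_product] at hU
    obtain ⟨⟨hz, hp⟩, hpz, hcp⟩ := hU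
    have key : ∀ s ∈ S, s ≠ z → c z s → r z p s := by
      intro s hs hsz hcs
      by_contra hr
      have hU' : (s, z) ∈ U := by
        simp only [U, Finset.mem_filter, Finset.mem_product, Finset.mem_union]
        exact ⟨⟨hs, .inl hz⟩, hsz.symm, csym _ _ hcs⟩
      have hlt : m (s, z) < m (z, p) := by
        refine Finset.card_lt_card ?_
        rw [Finset.ssubset_iff_of_subset]
        · refine ⟨s, ?_, ?_⟩
          · simp only [Finset.mem_filter]; exact ⟨hs, hsz, hcs, hr⟩
          · simp
        · intro t ht
          simp only [Finset.mem_filter] at ht ⊢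
          obtain ⟨htS, hts, hct, hrt⟩ := ht
          have htz : t ≠ z := by
            rintro rfl
            exact hrt (hrefl s hs t (Finset.mem_union_left _ htS) hts hct)
          refine ⟨htS, htz, ctr _ _ _ hcs hct, fun hpt => ?_⟩
          rcases H z hz s hs hsz.symm t (Finset.mem_union_left _ htS) htz hts
            (csym _ _ (ctr _ _ _ hcs hct)) (csym _ _ hct) with h | h
          · exact hr (rtr _ _ _ _ hpt h)
          · exact hrt (rsym _ _ _ h)
      exact absurd (hmin _ hU') (by omega)
    obtain ⟨p', hp', hpr⟩ := T z hz
    obtain ⟨i, j, hij, hi, hj⟩ : ∃ i j, i ≠ j ∧ ¬ r z p (p' i) ∧ ¬ r z p (p' j) := by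
      have hh : ∀ i j, i ≠ j → r z p (p' i) → ¬ r z p (p' j) := fun i j hij h1 h2 =>
        hpr i j hij (rtr _ _ _ _ (rsym _ _ _ h1) h2)
      by_cases h0 : r z p (p' 0)
      · exact ⟨1, 2, by decide, hh 0 1 (by decide) h0, hh 0 2 (by decide) h0⟩
      · by_cases h1 : r z p (p' 1)
        · exact ⟨0, 2, by decide, h0, hh 1 2 (by decide) h1⟩
        · exact ⟨0, 1, by decide, h0, h1⟩
    have hq := hpr i j hij
    set q1 := p' i with hq1
    set q2 := p' j with hq2
    obtain ⟨hq1D, hq1c⟩ := hp' i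
    obtain ⟨hq2D, hq2c⟩ := hp' j
    rw [← hq1] at hq1D hq1c
    rw [← hq2] at hq2D hq2c
    have neSD : ∀ s ∈ S, ∀ q ∈ D, q ≠ s := fun s hs q hq h => Finset.disjoint_left.1 hdis hs (h ▸ hq)
    have hq12 : q2 ≠ q1 := by
      intro h
      apply hq
      rw [h]
      exact hrefl z hz q1 (Finset.mem_union_right _ hq1D) (neSD z hz _ hq1D) hq1c
    have hsub1 : S.erase z ⊆ S := Finset.erase_subset _ _
    have hsub2 : D.erase q1 ⊆ D := Finset.erase_subset _ _
    have hU := Finset.union_subset_union hsub1 hsub2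
    have hfin := ih (S.erase z) (D.erase q1) (by rw [Finset.card_erase_of_mem hz]; omega)
      (hdis.mono hsub1 hsub2)
      (fun z hz p hp => hrefl z (hsub1 hz) p (hU hp))
      (fun z hz z' hz' hne w hw => H z (hsub1 hz) z' (hsub1 hz') hne w (hU hw)) ?_
    · rw [Finset.card_erase_of_mem hz, Finset.card_erase_of_mem hq1D] at hfin
      have : 0 < D.card := Finset.card_pos.2 ⟨_, hq1D⟩
      omega
    · intro z' hz'
      have hz'S := hsub1 hz'
      have hzz' : z' ≠ z := Finset.ne_of_mem_erase hz'
      obtain ⟨t, ht, htr⟩ := T z' hz'S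
      have hA : c z' q1 → c z' q2 ∧ r z' q1 q2 := by
        intro hc
        have hczz : c z z' := ctr _ _ _ hq1c (csym _ _ hc)
        have hc2 : c z' q2 := ctr _ _ _ (csym _ _ hczz) hq2c
        have hpz' := key z' hz'S hzz' hczz
        have f : ∀ q ∈ D, c z q → c z' q → ¬ r z p q → r z' q z := by
          intro q hqD h1 h2 h3
          rcases H z hz z' hz'S hzz'.symm q (Finset.mem_union_right _ hqD) (neSD z hz q hqD)
            (neSD z' hz'S q hqD) (csym _ _ h1) (csym _ _ h2) with h | h
          · exact absurd (rtr _ _ _ _ hpz' (rsym _ _ _ h)) h3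
          · exact h
        exact ⟨hc2, rtr _ _ _ _ (f q1 hq1D hq1c hc hi) (rsym _ _ _ (f q2 hq2D hq2c hc2 hj))⟩
      refine ⟨fun k => if t k = q1 then q2 else t k, ?_, ?_⟩
      · intro k
        dsimp only
        split_ifs with h
        · exact ⟨Finset.mem_erase.2 ⟨hq12, hq2D⟩, (hA (h ▸ (ht k).2)).1⟩
        · exact ⟨Finset.mem_erase.2 ⟨h, (ht k).1⟩, (ht k).2⟩
      · intro k l hkl
        dsimp only
        split_ifs with h1 h2 h2
        · exfalso
          apply htr k l hkl
          rw [h1, h2]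
          exact hrefl z' hz'S q1 (Finset.mem_union_right _ hq1D) (neSD _ hz'S _ hq1D) (h1 ▸ (ht k).2)
        · intro h
          exact htr k l hkl (h1 ▸ rtr _ _ _ _ (hA (h1 ▸ (ht k).2)).2 h)
        · intro h
          exact htr k l hkl (h2 ▸ rtr _ _ _ _ h (rsym _ _ _ (hA (h2 ▸ (ht l).2)).2))
        · exact htr k l hkl

def Inf {d : ℕ} (S : Set (Zd d)) (a : Zd d) : Prop := ∀ B : Finset (Zd d), ∃ b, b ∉ B ∧ RR S a b

def trif {d : ℕ} (F : Finset (Zd d)) (z : Zd d) (J : Set (Zd d)) : Prop :=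
  (∀ f ∈ F, f + z ∈ J) ∧ ∃ a : Fin 3 → Zd d, (∀ i, RR J z (a i)) ∧
    (∀ i, Inf (J \ {x | x - z ∈ F}) (a i)) ∧
    ∀ i j, i ≠ j → ¬ RR (J \ {x | x - z ∈ F}) (a i) (a j)

lemma RR.shift {d : ℕ} {S : Set (Zd d)} {a b : Zd d} (z : Zd d) (h : RR S a b) :
    RR {x | x - z ∈ S} (a + z) (b + z) := by
  refine h.rec' (p := fun b => RR {x | x - z ∈ S} (a + z) (b + z)) ?_ ?_
  · intro ha; exact RR.refl (by simpa using ha)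
  · intro b c _ ih hadj hc
    refine ih.step ?_ (by simpa using hc)
    unfold adj at *
    simpa using hadj

lemma exit_pt {d : ℕ} {S : Set (Zd d)} {a b : Zd d} (B D : Finset (Zd d))
    (hBD : ∀ x ∈ B, ∀ y, adj y x → y ∉ B → y ∈ D) (ha : a ∈ B) (hb : b ∉ B) (h : RR S a b) :
    ∃ p ∈ D, RR S a p := by
  have : b ∈ B ∨ ∃ p ∈ D, RR S a p := by
    refine h.rec' (p := fun b => b ∈ B ∨ ∃ p ∈ D, RR S a p) (fun _ => .inl ha) ?_
    intro b c hab ih hadj hc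
    rcases ih with ih | ih
    · by_cases hcB : c ∈ B
      · exact .inl hcB
      · exact .inr ⟨c, hBD b ih c hadj hcB, hab.step hadj hc⟩
    · exact .inr ih
  exact this.resolve_left hb

lemma exit_pt' {d : ℕ} {J Fz : Set (Zd d)} {a z : Zd d} (B D : Finset (Zd d))
    (hBD : ∀ x ∈ B, ∀ y, adj y x → y ∉ B → y ∈ D) (ha : a ∉ B) (hz : z ∈ B)
    (hF : ∀ x ∈ Fz, x ∈ B) (h : RR J a z) :
    ∃ p ∈ D, RR (J \ Fz) a p := by
  have : (z ∉ B ∧ RR (J \ Fz) a z) ∨ ∃ p ∈ D, RR (J \ Fz) a p := by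
    refine h.rec' (p := fun b => (b ∉ B ∧ RR (J \ Fz) a b) ∨ ∃ p ∈ D, RR (J \ Fz) a p) ?_ ?_
    · intro haJ
      exact .inl ⟨ha, RR.refl ⟨haJ, fun h => ha (hF _ h)⟩⟩
    · intro b c _ ih hadj hc
      rcases ih with ⟨hb, ih⟩ | ih
      · by_cases hcB : c ∈ B
        · exact .inr ⟨b, hBD c hcB b (adj_symm hadj) hb, ih⟩
        · exact .inl ⟨hcB, ih.step hadj ⟨hc, fun h => hcB (hF _ h)⟩⟩
      · exact .inr ih
  exact this.resolve_left (fun h => h.1 hz)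

lemma trif_count {d : ℕ} (F : Finset (Zd d)) (h0 : (0 : Zd d) ∈ F) (hF : ∀ f ∈ F, RR (F : Set (Zd d)) 0 f)
    (G B D : Finset (Zd d)) (hBD : ∀ x ∈ B, ∀ y, adj y x → y ∉ B → y ∈ D)
    (hdis : Disjoint B D) (hGB : ∀ z ∈ G, ∀ f ∈ F, f + z ∈ B)
    (hGG : ∀ z ∈ G, ∀ z' ∈ G, z ≠ z' → ∀ x, x - z ∈ F → x - z' ∉ F)
    (J : Set (Zd d)) (S : Finset (Zd d)) (hS : S ⊆ G) (hT : ∀ z ∈ S, trif F z J) :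
    S.card ≤ D.card := by
  have hSB : S ⊆ B := fun z hz => by simpa using hGB z (hS hz) 0 h0
  have hzz : ∀ z : Zd d, z - z ∈ F := fun z => by simpa using h0
  have hFB : ∀ z ∈ S, ∀ x, x - z ∈ F → x ∈ B := fun z hz x hx => by
    simpa using hGB z (hS hz) _ hx
  have hFJ : ∀ z ∈ S, ∀ x, x - z ∈ F → RR (J ∩ {x | x - z ∈ F}) z x := by
    intro z hz x hx
    have h1 := (hF _ hx).shift z
    rw [zero_add, sub_add_cancel] at h1
    refine h1.mono ?_
    intro y hy
    refine ⟨?_, hy⟩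
    have := (hT z hz).1 _ hy
    simpa using this
  refine counting (fun a b => RR J a b) (fun z a b => RR (J \ {x | x - z ∈ F}) a b)
    (fun a b h => h.symm) (fun a b c h h' => h.trans h') (fun z a b h => h.symm)
    (fun z a b e h h' => h.trans h') S.card S D rfl (hdis.mono_left hSB) ?_ ?_ ?_
  · intro z hz p hp hpz hc
    refine RR.refl ⟨hc.right, fun h => ?_⟩
    rcases Finset.mem_union.1 hp with hp | hp
    · exact hGG z (hS hz) p (hS hp) hpz.symm p h (hzz p)
    · exact Finset.disjoint_left.1 hdis (hFB z hz p h) hp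
  · intro z hz z' hz' hne w hw hwz hwz' hcz hcz'
    have hnot : ∀ y ∈ S, w ≠ y → w - y ∉ F := by
      intro y hy hwy h
      rcases Finset.mem_union.1 hw with hw | hw
      · exact hGG y (hS hy) w (hS hw) hwy.symm w h (hzz w)
      · exact Finset.disjoint_left.1 hdis (hFB y hy w h) hw
    have main : (RR (J \ {x | x - z ∈ F}) w z' ∨ RR (J \ {x | x - z' ∈ F}) w z) ∨
        (RR (J \ {x | x - z ∈ F}) w z ∧ RR (J \ {x | x - z' ∈ F}) w z) := by
      refine hcz.rec' (p := fun b => (RR (J \ {x | x - z ∈ F}) w z' ∨ RR (J \ {x | x - z' ∈ F}) w z) ∨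
        (RR (J \ {x | x - z ∈ F}) w b ∧ RR (J \ {x | x - z' ∈ F}) w b)) ?_ ?_
      · intro hwJ
        exact .inr ⟨RR.refl ⟨hwJ, hnot z hz hwz⟩, RR.refl ⟨hwJ, hnot z' hz' hwz'⟩⟩
      · intro b c _ ih hadj hc
        rcases ih with ih | ⟨ih1, ih2⟩
        · exact .inl ih
        · by_cases h1 : c - z ∈ F
          · have h2 : c - z' ∉ F := hGG z (hS hz) z' (hS hz') hne c h1
            refine .inl (.inr ((ih2.step hadj ⟨hc, h2⟩).trans ?_))
            exact (hFJ z hz c h1).symm.mono fun y hy => ⟨hy.1, hGG z (hS hz) z' (hS hz') hne y hy.2⟩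
          · by_cases h2 : c - z' ∈ F
            · refine .inl (.inl ((ih1.step hadj ⟨hc, h1⟩).trans ?_))
              exact (hFJ z' hz' c h2).symm.mono
                fun y hy => ⟨hy.1, hGG z' (hS hz') z (hS hz) hne.symm y hy.2⟩
            · exact .inr ⟨ih1.step hadj ⟨hc, h1⟩, ih2.step hadj ⟨hc, h2⟩⟩
    rcases main with h | h
    · exact h
    · exact absurd (hzz z) h.1.right.2
  · intro z hz
    obtain ⟨-, a, h1, h2, h3⟩ := hT z hz
    have : ∀ i, ∃ p ∈ D, RR (J \ {x | x - z ∈ F}) (a i) p := by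
      intro i
      obtain ⟨b, hb, hab⟩ := h2 i B
      by_cases haB : a i ∈ B
      · exact exit_pt B D hBD haB hb hab
      · exact exit_pt' B D hBD haB (hSB hz) (hFB z hz) (h1 i).symm
    choose p hp hp' using this
    refine ⟨p, fun i => ⟨hp i, (h1 i).trans ((hp' i).mono Set.sdiff_subset)⟩, fun i j hij h => ?_⟩
    exact h3 i j hij ((hp' i).trans (h.trans (hp' j).symm))

end RI

namespace RI

def occ {d : ℕ} (ω : Zd d → Bool) : Set (Zd d) := {z | ω z = false}

lemma P_trans {d : ℕ} {P : Zd d → Measure (ℕ → Zd d)} (hP : IsSRW d P) (x z : Zd d) :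
    P (x + z) = (P x).map (fun w n => w n + z) := by
  have := hP.1
  have hm : Measurable (fun (w : ℕ → Zd d) n => w n + z) := by
    refine measurable_pi_lambda _ fun n => ?_
    have h : Measurable (fun w : ℕ → Zd d => w n) := measurable_pi_apply n
    exact (measurable_of_countable (fun y : Zd d => y + z)).comp h
  have : IsProbabilityMeasure ((P x).map (fun w n => w n + z)) :=
    Measure.isProbabilityMeasure_map hm.aemeasurable
  refine ext_cyl ?_ ?_
  · intro N γ
    rw [Measure.map_apply hm (meas_cyl N γ)]
    have : (fun (w : ℕ → Zd d) n => w n + z) ⁻¹' cyl N γ = cyl N (fun n => γ n - z) := by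
      ext w
      simp only [cyl, Set.mem_preimage, Set.mem_ofPred_eq, eq_sub_iff_add_eq]
    rw [this, P_cyl hP, P_cyl hP]
    simp only [sub_eq_iff_eq_add]
    simp only [adj, Pi.sub_apply, sub_sub_sub_cancel_right]
    congr 1
  · simp

lemma capa_trans {d : ℕ} {P : Zd d → Measure (ℕ → Zd d)} (hP : IsSRW d P) (A : Finset (Zd d)) (z : Zd d) :
    capa d P (A.image (· + z)) = capa d P A := by
  unfold capa
  rw [Finset.sum_image (fun a _ b _ h => add_right_cancel h)]
  refine Finset.sum_congr rfl fun x hx => ?_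
  unfold eqm
  rw [if_pos hx, if_pos (Finset.mem_image_of_mem _ hx), P_trans hP x z]
  have hm : Measurable (fun (w : ℕ → Zd d) n => w n + z) := by
    refine measurable_pi_lambda _ fun n => ?_
    have h : Measurable (fun w : ℕ → Zd d => w n) := measurable_pi_apply n
    exact (measurable_of_countable (fun y : Zd d => y + z)).comp h
  rw [Measure.map_apply hm (meas_esc _)]
  congr 1
  ext w
  simp [escSet]

lemma meas_shω {d : ℕ} (z : Zd d) : Measurable (fun (ω : Zd d → Bool) y => ω (y + z)) :=
  measurable_pi_lambda _ fun y => measurable_pi_apply (y + z)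

lemma Q_trans {d : ℕ} {P : Zd d → Measure (ℕ → Zd d)} (hP : IsSRW d P)
    {u : ℝ} {Q : Measure (Zd d → Bool)} (hQ : IsVacantLaw d P u Q) (z : Zd d) :
    Q.map (fun ω y => ω (y + z)) = Q := by
  have := hQ.1
  refine ext_VA fun A => ?_
  rw [Measure.map_apply (meas_shω z) (meas_VA A)]
  have : (fun (ω : Zd d → Bool) y => ω (y + z)) ⁻¹' VA A = VA (A.image (· + z)) := by
    ext ω
    simp only [VA, Set.mem_preimage, Set.mem_ofPred_eq, Finset.forall_mem_image]
  rw [this]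
  have e1 : Q (VA A) = _ := hQ.2 A
  have e2 : Q (VA (A.image (· + z))) = _ := hQ.2 (A.image (· + z))
  rw [e1, e2, capa_trans hP]

lemma trif_shift {d : ℕ} {F : Finset (Zd d)} {z : Zd d} {J : Set (Zd d)} (y : Zd d) (h : trif F z J) :
    trif F (z + y) {x | x - y ∈ J} := by
  have hset : ({x | x - y ∈ J} : Set (Zd d)) \ {x | x - (z + y) ∈ F} = {x | x - y ∈ J \ {x | x - z ∈ F}} := by
    ext x
    simp [sub_sub, add_comm]
  obtain ⟨h1, a, h2, h3, h4⟩ := h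
  refine ⟨fun f hf => ?_, fun i => a i + y, fun i => (h2 i).shift y, ?_, ?_⟩
  · have := h1 f hf
    simpa [← add_assoc] using this
  · intro i B
    rw [hset]
    obtain ⟨b, hb, hr⟩ := h3 i (B.image (· - y))
    refine ⟨b + y, fun h => hb ?_, hr.shift y⟩
    exact Finset.mem_image.2 ⟨_, h, by simp⟩
  · intro i j hij h
    rw [hset] at h
    have := h.shift (-y)
    simp only [add_neg_cancel_right] at this
    refine h4 i j hij (this.mono ?_)
    intro x hx
    simpa using hx

lemma trif_occ {d : ℕ} (F : Finset (Zd d)) (z : Zd d) (ω : Zd d → Bool) :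
    trif F z (occ ω) ↔ trif F 0 (occ (fun y => ω (y + z))) := by
  constructor
  · intro h
    have := trif_shift (-z) h
    rw [add_neg_cancel] at this
    simpa [occ] using this
  · intro h
    have := trif_shift z h
    rw [zero_add] at this
    simpa [occ] using this

lemma meas_trif {d : ℕ} (F : Finset (Zd d)) (z : Zd d) :
    MeasurableSet {ω : Zd d → Bool | trif F z (occ ω)} := by
  have hR : ∀ a b, MeasurableSet {ω : Zd d → Bool | RR (occ ω) a b} := fun a b =>
    meas_RR _ (fun z => meas_pt z false) a b
  have hR' : ∀ a b, MeasurableSet {ω : Zd d → Bool | RR (occ ω \ {x | x - z ∈ F}) a b} := fun a b =>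
    meas_RR _ (fun y => (meas_pt y false).inter (MeasurableSet.const _)) a b
  have : {ω : Zd d → Bool | trif F z (occ ω)} = (⋂ f ∈ F, {ω | ω (f + z) = false}) ∩
      ⋃ a : Fin 3 → Zd d, (⋂ i, {ω | RR (occ ω) z (a i)}) ∩
        ((⋂ i, ⋂ B : Finset (Zd d), ⋃ b, ⋃ (_ : b ∉ B), {ω | RR (occ ω \ {x | x - z ∈ F}) (a i) b}) ∩
        ⋂ i, ⋂ j, ⋂ (_ : i ≠ j), {ω | RR (occ ω \ {x | x - z ∈ F}) (a i) (a j)}ᶜ) := by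
    ext ω
    simp only [trif, Inf, Set.mem_ofPred_eq, Set.mem_inter_iff, Set.mem_iInter, Set.mem_iUnion,
      Set.mem_compl_iff, exists_prop]
    rfl
  rw [this]
  refine (Finset.measurableSet_biInter _ fun f _ => meas_pt _ _).inter
    (MeasurableSet.iUnion fun a => ((MeasurableSet.iInter fun i => hR _ _).inter
      ((MeasurableSet.iInter fun i => MeasurableSet.iInter fun B => MeasurableSet.iUnion fun b =>
        MeasurableSet.iUnion fun _ => hR' _ _).inter
        (MeasurableSet.iInter fun i => MeasurableSet.iInter fun j => MeasurableSet.iInter fun _ =>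
          (hR' _ _).compl))))

lemma adj_le {d : ℕ} {x y : Zd d} (h : adj y x) (i : Fin d) : x i - 1 ≤ y i ∧ y i ≤ x i + 1 := by
  have : (y i - x i).natAbs ≤ 1 := by
    rw [← h]
    exact Finset.single_le_sum (f := fun i => (y i - x i).natAbs) (fun _ _ => Nat.zero_le _) (Finset.mem_univ i)
  omega

lemma card_box {d : ℕ} (a b : ℤ) :
    (Finset.Icc (fun _ => a : Zd d) (fun _ => b)).card = (b + 1 - a).toNat ^ d := by
  rw [Pi.card_Icc]; simp

lemma mem_box {d : ℕ} (a b : ℤ) (x : Zd d) :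
    x ∈ Finset.Icc (fun _ => a : Zd d) (fun _ => b) ↔ ∀ i, a ≤ x i ∧ x i ≤ b := by
  rw [Finset.mem_Icc, Pi.le_def, Pi.le_def, forall_and]

lemma trif_bound {d : ℕ} {P : Zd d → Measure (ℕ → Zd d)} (hP : IsSRW d P)
    {u : ℝ} {Q : Measure (Zd d → Bool)} (hQ : IsVacantLaw d P u Q)
    (F : Finset (Zd d)) (h0 : (0 : Zd d) ∈ F) (hF : ∀ f ∈ F, RR (F : Set (Zd d)) 0 f)
    (M : ℕ) (hM : ∀ f ∈ F, ∀ i, -(M:ℤ) ≤ f i ∧ f i ≤ M) (n : ℕ) :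
    ((n + 1 : ℕ) : ℝ≥0∞) ^ d * Q {ω | trif F 0 (occ ω)} ≤
      (((2 * M + 1) * (n + 1) + (2 * M + 1) + 3) ^ d - ((2 * M + 1) * (n + 1) + (2 * M + 1) + 1) ^ d : ℕ) := by
  classical
  have := hQ.1
  set K : ℤ := 2 * M + 1 with hK
  have hKp : 0 < K := by omega
  let B : Finset (Zd d) := Finset.Icc (fun _ => -K) (fun _ => K * (n + 1))
  let D : Finset (Zd d) := Finset.Icc (fun _ => -K - 1) (fun _ => K * (n + 1) + 1) \ B
  let G : Finset (Zd d) := (Finset.Icc (fun _ => (0:ℤ)) (fun _ => (n:ℤ))).image (fun k i => K * k i)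
  have hBs : B ⊆ Finset.Icc (fun _ => -K - 1) (fun _ => K * (n + 1) + 1) := by
    intro x hx
    rw [mem_box] at hx ⊢
    exact fun i => ⟨by linarith [(hx i).1], by linarith [(hx i).2]⟩
  have hG : G.card = (n+1)^d := by
    rw [Finset.card_image_of_injective, card_box]
    · congr 1
    · intro a b h
      funext i
      exact mul_left_cancel₀ hKp.ne' (congrFun h i)
  have hD : D.card = ((2 * M + 1) * (n + 1) + (2 * M + 1) + 3) ^ d - ((2 * M + 1) * (n + 1) + (2 * M + 1) + 1) ^ d := by
    have hp : 0 ≤ K * (n+1) := by positivity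
    have hp' : K * (n+1) = (((2 * M + 1) * (n + 1) : ℕ) : ℤ) := by rw [hK]; push_cast; ring
    rw [Finset.card_sdiff_of_subset hBs, card_box, card_box]
    congr 2 <;> omega
  have count : ∀ ω : Zd d → Bool, (G.filter (fun z => trif F z (occ ω))).card ≤ D.card := by
    intro ω
    refine trif_count F h0 hF G B D ?_ ?_ ?_ ?_ (occ ω) _ (Finset.filter_subset _ _) ?_
    · intro x hx y hadj hy
      rw [Finset.mem_sdiff]
      refine ⟨?_, hy⟩
      rw [mem_box] at hx ⊢
      intro i
      have := adj_le hadj i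
      have := hx i
      omega
    · exact Finset.disjoint_sdiff
    · intro z hz f hf
      obtain ⟨k, hk, rfl⟩ := Finset.mem_image.1 hz
      rw [mem_box] at hk ⊢
      intro i
      obtain ⟨h1, h2⟩ := hk i
      obtain ⟨h3, h4⟩ := hM f hf i
      simp only [Pi.add_apply]
      constructor <;> nlinarith
    · intro z hz z' hz' hne x hx hx'
      obtain ⟨k, hk, rfl⟩ := Finset.mem_image.1 hz
      obtain ⟨k', hk', rfl⟩ := Finset.mem_image.1 hz'
      apply hne
      funext i
      have h1 := hM _ hx i
      have h2 := hM _ hx' i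
      simp only [Pi.sub_apply] at h1 h2
      have : k i = k' i := by
        by_contra hkk
        rcases lt_or_gt_of_ne hkk with h | h
        · have : K * (k i + 1) ≤ K * k' i := mul_le_mul_of_nonneg_left (by omega) hKp.le
          rw [mul_add] at this
          omega
        · have : K * (k' i + 1) ≤ K * k i := mul_le_mul_of_nonneg_left (by omega) hKp.le
          rw [mul_add] at this
          omega
      rw [this]
    · intro z hz; exact (Finset.mem_filter.1 hz).2
  have hsame : ∀ z, Q {ω | trif F z (occ ω)} = Q {ω | trif F 0 (occ ω)} := by
    intro z
    conv_rhs => rw [← Q_trans hP hQ z]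
    rw [Measure.map_apply (meas_shω z) (meas_trif F 0)]
    congr 1
    ext ω
    exact trif_occ F z ω
  calc ((n + 1 : ℕ) : ℝ≥0∞) ^ d * Q {ω | trif F 0 (occ ω)} = ∑ z ∈ G, Q {ω | trif F z (occ ω)} := by
        rw [Finset.sum_congr rfl (fun z _ => hsame z), Finset.sum_const, hG]
        simp
    _ = ∫⁻ ω, ∑ z ∈ G, ({ω | trif F z (occ ω)}.indicator 1 ω) ∂Q := by
        rw [lintegral_finsetSum _ (fun z _ => measurable_one.indicator (meas_trif F z))]
        exact Finset.sum_congr rfl fun z _ => (lintegral_indicator_one (meas_trif F z)).symm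
    _ ≤ ∫⁻ ω, (D.card : ℝ≥0∞) ∂Q := by
        refine lintegral_mono fun ω => ?_
        simp only [Set.indicator_apply, Set.mem_ofPred_eq, Pi.one_apply]
        rw [Finset.sum_boole]
        exact_mod_cast count ω
    _ = _ := by rw [lintegral_const, measure_univ, mul_one, hD]

lemma trif_zero {d : ℕ} {P : Zd d → Measure (ℕ → Zd d)} (hP : IsSRW d P)
    {u : ℝ} {Q : Measure (Zd d → Bool)} (hQ : IsVacantLaw d P u Q)
    (F : Finset (Zd d)) (h0 : (0 : Zd d) ∈ F) (hF : ∀ f ∈ F, RR (F : Set (Zd d)) 0 f) :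
    ∀ᵐ ω ∂Q, ¬ trif F 0 (occ ω) := by
  have := hQ.1
  obtain ⟨M, hM⟩ : ∃ M : ℕ, ∀ f ∈ F, ∀ i, -(M:ℤ) ≤ f i ∧ f i ≤ M := by
    refine ⟨F.sup (fun f => Finset.univ.sup (fun i => (f i).natAbs)), fun f hf i => ?_⟩
    have h1 : (f i).natAbs ≤ Finset.univ.sup (fun i => (f i).natAbs) :=
      Finset.le_sup (f := fun i => (f i).natAbs) (Finset.mem_univ i)
    have h2 := Finset.le_sup (f := fun f : Zd d => Finset.univ.sup (fun i => (f i).natAbs)) hf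
    omega
  set t := Q.real {ω | trif F 0 (occ ω)} with ht
  have hle : ∀ n : ℕ, t ≤ ((2 * M + 1 : ℝ) + (2 * M + 4) * (1 / ((n:ℝ) + 1))) ^ d
      - ((2 * M + 1 : ℝ) + (2 * M + 2) * (1 / ((n:ℝ) + 1))) ^ d := by
    intro n
    have h := trif_bound hP hQ F h0 hF M hM n
    have h' := ENNReal.toReal_mono (ENNReal.natCast_ne_top _) h
    rw [ENNReal.toReal_mul, ENNReal.toReal_natCast, Nat.cast_sub (Nat.pow_le_pow_left (by omega) _)] at h'
    rw [ENNReal.toReal_pow, ENNReal.toReal_natCast] at h'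
    have hn : (0:ℝ) < (n:ℝ) + 1 := by positivity
    have e1 : ((2 * M + 1 : ℝ) + (2 * M + 4) * (1 / ((n:ℝ) + 1))) ^ d
      - ((2 * M + 1 : ℝ) + (2 * M + 2) * (1 / ((n:ℝ) + 1))) ^ d =
      (((2 * M + 1 : ℝ) * (n + 1) + (2 * M + 1) + 3) ^ d - ((2 * M + 1 : ℝ) * (n + 1) + (2 * M + 1) + 1) ^ d) / ((n:ℝ)+1)^d := by
      rw [sub_div, ← div_pow, ← div_pow]
      congr 2 <;> field_simp <;> ring
    rw [e1, le_div_iff₀ (by positivity), mul_comm]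
    push_cast at h'
    exact h'
  have hlim : Filter.Tendsto (fun n : ℕ => ((2 * M + 1 : ℝ) + (2 * M + 4) * (1 / ((n:ℝ) + 1))) ^ d
      - ((2 * M + 1 : ℝ) + (2 * M + 2) * (1 / ((n:ℝ) + 1))) ^ d) Filter.atTop (nhds 0) := by
    have h1 := tendsto_one_div_add_atTop_nhds_zero_nat (𝕜 := ℝ)
    have h2 := (((h1.const_mul (2 * (M:ℝ) + 4)).const_add (2 * (M:ℝ) + 1)).pow d).sub
      (((h1.const_mul (2 * (M:ℝ) + 2)).const_add (2 * (M:ℝ) + 1)).pow d)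
    simpa using h2
  have ht0 : t ≤ 0 := ge_of_tendsto' hlim hle
  have : t = 0 := le_antisymm ht0 measureReal_nonneg
  rw [ae_iff]
  simp only [not_not]
  exact (measureReal_eq_zero_iff (measure_ne_top _ _)).1 this

end RI

namespace RI

lemma P_nn {d : ℕ} (hd : 3 ≤ d) {P : Zd d → Measure (ℕ → Zd d)} (hP : IsSRW d P) (x : Zd d) :
    ∀ᵐ w ∂P x, ∀ n, adj (w (n+1)) (w n) := by
  rw [ae_all_iff]
  intro n
  have hm : ∀ n, MeasurableSet {w : ℕ → Zd d | ¬ adj (w (n+1)) (w n)} := by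
    intro n
    have h1 : Measurable (fun w : ℕ → Zd d => w n) := measurable_pi_apply n
    have h2 : Measurable (fun w : ℕ → Zd d => w (n+1)) := measurable_pi_apply (n+1)
    have h3 : MeasurableSet {p : Zd d × Zd d | ¬ adj p.1 p.2} := Set.Countable.measurableSet (Set.to_countable _)
    exact (h2.prodMk h1) h3
  have : ∀ x, P x {w | ¬ adj (w (n+1)) (w n)} = 0 := by
    induction n with
    | zero =>
      intro x
      rw [P_step hd hP x (hm 0)]
      refine mul_eq_zero.2 (.inr (Finset.sum_eq_zero fun s _ => ?_))
      refine measure_mono_null (t := {w | ¬ w 0 = x + stp s}) ?_ (P_start hP _)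
      intro w hw h
      apply hw
      change adj (w 0) x
      rw [h]; exact adj_stp x s
    | succ n ih =>
      intro x
      rw [P_step hd hP x (hm (n+1))]
      refine mul_eq_zero.2 (.inr (Finset.sum_eq_zero fun s _ => ?_))
      exact ih (x + stp s)
  exact this x

def glue {d : ℕ} (N : ℕ) (γ w : ℕ → Zd d) : ℕ → Zd d := fun n => if n ≤ N then γ n else w (n - N)

lemma meas_glue {d : ℕ} (N : ℕ) (γ : ℕ → Zd d) : Measurable (glue N γ) := by
  refine measurable_pi_lambda _ fun n => ?_
  unfold glue
  split_ifs
  · exact measurable_const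
  · exact measurable_pi_apply _

lemma P_path_ae {d : ℕ} (hd : 3 ≤ d) {P : Zd d → Measure (ℕ → Zd d)} (hP : IsSRW d P)
    (N : ℕ) (γ : ℕ → Zd d) (hγ : ∀ k < N, adj (γ (k + 1)) (γ k)) {p : (ℕ → Zd d) → Prop}
    (h : ∀ᵐ w ∂P (γ 0), p w) : ∀ᵐ w ∂P (γ N), p (glue N γ w) := by
  obtain ⟨t, ht1, ht2, ht3⟩ := exists_measurable_superset_of_null (ae_iff.1 h)
  have hE : MeasurableSet (glue N γ ⁻¹' t) := meas_glue N γ ht2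
  have h1 := P_path hd hP hE N γ hγ
  have h2 : P (γ 0) (cyl N γ ∩ sh N ⁻¹' (glue N γ ⁻¹' t)) = 0 := by
    refine measure_mono_null ?_ ht3
    rintro w ⟨hw1, hw2⟩
    have : glue N γ (sh N w) = w := by
      funext n
      unfold glue sh
      split_ifs with hn
      · exact (hw1 n hn).symm
      · congr 1; omega
    rw [← this]; exact hw2
  rw [h2] at h1
  have h3 : P (γ N) (glue N γ ⁻¹' t) = 0 := by
    rcases mul_eq_zero.1 h1.symm with h | h
    · exact absurd h (pow_ne_zero _ (ENNReal.inv_ne_zero.2 two_d_ne_top))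
    · exact h
  exact measure_mono_null (t := glue N γ ⁻¹' t) (fun w hw => ht1 (show ¬ p (glue N γ w) from hw)) h3

lemma path_ext {d : ℕ} (N : ℕ) (γ : ℕ → Zd d) (hγ : ∀ k < N, adj (γ (k + 1)) (γ k)) (v : Zd d) :
    ∃ (N' : ℕ) (γ' : ℕ → Zd d), N ≤ N' ∧ (∀ k ≤ N, γ' k = γ k) ∧ (∀ k < N', adj (γ' (k + 1)) (γ' k)) ∧ γ' N' = γ N + v := by
  refine zd_induct (p := fun v => ∃ (N' : ℕ) (γ' : ℕ → Zd d), N ≤ N' ∧ (∀ k ≤ N, γ' k = γ k) ∧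
    (∀ k < N', adj (γ' (k + 1)) (γ' k)) ∧ γ' N' = γ N + v) ?_ ?_ v
  · exact ⟨N, γ, le_rfl, fun _ _ => rfl, hγ, (add_zero _).symm⟩
  · rintro v s ⟨N', γ', h1, h2, h3, h4⟩
    refine ⟨N'+1, fun k => if k ≤ N' then γ' k else γ N + (v + stp s), by omega, ?_, ?_, by simp⟩
    · intro k hk
      dsimp only
      rw [if_pos (by omega), h2 k hk]
    · intro k hk
      dsimp only
      rw [if_pos (by omega : k ≤ N')]
      split_ifs with h
      · exact h3 k (by omega)
      · have : k = N' := by omega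
        rw [this, h4, ← add_assoc]
        exact adj_stp _ s

lemma path_cover {d : ℕ} (D : Finset (Zd d)) :
    ∃ (N : ℕ) (γ : ℕ → Zd d), γ 0 = 0 ∧ (∀ k < N, adj (γ (k + 1)) (γ k)) ∧ ∀ z ∈ D, ∃ k ≤ N, γ k = z := by
  classical
  induction D using Finset.induction_on with
  | empty => exact ⟨0, fun _ => 0, rfl, fun k hk => by omega, fun z hz => by simp at hz⟩
  | insert z D _ ih =>
    obtain ⟨N, γ, h0, h1, h2⟩ := ih
    obtain ⟨N', γ', g1, g2, g3, g4⟩ := path_ext N γ h1 (z - γ N)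
    refine ⟨N', γ', by rw [g2 0 (Nat.zero_le _), h0], g3, ?_⟩
    intro y hy
    rcases Finset.mem_insert.1 hy with rfl | hy
    · exact ⟨N', le_rfl, by rw [g4]; simp⟩
    · obtain ⟨k, hk, rfl⟩ := h2 y hy
      exact ⟨k, by omega, g2 k hk⟩

def Bad {d : ℕ} (I : Set (Zd d)) (w w' : ℕ → Zd d) : Prop :=
  ∃ n : ℕ, ∀ i, n ≤ i → ∀ j, n ≤ j → ¬ RR (I ∪ {w i, w' j}) (w i) (w' j)

lemma meas_Bad {d : ℕ} (I : Set (Zd d)) :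
    MeasurableSet {p : (ℕ → Zd d) × (ℕ → Zd d) | Bad I p.2 p.1} := by
  have : {p : (ℕ → Zd d) × (ℕ → Zd d) | Bad I p.2 p.1} =
      ⋃ n : ℕ, ⋂ i, ⋂ (_ : n ≤ i), ⋂ j, ⋂ (_ : n ≤ j),
        {p : (ℕ → Zd d) × (ℕ → Zd d) | ¬ RR (I ∪ {p.2 i, p.1 j}) (p.2 i) (p.1 j)} := by
    ext p; simp [Bad]
  rw [this]
  refine MeasurableSet.iUnion fun n => MeasurableSet.iInter fun i => MeasurableSet.iInter fun _ =>
    MeasurableSet.iInter fun j => MeasurableSet.iInter fun _ => ?_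
  have h1 : Measurable (fun w : ℕ → Zd d => w i) := measurable_pi_apply i
  have h2 : Measurable (fun w : ℕ → Zd d => w j) := measurable_pi_apply j
  have h3 : MeasurableSet {p : Zd d × Zd d | ¬ RR (I ∪ {p.1, p.2}) p.1 p.2} :=
    Set.Countable.measurableSet (Set.to_countable _)
  exact ((h1.comp measurable_snd).prodMk (h2.comp measurable_fst)) h3

lemma Bad_sh {d : ℕ} (I : Set (Zd d)) (w w' : ℕ → Zd d) : Bad I (sh 1 w) w' ↔ Bad I w w' := by
  constructor
  · rintro ⟨n, hn⟩
    refine ⟨n+1, fun i hi j hj => ?_⟩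
    have := hn (i-1) (by omega) j (by omega)
    unfold sh at this
    rwa [Nat.sub_add_cancel (by omega)] at this
  · rintro ⟨n, hn⟩
    exact ⟨n, fun i hi j hj => hn (i+1) (by omega) j hj⟩

lemma Bad_sh' {d : ℕ} (I : Set (Zd d)) (w w' : ℕ → Zd d) : Bad I w (sh 1 w') ↔ Bad I w w' := by
  constructor
  · rintro ⟨n, hn⟩
    refine ⟨n+1, fun i hi j hj => ?_⟩
    have := hn i (by omega) (j-1) (by omega)
    unfold sh at this
    rwa [Nat.sub_add_cancel (by omega)] at this
  · rintro ⟨n, hn⟩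
    exact ⟨n, fun i hi j hj => hn i hi (j+1) (by omega)⟩

lemma dich {d : ℕ} (hd : 3 ≤ d) {P : Zd d → Measure (ℕ → Zd d)} (hP : IsSRW d P) (I : Set (Zd d)) :
    (∀ x y, ∀ᵐ w' ∂P y, ∀ᵐ w ∂P x, ¬ Bad I w w') ∨ (∀ x y, ∀ᵐ w' ∂P y, ∀ᵐ w ∂P x, Bad I w w') := by
  have := hP.1
  have hB : ∀ w', MeasurableSet {w | Bad I w w'} := fun w' => measurable_prodMk_left (meas_Bad I)
  have h1 : ∀ w', (∀ x, P x {w | Bad I w w'} = 0) ∨ (∀ x, P x {w | Bad I w w'} = 1) := fun w' =>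
    zero_one hd hP (hB w') (fun w => Bad_sh I w w')
  have hE : MeasurableSet {w' | P 0 {w | Bad I w w'} = 1} := by
    have := measurable_measure_prodMk_left (ν := P 0) (meas_Bad I)
    exact this (measurableSet_singleton 1)
  rcases zero_one hd hP hE (by
      intro w'
      simp only [Set.mem_ofPred_eq, Bad_sh']) with h | h
  · left
    intro x y
    have hy : ∀ᵐ w' ∂P y, ¬ (P 0 {w | Bad I w w'} = 1) := by
      rw [ae_iff]; simpa using h y
    filter_upwards [hy] with w' hw'
    rcases h1 w' with h | h
    · rw [ae_iff]; simpa using h x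
    · exact absurd (h 0) hw'
  · right
    intro x y
    have hy : ∀ᵐ w' ∂P y, P 0 {w | Bad I w w'} = 1 := by
      exact (mem_ae_iff_prob_eq_one hE).2 (h y)
    filter_upwards [hy] with w' hw'
    rcases h1 w' with h | h
    · rw [h 0] at hw'; exact absurd hw' zero_ne_one
    · exact (mem_ae_iff_prob_eq_one (hB w')).2 (h x)

lemma trif_of_bad {d : ℕ} (I J : Set (Zd d)) (F : Finset (Zd d)) (w : Fin 4 → ℕ → Zd d)
    (h0 : (0 : Zd d) ∈ F) (hF : ∀ f ∈ F, RR (F : Set (Zd d)) 0 f)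
    (hJ : ∀ x, x ∈ J ↔ x ∈ I ∨ x ∈ F ∨ ∃ i k, x = w i k)
    (hst : ∀ i, w i 0 ∈ F) (hnn : ∀ i n, adj (w i (n+1)) (w i n))
    (htr : ∀ i, ∀ A : Finset (Zd d), ∃ n, ∀ m, n ≤ m → w i m ∉ A)
    (n0 : ℕ) (hbad : ∀ i j, i ≠ j → ∀ k, n0 ≤ k → ∀ l, n0 ≤ l →
      ¬ RR (I ∪ {w i k, w j l}) (w i k) (w j l))
    (hD : ∀ i, ∀ k < n0, w i k ∈ F) : trif F 0 J := by
  have hlate : ∀ i k, w i k ∉ F → n0 ≤ k := fun i k h => by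
    by_contra h'
    exact h (hD i k (by omega))
  have hset : J \ {x | x - 0 ∈ F} = J \ (F : Set (Zd d)) := by simp
  have hwJ : ∀ i k, w i k ∈ J := fun i k => (hJ _).2 (.inr (.inr ⟨i, k, rfl⟩))
  have hFJ : (F : Set (Zd d)) ⊆ J := fun f hf => (hJ f).2 (.inr (.inl hf))
  choose n hn using fun i => htr i F
  refine ⟨fun f hf => by simpa using hFJ hf, fun i => w (i.castSucc) (n i.castSucc), ?_, ?_, ?_⟩
  · intro i
    refine ((hF _ (hst i.castSucc)).mono hFJ).trans ?_
    have := RR.path (S := J) (w i.castSucc) 0 (n i.castSucc) (fun k _ _ => hwJ _ k) (fun k _ _ => hnn _ k)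
    simpa using this
  · intro i B
    rw [hset]
    obtain ⟨m, hm⟩ := htr i.castSucc B
    refine ⟨w i.castSucc (n i.castSucc + m), hm _ (by omega), ?_⟩
    exact RR.path (w i.castSucc) _ m (fun k hk _ => ⟨hwJ _ k, hn _ k hk⟩) (fun k _ _ => hnn _ k)
  · intro i j hij h
    rw [hset] at h
    have hij' : i.castSucc ≠ j.castSucc := fun h => hij (Fin.castSucc_injective _ h)
    dsimp only at h
    generalize i.castSucc = i at *
    generalize j.castSucc = j at *
    have inv : ∃ k, w i k ∉ F ∧ RR (I ∪ {w i k}) (w i k) (w j (n j)) := by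
      refine h.rec' (p := fun b => ∃ k, w i k ∉ F ∧ RR (I ∪ {w i k}) (w i k) b) ?_ ?_
      · intro _
        exact ⟨n i, hn i _ le_rfl, RR.refl (.inr rfl)⟩
      · rintro b c - ⟨k, hk, hr⟩ hadj ⟨hcJ, hcF⟩
        rcases (hJ c).1 hcJ with hc | hc | ⟨i', k', rfl⟩
        · exact ⟨k, hk, hr.step hadj (.inl hc)⟩
        · exact absurd hc hcF
        · by_cases hii : i' = i
          · subst hii
            exact ⟨k', hcF, RR.refl (.inr rfl)⟩
          · exfalso
            refine hbad i i' (Ne.symm hii) k (hlate _ _ hk) k' (hlate _ _ hcF) ?_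
            refine (hr.mono ?_).step hadj (.inr (.inr rfl))
            rintro x (hx | hx)
            · exact .inl hx
            · exact .inr (.inl hx)
    obtain ⟨k, hk, hr⟩ := inv
    refine hbad i j hij' k (hlate _ _ hk) (n j) (hlate _ _ (hn j _ le_rfl)) (hr.mono ?_)
    rintro x (hx | hx)
    · exact .inl hx
    · exact .inr (.inl hx)

lemma path_cover' {d : ℕ} (D : Finset (Zd d)) :
    ∃ (N : ℕ) (γ : ℕ → Zd d), γ 0 = 0 ∧ γ N = 0 ∧ (∀ k < N, adj (γ (k + 1)) (γ k)) ∧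
      ∀ z ∈ D, ∃ k ≤ N, γ k = z := by
  obtain ⟨N, γ, h0, h1, h2⟩ := path_cover D
  obtain ⟨N', γ', g1, g2, g3, g4⟩ := path_ext N γ h1 (-γ N)
  refine ⟨N', γ', by rw [g2 0 (Nat.zero_le _), h0], by rw [g4]; simp, g3, ?_⟩
  intro y hy
  obtain ⟨k, hk, rfl⟩ := h2 y hy
  exact ⟨k, by omega, g2 k hk⟩

lemma Bad_symm {d : ℕ} {I : Set (Zd d)} {w w' : ℕ → Zd d} (h : Bad I w w') : Bad I w' w := by
  obtain ⟨n, hn⟩ := h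
  refine ⟨n, fun i hi j hj hr => hn j hj i hi ?_⟩
  rw [Set.pair_comm]
  exact hr.symm

lemma mem_occ_mt {d : ℕ} (ω ω' : Zd d → Bool) (x : Zd d) :
    x ∈ occ (mt ω ω') ↔ x ∈ occ ω ∨ x ∈ occ ω' := by
  simp only [occ, mt, Set.mem_ofPred_eq]
  cases ω x <;> simp

lemma mem_occ_vac {d : ℕ} (w : ℕ → Zd d) (x : Zd d) : x ∈ occ (vac w) ↔ ∃ k, w k = x := by
  simp [occ, vac]

set_option maxHeartbeats 1000000 in
lemma good {d : ℕ} (hd : 3 ≤ d) {P : Zd d → Measure (ℕ → Zd d)} (hP : IsSRW d P)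
    {u : ℝ} (hu : 0 < u) {Q : Measure (Zd d → Bool)} (hQ : IsVacantLaw d P u Q) :
    ∀ᵐ ω ∂Q, ∀ x y, ∀ᵐ w' ∂P y, ∀ᵐ w ∂P x, ¬ Bad (occ ω) w w' := by
  classical
  have := hP.1
  have := hQ.1
  choose N γ hγ0 hγN hγ hcov using path_cover' (d := d)
  let F : Finset (Zd d) → Finset (Zd d) := fun D => (Finset.range (N D + 1)).image (γ D)
  have hmem : ∀ D k, k ≤ N D → γ D k ∈ F D := fun D k hk =>
    Finset.mem_image_of_mem _ (Finset.mem_range.2 (by omega))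
  have h0 : ∀ D, (0 : Zd d) ∈ F D := fun D => by
    have := hmem D 0 (Nat.zero_le _)
    rwa [hγ0] at this
  have hF : ∀ D, ∀ f ∈ F D, RR (F D : Set (Zd d)) 0 f := by
    intro D f hf
    obtain ⟨k, hk, rfl⟩ := Finset.mem_image.1 hf
    rw [Finset.mem_range] at hk
    have := RR.path (S := (F D : Set (Zd d))) (γ D) 0 k (fun j _ hj => hmem D j (by omega))
      (fun j _ hj => hγ D j (by omega))
    rwa [hγ0, zero_add] at this
  set μ' := (P 0).restrict (escSet d {(0 : Zd d)}) with hμ'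
  have nb' : (ae μ').NeBot := by
    rw [ae_neBot, hμ', Ne, Measure.restrict_eq_zero]
    exact esc_pos hd hP 0
  have main : ∀ᵐ ω ∂Q, ∀ᵐ X ∂P 0, ∀ᵐ X' ∂μ', ∀ᵐ Y ∂P 0, ∀ᵐ Y' ∂μ', ∀ D,
      ¬ trif (F D) 0 (occ (mt (mt ω (mt (vac (glue (N D) (γ D) X)) (vac X'))) (mt (vac Y) (vac Y')))) := by
    simp only [ae_all_iff]
    intro D
    have h1 := ins1 hd hP hu hQ 0 (ins1 hd hP hu hQ 0 (trif_zero hP hQ (F D) (h0 D) (hF D)))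
    filter_upwards [h1] with ω hω
    have hω' := P_path_ae hd hP (N D) (γ D) (hγ D)
      (p := fun X => ∀ᵐ X' ∂μ', ∀ᵐ Y ∂P 0, ∀ᵐ Y' ∂μ',
        ¬ trif (F D) 0 (occ (mt (mt ω (mt (vac X) (vac X'))) (mt (vac Y) (vac Y'))))) (by
        rw [hγ0]; exact hω)
    rw [hγN] at hω'
    exact hω'
  filter_upwards [main] with ω hω
  rcases dich hd hP (occ ω) with h | hbad
  · exact h
  exfalso
  have hb := hbad 0 0
  have gen : ∀ᵐ w ∂P 0, (w 0 = 0 ∧ (∀ n, adj (w (n+1)) (w n)) ∧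
      (∀ A : Finset (Zd d), ∃ n, ∀ m, n ≤ m → w m ∉ A)) ∧ ∀ᵐ v ∂P 0, Bad (occ ω) v w := by
    filter_upwards [P_start hP 0, P_nn hd hP 0, transient_fin hd hP 0, hb] with w h1 h2 h3 h4
    exact ⟨⟨h1, h2, h3⟩, h4⟩
  have res : ∀ {p : (ℕ → Zd d) → Prop}, (∀ᵐ w ∂P 0, p w) → ∀ᵐ w ∂μ', p w := fun h =>
    ae_restrict_of_ae h
  obtain ⟨X, hX, gX, bX⟩ := (hω.and gen).exists
  obtain ⟨X', hX', ⟨gX', bX'⟩, b01⟩ := (hX.and ((res gen).and (res bX))).exists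
  obtain ⟨Y, hY, ⟨gY, bY⟩, b02, b12⟩ := (hX'.and (gen.and (bX.and bX'))).exists
  obtain ⟨Y', hY', ⟨gY', -⟩, b03, b13, b23⟩ := (hY.and ((res gen).and ((res bX).and ((res bX').and (res bY))))).exists
  let w : Fin 4 → ℕ → Zd d := ![X, X', Y, Y']
  have hg : ∀ i, (w i 0 = 0 ∧ (∀ n, adj (w i (n+1)) (w i n)) ∧
      (∀ A : Finset (Zd d), ∃ n, ∀ m, n ≤ m → w i m ∉ A)) := by
    intro i
    fin_cases i
    · exact gX
    · exact gX'
    · exact gY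
    · exact gY'
  have hlt : ∀ i j : Fin 4, i < j → Bad (occ ω) (w j) (w i) := by
    intro i j hij
    fin_cases i <;> fin_cases j <;> first | exact absurd hij (by decide) | skip
    · exact b01
    · exact b02
    · exact b03
    · exact b12
    · exact b13
    · exact b23
  have hne : ∀ i j : Fin 4, ∃ n, i ≠ j → ∀ k, n ≤ k → ∀ l, n ≤ l →
      ¬ RR (occ ω ∪ {w i k, w j l}) (w i k) (w j l) := by
    intro i j
    by_cases hij : i = j
    · exact ⟨0, fun h => absurd hij h⟩
    · have : Bad (occ ω) (w i) (w j) := by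
        rcases lt_or_gt_of_ne hij with h | h
        · exact Bad_symm (hlt _ _ h)
        · exact hlt _ _ h
      obtain ⟨n, hn⟩ := this
      exact ⟨n, fun _ => hn⟩
  choose n hn using hne
  let n0 := Finset.univ.sup (fun i => Finset.univ.sup (fun j => n i j))
  have hn0 : ∀ i j, n i j ≤ n0 := fun i j =>
    (Finset.le_sup (f := fun j => n i j) (Finset.mem_univ j)).trans
      (Finset.le_sup (f := fun i => Finset.univ.sup (fun j => n i j)) (Finset.mem_univ i))
  let D : Finset (Zd d) := Finset.univ.biUnion (fun i => (Finset.range n0).image (w i))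
  have hDF : D ⊆ F D := by
    intro z hz
    obtain ⟨k, hk, rfl⟩ := hcov D z hz
    exact hmem D k hk
  refine hY' D (trif_of_bad (occ ω) _ (F D) w (h0 D) (hF D) ?_ ?_ (fun i => (hg i).2.1)
    (fun i => (hg i).2.2) n0 ?_ ?_)
  · intro x
    have hgl : (∃ k, glue (N D) (γ D) X k = x) ↔ x ∈ F D ∨ ∃ k, X k = x := by
      constructor
      · rintro ⟨k, rfl⟩
        unfold glue
        split_ifs with hk
        · exact .inl (hmem D k hk)
        · exact .inr ⟨_, rfl⟩
      · rintro (h | ⟨k, rfl⟩)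
        · obtain ⟨k, hk, rfl⟩ := Finset.mem_image.1 h
          rw [Finset.mem_range] at hk
          exact ⟨k, by unfold glue; rw [if_pos (by omega)]⟩
        · refine ⟨k + N D, ?_⟩
          unfold glue
          split_ifs with hk
          · have : k = 0 := by omega
            rw [this, zero_add, hγN, gX.1]
          · rw [Nat.add_sub_cancel]
    simp only [mem_occ_mt, mem_occ_vac, hgl]
    have hex : (∃ i k, x = w i k) ↔ (∃ k, X k = x) ∨ (∃ k, X' k = x) ∨ (∃ k, Y k = x) ∨ (∃ k, Y' k = x) := by
      simp only [eq_comm (a := x), Fin.exists_fin_succ]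
      simp [w]
    rw [hex]
    simp only [or_assoc]
  · intro i; rw [(hg i).1]; exact h0 D
  · intro i j hij k hk l hl
    exact hn i j hij k ((hn0 i j).trans hk) l ((hn0 i j).trans hl)
  · intro i k hk
    exact hDF (Finset.mem_biUnion.2 ⟨i, Finset.mem_univ i, Finset.mem_image_of_mem _ (Finset.mem_range.2 hk)⟩)

end RI

namespace RI

lemma meas_occ_RR {d : ℕ} (x y : Zd d) : MeasurableSet {ω : Zd d → Bool | RR (occ ω) x y} :=
  meas_RR _ (fun z => meas_pt z false) x y

lemma RR_range {d : ℕ} {w : ℕ → Zd d} {x : Zd d} (h0 : w 0 = x) (hnn : ∀ n, adj (w (n+1)) (w n))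
    {S : Set (Zd d)} (hS : ∀ k, w k ∈ S) (n : ℕ) : RR S x (w n) := by
  have := RR.path (S := S) w 0 n (fun k _ _ => hS k) (fun k _ _ => hnn k)
  rwa [h0, zero_add] at this

lemma conn_xy {d : ℕ} (hd : 3 ≤ d) {P : Zd d → Measure (ℕ → Zd d)} (hP : IsSRW d P)
    {u : ℝ} (hu : 0 < u) {Q : Measure (Zd d → Bool)} (hQ : IsVacantLaw d P u Q) (x y : Zd d) :
    ∀ᵐ ω ∂Q, ω x = false → (ω y = false → RR (occ ω) x y) := by
  have := hP.1
  have := hQ.1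
  have step1 : ∀ᵐ ω ∂Q, ω y = false → ∀ᵐ w ∂P x, RR (occ (mt ω (vac w))) x y := by
    refine ins2 hd hP hu hQ y (p := fun ω => ∀ᵐ w ∂P x, RR (occ (mt ω (vac w))) x y) ?_ ?_
    · have hm : Measurable (fun p : (Zd d → Bool) × (ℕ → Zd d) => mt p.1 (vac p.2)) :=
        meas_mt.comp (measurable_fst.prodMk (meas_vac.comp measurable_snd))
      have hs : MeasurableSet {p : (Zd d → Bool) × (ℕ → Zd d) | ¬ RR (occ (mt p.1 (vac p.2))) x y} :=
        (hm (meas_occ_RR x y)).compl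
      have := measurable_measure_prodMk_left (ν := P x) hs
      exact this (measurableSet_singleton 0)
    · filter_upwards [good hd hP hu hQ] with ω hω
      filter_upwards [hω x y, P_start hP y, P_nn hd hP y] with v hv v0 vn
      have hstart := P_start hP x
      have hnn := P_nn hd hP x
      refine Filter.Eventually.of_forall fun v' => ?_
      filter_upwards [hv, hstart, hnn] with w hw w0 wn
      unfold Bad at hw
      push Not at hw
      obtain ⟨i, -, j, -, hr⟩ := hw 0
      have hS : ∀ z, z ∈ occ (mt (mt ω (mt (vac v) (vac v'))) (vac w)) ↔
        (z ∈ occ ω ∨ (∃ k, v k = z) ∨ (∃ k, v' k = z)) ∨ (∃ k, w k = z) := by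
        intro z; simp only [mem_occ_mt, mem_occ_vac]
      have hwS : ∀ k, w k ∈ occ (mt (mt ω (mt (vac v) (vac v'))) (vac w)) := fun k =>
        (hS _).2 (.inr ⟨k, rfl⟩)
      have hvS : ∀ k, v k ∈ occ (mt (mt ω (mt (vac v) (vac v'))) (vac w)) := fun k =>
        (hS _).2 (.inl (.inr (.inl ⟨k, rfl⟩)))
      refine (RR_range w0 wn hwS i).trans (RR.trans (hr.mono ?_) (RR_range v0 vn hvS j).symm)
      rintro z (hz | rfl | rfl)
      · exact (hS z).2 (.inl (.inl hz))
      · exact hwS i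
      · exact hvS j
  refine ins2 hd hP hu hQ x (p := fun ω => ω y = false → RR (occ ω) x y) ?_ ?_
  · have : {ω : Zd d → Bool | ω y = false → RR (occ ω) x y} = {ω | ω y = false}ᶜ ∪ {ω | RR (occ ω) x y} := by
      ext ω
      simp only [Set.mem_ofPred_eq, Set.mem_union, Set.mem_compl_iff]
      tauto
    rw [this]
    exact (meas_pt y false).compl.union (meas_occ_RR x y)
  · filter_upwards [step1] with ω hω
    have key : ∀ᵐ w ∂P x, y ∈ occ ω → RR (occ (mt ω (vac w))) x y := by
      by_cases hy : ω y = false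
      · filter_upwards [hω hy] with w hw _ using hw
      · exact Filter.Eventually.of_forall fun w h => absurd h hy
    have hsn : ∀ᵐ w ∂P x, w 0 = x ∧ ∀ n, adj (w (n+1)) (w n) := (P_start hP x).and (P_nn hd hP x)
    filter_upwards [key, hsn] with w hw ⟨w0, wn⟩
    filter_upwards [ae_restrict_of_ae hsn] with w' ⟨w0', wn'⟩
    intro hy
    have hS : ∀ z, z ∈ occ (mt ω (mt (vac w) (vac w'))) ↔
        z ∈ occ ω ∨ (∃ k, w k = z) ∨ (∃ k, w' k = z) := by
      intro z; simp only [mem_occ_mt, mem_occ_vac]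
    rcases (hS y).1 hy with h | ⟨k, rfl⟩ | ⟨k, rfl⟩
    · refine (hw h).mono ?_
      intro z hz
      rw [mem_occ_mt, mem_occ_vac] at hz
      rw [hS]; tauto
    · exact RR_range w0 wn (fun k => (hS _).2 (.inr (.inl ⟨k, rfl⟩))) k
    · exact RR_range w0' wn' (fun k => (hS _).2 (.inr (.inr ⟨k, rfl⟩))) k

lemma inf_x {d : ℕ} (hd : 3 ≤ d) {P : Zd d → Measure (ℕ → Zd d)} (hP : IsSRW d P)
    {u : ℝ} (hu : 0 < u) {Q : Measure (Zd d → Bool)} (hQ : IsVacantLaw d P u Q) (x : Zd d) :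
    ∀ᵐ ω ∂Q, ω x = false → ∀ B : Finset (Zd d), ∃ b, b ∉ B ∧ ω b = false := by
  refine ins2 hd hP hu hQ x (p := fun ω => ∀ B : Finset (Zd d), ∃ b, b ∉ B ∧ ω b = false) ?_ ?_
  · have : {ω : Zd d → Bool | ∀ B : Finset (Zd d), ∃ b, b ∉ B ∧ ω b = false} =
        ⋂ B : Finset (Zd d), ⋃ b, ⋃ (_ : b ∉ B), {ω | ω b = false} := by
      ext ω; simp
    rw [this]
    exact MeasurableSet.iInter fun B => MeasurableSet.iUnion fun b => MeasurableSet.iUnion fun _ => meas_pt b false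
  · refine Filter.Eventually.of_forall fun ω => ?_
    filter_upwards [transient_fin hd hP x] with w hw
    refine Filter.Eventually.of_forall fun w' B => ?_
    obtain ⟨n, hn⟩ := hw B
    refine ⟨w n, hn n le_rfl, ?_⟩
    have : w n ∈ occ (mt ω (mt (vac w) (vac w'))) := by
      rw [mem_occ_mt, mem_occ_mt, mem_occ_vac]
      exact .inr (.inl ⟨n, rfl⟩)
    exact this

lemma capa_grow {d : ℕ} (hd : 3 ≤ d) {P : Zd d → Measure (ℕ → Zd d)} (hP : IsSRW d P) :
    ∃ v : ℝ, 0 < v ∧ ∀ A : Finset (Zd d), ∃ A', (capa d P A).toReal + v / 4 ≤ (capa d P A').toReal := by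
  classical
  have := hP.1
  set v := (P 0).real (escSet d {(0 : Zd d)}) with hv
  have hv0 : 0 < v := by
    rw [hv, measureReal_def]
    exact ENNReal.toReal_pos (esc_pos hd hP 0) (measure_ne_top _ _)
  have hv1 : v ≤ 1 := measureReal_le_one
  have hvx : ∀ x, (P x).real (escSet d {x}) = v := by
    intro x
    have h := capa_trans hP {(0 : Zd d)} x
    rw [Finset.image_singleton, zero_add] at h
    simp only [capa, eqm, Finset.sum_singleton, Finset.mem_singleton, if_true] at h
    rw [hv, measureReal_def, measureReal_def, h]
  refine ⟨v, hv0, fun A => ?_⟩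
  have hf0 := ff_pos (0 : Zd d)
  have hc : (0:ℝ) < 2 * (A.card + 1) := by positivity
  obtain ⟨x, hx⟩ := ff_small hd A (ff (0 : Zd d) * (v / (2 * (A.card + 1)))) (by positivity)
  have hfrac : v / (2 * (A.card + 1)) ≤ 1 := by
    rw [div_le_one hc]; nlinarith [(Nat.cast_nonneg A.card : (0:ℝ) ≤ A.card)]
  have hxA : x ∉ A := by
    intro h
    have := hx x h
    rw [sub_self] at this
    nlinarith
  have hit : (P x).real (escSet d A)ᶜ ≤ v / 2 := by
    have h1 : (escSet d A)ᶜ ⊆ ⋃ a ∈ A, hitS a := by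
      intro w hw
      simp only [escSet, Set.mem_compl_iff, Set.mem_ofPred_eq] at hw
      push Not at hw
      obtain ⟨n, _, hn⟩ := hw
      exact Set.mem_iUnion₂.2 ⟨w n, hn, n, rfl⟩
    calc (P x).real (escSet d A)ᶜ ≤ (P x).real (⋃ a ∈ A, hitS a) := measureReal_mono h1 (measure_ne_top _ _)
      _ ≤ ∑ a ∈ A, (P x).real (hitS a) := measureReal_biUnion_finset_le _ _
      _ ≤ ∑ a ∈ A, v / (2 * (A.card + 1)) := by
          refine Finset.sum_le_sum fun a ha => (hit_bound hd hP x a).trans ?_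
          rw [div_le_iff₀ hf0, mul_comm]
          exact (hx a ha).le
      _ = A.card * (v / (2 * (A.card + 1))) := by rw [Finset.sum_const, nsmul_eq_mul]
      _ ≤ v / 2 := by
          rw [← mul_div_assoc, div_le_div_iff₀ hc two_pos]
          nlinarith
  have hcompl : (P x).real (escSet d A) = 1 - (P x).real (escSet d A)ᶜ := by
    rw [probReal_compl_eq_one_sub (meas_esc A)]; ring
  have hins : v / 2 ≤ (P x).real (escSet d (insert x A)) := by
    have h1 : escSet d {x} ⊆ escSet d (insert x A) ∪ (escSet d A)ᶜ := by
      intro w hw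
      by_cases h : w ∈ escSet d A
      · refine .inl fun n hn hm => ?_
        rcases Finset.mem_insert.1 hm with hm | hm
        · exact hw n hn (Finset.mem_singleton.2 hm)
        · exact h n hn hm
      · exact .inr h
    have h2 := (measureReal_mono (μ := P x) h1 (measure_ne_top _ _)).trans (measureReal_union_le _ _)
    rw [hvx] at h2
    linarith
  refine ⟨insert x A, ?_⟩
  rw [capa_insert hd hP A x hxA, ENNReal.toReal_add (capa_ne_top hP A)
    (ENNReal.mul_ne_top (measure_ne_top _ _) (measure_ne_top _ _)), ENNReal.toReal_mul]
  simp only [← measureReal_def]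
  have : 1 / 2 ≤ (P x).real (escSet d A) := by linarith
  nlinarith

lemma nonempty_ae {d : ℕ} (hd : 3 ≤ d) {P : Zd d → Measure (ℕ → Zd d)} (hP : IsSRW d P)
    {u : ℝ} (hu : 0 < u) {Q : Measure (Zd d → Bool)} (hQ : IsVacantLaw d P u Q) :
    ∀ᵐ ω ∂Q, ∃ x, ω x = false := by
  have := hQ.1
  obtain ⟨v, hv, hgrow⟩ := capa_grow hd hP
  have hbig : ∀ n : ℕ, ∃ A, n * (v / 4) ≤ (capa d P A).toReal := by
    intro n
    induction n with
    | zero => exact ⟨∅, by simp⟩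
    | succ n ih =>
      obtain ⟨A, hA⟩ := ih
      obtain ⟨A', hA'⟩ := hgrow A
      refine ⟨A', ?_⟩
      push_cast
      linarith
  have hle : ∀ n : ℕ, Q {ω | ¬ ∃ x, ω x = false} ≤ ENNReal.ofReal (Real.exp (-(n * (u * (v / 4))))) := by
    intro n
    obtain ⟨A, hA⟩ := hbig n
    calc Q {ω | ¬ ∃ x, ω x = false} ≤ Q (VA A) := by
          refine measure_mono fun ω hω z _ => ?_
          by_contra h
          exact hω ⟨z, by simpa using h⟩
      _ = ENNReal.ofReal (Real.exp (-(u * (capa d P A).toReal))) := hQ.2 A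
      _ ≤ _ := by
          refine ENNReal.ofReal_le_ofReal (Real.exp_le_exp.2 ?_)
          nlinarith
  have hlim : Filter.Tendsto (fun n : ℕ => ENNReal.ofReal (Real.exp (-(n * (u * (v / 4)))))) Filter.atTop (nhds 0) := by
    have h1 : Filter.Tendsto (fun n : ℕ => (n : ℝ) * (u * (v / 4))) Filter.atTop Filter.atTop :=
      tendsto_natCast_atTop_atTop.atTop_mul_const (by positivity)
    have h2 := Real.tendsto_exp_neg_atTop_nhds_zero.comp h1
    have h3 := ENNReal.tendsto_ofReal h2
    simpa using h3
  rw [ae_iff]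
  exact le_antisymm (ge_of_tendsto' hlim hle) (zero_le)

end RI

theorem interlacement_infinite_connected
    (d : ℕ) (hd : 3 ≤ d) (P : Zd d → Measure (ℕ → Zd d)) (hP : IsSRW d P)
    (u : ℝ) (hu : 0 < u) (Q : Measure (Zd d → Bool)) (hQ : IsVacantLaw d P u Q) :
    ∀ᵐ ω ∂Q,
      {x : Zd d | ω x = false}.Infinite
      ∧ ∀ x ∈ {x : Zd d | ω x = false}, ∀ y ∈ {x : Zd d | ω x = false},
          connectedIn {x : Zd d | ω x = false} x y := by
  have h1 : ∀ᵐ ω ∂Q, ∀ x y, ω x = false → (ω y = false → RI.RR (RI.occ ω) x y) := by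
    rw [ae_all_iff]; intro x
    rw [ae_all_iff]; intro y
    exact RI.conn_xy hd hP hu hQ x y
  have h2 : ∀ᵐ ω ∂Q, ∀ x, ω x = false → ∀ B : Finset (Zd d), ∃ b, b ∉ B ∧ ω b = false := by
    rw [ae_all_iff]; exact RI.inf_x hd hP hu hQ
  filter_upwards [h1, h2, RI.nonempty_ae hd hP hu hQ] with ω g1 g2 ⟨x0, hx0⟩
  refine ⟨fun hfin => ?_, fun x hx y hy => RI.conn_iff.2 (g1 x y hx hy)⟩
  obtain ⟨b, hb, hb'⟩ := g2 x0 hx0 hfin.toFinset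
  exact hb (hfin.mem_toFinset.2 hb')
end

section
/- (Quantitative decorrelation.) There is a constant c > 0 depending only on d ≥ 3 with the following property. Let u ≥ 0, let Q be a vacant-set law at level u on {0,1}^{ℤ^d}, let K ⊆ ℤ^d be finite and x ∈ ℤ^d be such that K ∩ (K+x) = ∅, and let f, h : {0,1}^{ℤ^d} → [0,1] be measurable functions such that f depends only on the coordinates (Y_z)_{z∈K} and h depends only on the coordinates (Y_z)_{z∈K+x}. Then |E_Q[f·h] − E_Q[f]·E_Q[h]| ≤ c·u·cap(K)² / d(K, K+x)^{d−2}, where d(K,K+x) denotes the ℓ^∞-distance between K and K+x. -/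
open MeasureTheory
open scoped ENNReal

/-- The `ℓ∞`-distance between two points of `ℤ^d`. -/
def linfDist {d : ℕ} (a b : Zd d) : ℕ := Finset.univ.sup fun i => (a i - b i).natAbs

/-- The `ℓ∞`-distance `d(A,B)` between two finite subsets of `ℤ^d`. -/
noncomputable def setDist (d : ℕ) (A B : Finset (Zd d)) : ℕ :=
  sInf {m : ℕ | ∃ a ∈ A, ∃ b ∈ B, linfDist a b = m}

open Filter Topology in
lemma taylor4 (α : ℝ) : ∃ C > 0, ∃ δ > 0, ∀ x : ℝ, |x| ≤ δ →
    (1 + x) ^ (-α) ≤ 1 - α * x + α * (α + 1) / 2 * x ^ 2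
      - α * (α + 1) * (α + 2) / 6 * x ^ 3 + C * x ^ 4 := by
  have h := (Real.one_add_rpow_hasFPowerSeriesAt_zero (a := -α)).isBigO_sub_partialSum_pow 4
  obtain ⟨C, hC, h⟩ := h.exists_pos
  have h := h.bound
  rw [Metric.eventually_nhds_iff] at h
  obtain ⟨ε, hε, h⟩ := h
  refine ⟨C, hC, ε / 2, by positivity, fun x hx => ?_⟩
  have := h (y := x) (by rw [Real.dist_eq, sub_zero]; linarith)
  have c0 : Ring.choose (-α) 0 = 1 := by simp
  have c1 : Ring.choose (-α) 1 = -α := by simp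
  have c2 : Ring.choose (-α) 2 = α * (α + 1) / 2 := by
    rw [Ring.choose_eq_smul]
    simp [descPochhammer_succ_right, Polynomial.smeval_sub, Polynomial.smeval_mul, Polynomial.smeval_X, Polynomial.smeval_one, Nat.factorial]
    ring
  have c3 : Ring.choose (-α) 3 = -(α * (α + 1) * (α + 2) / 6) := by
    rw [Ring.choose_eq_smul]
    have s2 : Polynomial.smeval (2 : Polynomial ℤ) (-α) = 2 := by
      have := Polynomial.smeval_natCast ℤ (-α) 2
      simpa using this
    simp [descPochhammer_succ_right, Polynomial.smeval_sub, Polynomial.smeval_mul, Polynomial.smeval_X, Polynomial.smeval_one, s2, Nat.factorial]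
    ring
  simp only [FormalMultilinearSeries.partialSum, binomialSeries, FormalMultilinearSeries.ofScalars_apply_eq, Finset.sum_range_succ, Finset.sum_range_zero, c0, c1, c2, c3] at this
  simp only [zero_add, pow_zero, smul_eq_mul, pow_one, Real.norm_eq_abs, one_mul, abs_pow, abs_abs] at this
  have h2 := (abs_le.1 this).2
  rw [← abs_pow, abs_of_nonneg (by positivity : 0 ≤ x ^ 4)] at h2
  linarith

lemma superharm (d : ℕ) (hd : 3 ≤ d) (α : ℝ) (hα : α = ((d : ℝ) - 2) / 2) :
    ∃ A : ℝ, 1 ≤ A ∧ ∀ z : Fin d → ℝ, ∀ s : ℝ, s = ∑ i, z i ^ 2 + A →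
      ∑ i, ((s + 1 + 2 * z i) ^ (-α) + (s + 1 - 2 * z i) ^ (-α))
        ≤ (2 * d - 1 / s ^ 2) * s ^ (-α) := by
  obtain ⟨C, hC, δ, hδ, hT⟩ := taylor4 α
  have hd' : (3 : ℝ) ≤ d := by exact_mod_cast hd
  have hα0 : 1 / 2 ≤ α := by rw [hα]; linarith
  set B := α * (α + 1) + 82 * C + 1 with hB
  have hB1 : 1 ≤ B := by
    have : 0 ≤ α * (α + 1) := by positivity
    linarith
  refine ⟨B + 9 / δ ^ 2, by have : 0 ≤ 9 / δ ^ 2 := by positivity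
                            linarith, ?_⟩
  intro z s hs
  set A := B + 9 / δ ^ 2 with hA
  have hAB : B ≤ A := by have : 0 ≤ 9 / δ ^ 2 := by positivity
                         linarith
  have hAδ : 9 / δ ^ 2 ≤ A := by linarith
  have hsum : 0 ≤ ∑ i, z i ^ 2 := Finset.sum_nonneg fun i _ => sq_nonneg _
  have hs1 : 1 ≤ s := by linarith
  have hs0 : 0 < s := by linarith
  have hz : ∀ i, z i ^ 2 ≤ s := by
    intro i
    have : z i ^ 2 ≤ ∑ i, z i ^ 2 :=
      Finset.single_le_sum (f := fun i => z i ^ 2) (fun i _ => sq_nonneg _) (Finset.mem_univ i)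
    linarith
  have key : ∀ t : ℝ, t ^ 2 ≤ s → (0 ≤ 1 + (1 + 2 * t) / s) ∧ 
      (1 + (1 + 2 * t) / s) ^ (-α) ≤ 1 - α * ((1 + 2 * t) / s) + α * (α + 1) / 2 * ((1 + 2 * t) / s) ^ 2
      - α * (α + 1) * (α + 2) / 6 * ((1 + 2 * t) / s) ^ 3 + C * ((1 + 2 * t) / s) ^ 4 := by
    intro t ht
    constructor
    · have : 0 ≤ s + (1 + 2 * t) := by nlinarith [sq_nonneg (t + 1)]
      have h2 : 1 + (1 + 2 * t) / s = (s + (1 + 2 * t)) / s := by field_simp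
      rw [h2]; positivity
    · apply hT
      apply abs_le_of_sq_le_sq _ hδ.le
      rw [div_pow, div_le_iff₀ (by positivity)]
      have h1 : (1 + 2 * t) ^ 2 ≤ 9 * s := by nlinarith [sq_nonneg (t - 1)]
      have h2 : 9 ≤ δ ^ 2 * s := by
        have : 9 / δ ^ 2 ≤ s := by linarith
        rw [div_le_iff₀ (by positivity)] at this
        linarith
      nlinarith
  have pair : ∀ i, (s + 1 + 2 * z i) ^ (-α) + (s + 1 - 2 * z i) ^ (-α) ≤
      (2 - 2 * α / s + (α * (α + 1) * (1 + 4 * z i ^ 2) + 82 * C) / s ^ 2) * s ^ (-α) := by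
    intro i
    obtain ⟨a1, a2⟩ := key (z i) (hz i)
    obtain ⟨b1, b2⟩ := key (-z i) (by simpa using hz i)
    have e1 : s + 1 + 2 * z i = (1 + (1 + 2 * z i) / s) * s := by field_simp; ring
    have e2 : s + 1 - 2 * z i = (1 + (1 + 2 * (-z i)) / s) * s := by field_simp; ring
    rw [e1, e2, Real.mul_rpow a1 hs0.le, Real.mul_rpow b1 hs0.le, ← add_mul]
    apply mul_le_mul_of_nonneg_right _ (by positivity)
    refine (add_le_add a2 b2).trans ?_
    set t := z i
    have ht := hz i
    have cub : 0 ≤ α * (α + 1) * (α + 2) / 6 * ((2 + 24 * t ^ 2) / s ^ 3) := by positivity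
    have quart : C * ((2 + 48 * t ^ 2 + 32 * t ^ 4) / s ^ 4) ≤ 82 * C / s ^ 2 := by
      rw [mul_div_assoc', div_le_div_iff₀ (by positivity) (by positivity)]
      have h1 : 2 + 48 * t ^ 2 + 32 * t ^ 4 ≤ 82 * s ^ 2 := by
        nlinarith [sq_nonneg t, mul_le_mul ht ht (sq_nonneg t) hs0.le]
      have : C * (2 + 48 * t ^ 2 + 32 * t ^ 4) ≤ C * (82 * s ^ 2) :=
        mul_le_mul_of_nonneg_left h1 hC.le
      have := mul_le_mul_of_nonneg_right this (sq_nonneg s)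
      nlinarith
    have expand : (1 - α * ((1 + 2 * t) / s) + α * (α + 1) / 2 * ((1 + 2 * t) / s) ^ 2
      - α * (α + 1) * (α + 2) / 6 * ((1 + 2 * t) / s) ^ 3 + C * ((1 + 2 * t) / s) ^ 4)
      + (1 - α * ((1 + 2 * -t) / s) + α * (α + 1) / 2 * ((1 + 2 * -t) / s) ^ 2
      - α * (α + 1) * (α + 2) / 6 * ((1 + 2 * -t) / s) ^ 3 + C * ((1 + 2 * -t) / s) ^ 4)
      = 2 - 2 * α / s + (α * (α + 1) * (1 + 4 * t ^ 2)) / s ^ 2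
        - α * (α + 1) * (α + 2) / 6 * ((2 + 24 * t ^ 2) / s ^ 3)
        + C * ((2 + 48 * t ^ 2 + 32 * t ^ 4) / s ^ 4) := by
      field_simp; ring
    rw [expand, add_div (α * (α + 1) * (1 + 4 * t ^ 2))]
    linarith
  refine (Finset.sum_le_sum fun i _ => pair i).trans ?_
  rw [← Finset.sum_mul]
  apply mul_le_mul_of_nonneg_right _ (by positivity)
  have hR : ∑ i, z i ^ 2 = s - A := by linarith
  have : ∑ i : Fin d, (2 - 2 * α / s + (α * (α + 1) * (1 + 4 * z i ^ 2) + 82 * C) / s ^ 2)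
      = d * (2 - 2 * α / s) + (α * (α + 1) * (d + 4 * (s - A)) + 82 * C * d) / s ^ 2 := by
    rw [Finset.sum_add_distrib, ← Finset.sum_div, Finset.sum_add_distrib, ← Finset.mul_sum,
      Finset.sum_add_distrib, ← Finset.mul_sum, hR]
    simp
    ring
  rw [this]
  have e3 : (d : ℝ) = 2 * α + 2 := by rw [hα]; ring
  have e4 : (2 * (d:ℝ) - 1 / s ^ 2) - (d * (2 - 2 * α / s) + (α * (α + 1) * (d + 4 * (s - A)) + 82 * C * d) / s ^ 2)
    = (2 * α * d * A - α * (α + 1) * d - 82 * C * d - 1) / s ^ 2 := by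
    rw [e3]; field_simp; ring
  have e5 : 0 ≤ 2 * α * d * A - α * (α + 1) * d - 82 * C * d - 1 := by
    have h1 : d * B ≤ 2 * α * d * A := by
      have : (d : ℝ) * B ≤ d * A := by gcongr
      have : (d : ℝ) * A ≤ 2 * α * (d * A) := le_mul_of_one_le_left (by positivity) (by linarith)
      linarith
    rw [hB] at h1
    nlinarith
  have : 0 ≤ (2 * α * d * A - α * (α + 1) * d - 82 * C * d - 1) / s ^ 2 := by positivity
  linarith

def stp {d : ℕ} (e : Fin d × Bool) : Zd d := Pi.single e.1 (if e.2 then 1 else -1)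

noncomputable def rr (d : ℕ) : ℕ → Zd d → ℝ≥0∞
  | 0, z => if z = 0 then 1 else 0
  | n + 1, z => ∑ e : Fin d × Bool, (2 * d : ℝ≥0∞)⁻¹ * rr d n (z - stp e)

noncomputable def GG (d : ℕ) (z : Zd d) : ℝ≥0∞ := ∑' n, rr d n z

lemma rr_neg (d n : ℕ) (z : Zd d) : rr d n (-z) = rr d n z := by
  induction n generalizing z with
  | zero => simp [rr]
  | succ n ih =>
    simp only [rr]
    refine Fintype.sum_equiv (Equiv.prodCongr (Equiv.refl _) (Equiv.boolNot)) _ _ ?_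
    rintro ⟨i, b⟩
    rw [← ih]
    congr 2
    cases b <;> simp [stp, Pi.single_neg] <;> abel

lemma GG_neg (d : ℕ) (z : Zd d) : GG d (-z) = GG d z := by
  simp [GG, rr_neg]

lemma GG_le (d : ℕ) (F : Zd d → ℝ≥0∞)
    (hF : ∀ z, (if z = 0 then 1 else 0) + ∑ e : Fin d × Bool, (2 * d : ℝ≥0∞)⁻¹ * F (z - stp e) ≤ F z)
    (z : Zd d) : GG d z ≤ F z := by
  have : ∀ n z, ∑ k ∈ Finset.range n, rr d k z ≤ F z := by
    intro n
    induction n with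
    | zero => simp
    | succ n ih =>
      intro z
      rw [Finset.sum_range_succ', add_comm]
      refine le_trans ?_ (hF z)
      simp only [rr]
      gcongr
      rw [Finset.sum_comm]
      gcongr with e
      rw [← Finset.mul_sum]
      gcongr
      exact ih _
  exact ENNReal.tsum_le_of_sum_range_le (fun n => this n z)

lemma GG_bound (d : ℕ) (hd : 3 ≤ d) : ∃ M : ℝ, 0 < M ∧ (∀ z, GG d z ≤ ENNReal.ofReal M) ∧
    ∀ (z : Zd d) (m : ℕ), 0 < m → m ≤ linfDist z 0 → GG d z ≤ ENNReal.ofReal (M / (m : ℝ) ^ (d - 2)) := by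
  set α : ℝ := ((d : ℝ) - 2) / 2 with hα
  have hd' : (3 : ℝ) ≤ d := by exact_mod_cast hd
  have hα0 : 0 < α := by rw [hα]; linarith
  obtain ⟨A, hA, hS⟩ := superharm d hd α hα
  have hA0 : 0 < A := by linarith
  set S : Zd d → ℝ := fun z => ∑ i, (z i : ℝ) ^ 2 + A with hSdef
  have hSA : ∀ z, A ≤ S z := fun z => by
    have : 0 ≤ ∑ i, (z i : ℝ) ^ 2 := Finset.sum_nonneg fun i _ => sq_nonneg _
    simp only [hSdef]; linarith
  have hS0 : ∀ z, 0 < S z := fun z => hA0.trans_le (hSA z)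
  set M : ℝ := 2 * d * A ^ 2 * A ^ α with hM
  have hM0 : 0 < M := by positivity
  have hstp : ∀ (z : Zd d) (i : Fin d) (b : Bool),
      S (z - stp (i, b)) = if b then S z + 1 - 2 * z i else S z + 1 + 2 * z i := by
    intro z i b
    have : ∀ j, (((z - stp (i, b)) j : ℤ) : ℝ) ^ 2 = (z j : ℝ) ^ 2 +
        (if j = i then (if b then 1 - 2 * (z i : ℝ) else 1 + 2 * z i) else 0) := by
      intro j
      by_cases h : j = i
      · subst h; cases b <;> simp [stp] <;> ring
      · simp [stp, h]
    simp only [hSdef, this, Finset.sum_add_distrib, Finset.sum_ite_eq', Finset.mem_univ, if_true]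
    split_ifs <;> ring
  have hG : ∀ z, GG d z ≤ ENNReal.ofReal (M * S z ^ (-α)) := by
    apply GG_le
    intro z
    have h1 := hS (fun i => (z i : ℝ)) (S z) rfl
    have h2 : ∑ e : Fin d × Bool, S (z - stp e) ^ (-α) ≤ (2 * d - 1 / S z ^ 2) * S z ^ (-α) := by
      rw [Fintype.sum_prod_type]
      refine le_trans (le_of_eq ?_) h1
      refine Finset.sum_congr rfl fun i _ => ?_
      simp [hstp]
      ring
    have h3 : ∑ e : Fin d × Bool, (2 * d : ℝ≥0∞)⁻¹ * ENNReal.ofReal (M * S (z - stp e) ^ (-α))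
        = ENNReal.ofReal ((2 * d : ℝ)⁻¹ * (M * ∑ e : Fin d × Bool, S (z - stp e) ^ (-α))) := by
      have : (2 * d : ℝ≥0∞)⁻¹ = ENNReal.ofReal ((2 * d : ℝ)⁻¹) := by
        rw [ENNReal.ofReal_inv_of_pos (by positivity), ENNReal.ofReal_mul (by positivity)]
        simp
      rw [Finset.mul_sum, Finset.mul_sum, ENNReal.ofReal_sum_of_nonneg]
      · refine Finset.sum_congr rfl fun e _ => ?_
        rw [this, ← ENNReal.ofReal_mul (by positivity)]
      · intro e _
        have := hS0 (z - stp e)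
        positivity
    have h4 : (if z = 0 then (1 : ℝ≥0∞) else 0) = ENNReal.ofReal (if z = 0 then 1 else 0) := by
      split_ifs <;> simp
    rw [h3, h4, ← ENNReal.ofReal_add (by split_ifs <;> norm_num)
      (by
        have : 0 ≤ ∑ e : Fin d × Bool, S (z - stp e) ^ (-α) :=
          Finset.sum_nonneg fun e _ => by have := hS0 (z - stp e); positivity
        positivity)]
    apply ENNReal.ofReal_le_ofReal
    have hz0 := hS0 z
    have h5 : (2 * d : ℝ)⁻¹ * (M * ∑ e : Fin d × Bool, S (z - stp e) ^ (-α)) ≤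
        M * S z ^ (-α) - M * S z ^ (-α) / (2 * d * S z ^ 2) := by
      calc _ ≤ (2 * d : ℝ)⁻¹ * (M * ((2 * d - 1 / S z ^ 2) * S z ^ (-α))) := by gcongr
        _ = _ := by field_simp
    have h6 : (if z = 0 then (1 : ℝ) else 0) ≤ M * S z ^ (-α) / (2 * d * S z ^ 2) := by
      split_ifs with h
      · have : S z = A := by simp [hSdef, h]
        rw [this, hM, Real.rpow_neg hA0.le]
        apply le_of_eq
        field_simp
      · positivity
    linarith
  refine ⟨M, hM0, fun z => (hG z).trans ?_, fun z m hm hmz => (hG z).trans ?_⟩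
  · apply ENNReal.ofReal_le_ofReal
    have : S z ^ (-α) ≤ 1 := Real.rpow_le_one_of_one_le_of_nonpos (hA.trans (hSA z)) (by linarith)
    nlinarith
  · apply ENNReal.ofReal_le_ofReal
    rw [div_eq_mul_inv]
    gcongr
    rw [Real.rpow_neg (hS0 z).le]
    gcongr
    have hm2 : (m : ℝ) ^ 2 ≤ S z := by
      have : ∃ i, linfDist z 0 = (z i).natAbs := by
        have hne : (Finset.univ : Finset (Fin d)).Nonempty := ⟨⟨0, by omega⟩, Finset.mem_univ _⟩
        obtain ⟨i, -, hi⟩ := Finset.exists_mem_eq_sup _ hne (fun i => ((z i) - (0 : Zd d) i).natAbs)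
        exact ⟨i, by simpa [linfDist] using hi⟩
      obtain ⟨i, hi⟩ := this
      have h1 : (m : ℝ) ≤ |(z i : ℝ)| := by
        rw [hi] at hmz
        have : ((z i).natAbs : ℝ) = |(z i : ℝ)| := by simp [Nat.cast_natAbs]
        rw [← this]; exact_mod_cast hmz
      have h2 : (z i : ℝ) ^ 2 ≤ ∑ i, (z i : ℝ) ^ 2 :=
        Finset.single_le_sum (f := fun i => (z i : ℝ) ^ 2) (fun i _ => sq_nonneg _) (Finset.mem_univ i)
      have h3 : (m : ℝ) ^ 2 ≤ (z i : ℝ) ^ 2 := by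
        rw [← sq_abs (z i : ℝ)]; gcongr
      simp only [hSdef]; linarith
    calc (m : ℝ) ^ (d - 2) = ((m : ℝ) ^ 2) ^ α := by
          rw [← Real.rpow_natCast, ← Real.rpow_natCast, ← Real.rpow_mul (by positivity)]
          congr 1
          rw [Nat.cast_sub (by omega), hα]; push_cast; ring
      _ ≤ _ := by gcongr

def cyl (d : ℕ) (N : ℕ) (γ : ℕ → Zd d) : Set (ℕ → Zd d) := {w | ∀ k ≤ N, w k = γ k}

def cyls (d : ℕ) : Set (Set (ℕ → Zd d)) := {s | ∃ N γ, s = cyl d N γ}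

lemma cyl_meas (d N : ℕ) (γ : ℕ → Zd d) : MeasurableSet (cyl d N γ) := by
  have : cyl d N γ = ⋂ k ≤ N, (fun w : ℕ → Zd d => w k) ⁻¹' {γ k} := by
    ext w; simp [cyl]
  rw [this]
  refine MeasurableSet.iInter fun k => MeasurableSet.iInter fun _ => ?_
  exact measurable_pi_apply k (measurableSet_singleton _)

lemma cyls_pi (d : ℕ) : IsPiSystem (cyls d) := by
  rintro _ ⟨N, γ, rfl⟩ _ ⟨M, η, rfl⟩ ⟨w, hw1, hw2⟩
  refine ⟨max N M, w, ?_⟩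
  ext v
  simp only [cyl, Set.mem_inter_iff, Set.mem_ofPred_eq] at *
  constructor
  · rintro ⟨h1, h2⟩ k hk
    rcases le_max_iff.1 hk with h | h
    · rw [h1 k h, hw1 k h]
    · rw [h2 k h, hw2 k h]
  · intro h
    exact ⟨fun k hk => by rw [h k (hk.trans (le_max_left _ _)), hw1 k hk],
      fun k hk => by rw [h k (hk.trans (le_max_right _ _)), hw2 k hk]⟩

lemma cyls_gen (d : ℕ) : (inferInstance : MeasurableSpace (ℕ → Zd d)) = MeasurableSpace.generateFrom (cyls d) := by
  apply le_antisymm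
  · change MeasurableSpace.pi ≤ _
    refine iSup_le fun k => ?_
    rintro _ ⟨t, -, rfl⟩
    have : (fun w : ℕ → Zd d => w k) ⁻¹' t =
        ⋃ γ : {γ : Fin (k + 1) → Zd d // γ (Fin.last k) ∈ t},
          cyl d k (fun j => γ.1 ⟨min j k, by omega⟩) := by
      ext w
      simp only [Set.mem_preimage, Set.mem_iUnion, cyl, Set.mem_ofPred_eq]
      constructor
      · intro h
        refine ⟨⟨fun j => w j, by simpa using h⟩, fun j hj => ?_⟩
        simp [hj]
      · rintro ⟨⟨γ, hγ⟩, h⟩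
        rw [h k le_rfl]
        convert hγ using 3
        simp
    rw [this]
    exact @MeasurableSet.iUnion _ _ (MeasurableSpace.generateFrom (cyls d)) _ _
      (fun γ => MeasurableSpace.measurableSet_generateFrom ⟨_, _, rfl⟩)
  · apply MeasurableSpace.generateFrom_le
    rintro _ ⟨N, γ, rfl⟩
    exact cyl_meas d N γ

lemma adj_iff {d : ℕ} (x y : Zd d) : adj y x ↔ ∃ e, y = x + stp e := by
  constructor
  · intro h
    unfold adj at h
    obtain ⟨i, -, hi⟩ : ∃ i ∈ Finset.univ, (y i - x i).natAbs ≠ 0 := by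
      by_contra hc
      push Not at hc
      rw [Finset.sum_eq_zero hc] at h
      omega
    rw [← Finset.add_sum_erase _ _ (Finset.mem_univ i)] at h
    have h0 : ∑ j ∈ Finset.univ.erase i, (y j - x j).natAbs = 0 := by omega
    have h1 : (y i - x i).natAbs = 1 := by omega
    rw [Finset.sum_eq_zero_iff] at h0
    refine ⟨(i, decide (y i - x i = 1)), ?_⟩
    ext j
    by_cases hj : j = i
    · subst hj
      by_cases h2 : y j - x j = 1
      · simp [stp, h2]; omega
      · simp [stp, h2]; omega
    · have := h0 j (by simp [hj])
      simp [stp, hj]; omega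
  · rintro ⟨⟨i, b⟩, rfl⟩
    unfold adj
    rw [Finset.sum_eq_single i]
    · cases b <;> simp [stp]
    · intro j _ hj
      simp [stp, hj]
    · simp

lemma stp_inj {d : ℕ} : Function.Injective (stp (d := d)) := by
  rintro ⟨i, b⟩ ⟨j, c⟩ h
  have h1 := congrFun h i
  by_cases hij : i = j
  · subst hij
    cases b <;> cases c <;> simp [stp] at h1 ⊢
  · exfalso
    cases b <;> simp [stp, hij] at h1

lemma sum_stp {d : ℕ} (x y : Zd d) (a : ℝ≥0∞) :
    ∑ e : Fin d × Bool, (if y = x + stp e then a else 0) = if adj y x then a else 0 := by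
  classical
  by_cases h : adj y x
  · rw [if_pos h]
    obtain ⟨e, he⟩ := (adj_iff x y).1 h
    rw [Finset.sum_eq_single e]
    · simp [he]
    · intro b _ hb
      rw [if_neg]
      intro hb'
      rw [he] at hb'
      exact hb (stp_inj (add_left_cancel hb')).symm
    · simp
  · rw [if_neg h]
    refine Finset.sum_eq_zero fun e _ => if_neg fun he => h ((adj_iff x y).2 ⟨e, he⟩)

section SRW
variable {d : ℕ} {P : Zd d → Measure (ℕ → Zd d)}

lemma start_ae (hP : IsSRW d P) (x : Zd d) : ∀ᵐ w ∂(P x), w 0 = x := by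
  have := hP.1 x
  have h := hP.2 x 0 (fun _ => x) rfl
  simp at h
  have hm : MeasurableSet {w : ℕ → Zd d | w 0 = x} :=
    (measurable_pi_apply (X := fun _ : ℕ => Zd d) 0) (measurableSet_singleton x)
  have h2 := (prob_compl_eq_zero_iff (μ := P x) hm).2 h
  exact h2

lemma cyl_prob (hP : IsSRW d P) (x : Zd d) (N : ℕ) (γ : ℕ → Zd d) :
    P x (cyl d N γ) = if γ 0 = x then
      (if ∀ k < N, adj (γ (k + 1)) (γ k) then ((2 * d : ℝ≥0∞))⁻¹ ^ N else 0) else 0 := by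
  split_ifs with h1 h2
  · have := hP.2 x N γ h1
    rwa [if_pos h2] at this
  · have := hP.2 x N γ h1
    rwa [if_neg h2] at this
  · have h := start_ae hP x
    rw [ae_iff] at h
    refine measure_mono_null ?_ h
    intro w hw hw0
    exact h1 (by rw [← hw 0 (Nat.zero_le _), hw0])

def shf (d : ℕ) (w : ℕ → Zd d) : ℕ → Zd d := fun n => w (n + 1)

lemma shf_meas : Measurable (shf d) := by
  rw [measurable_pi_iff]
  exact fun n => measurable_pi_apply (n + 1)

lemma markov1 (hd : d ≠ 0) (hP : IsSRW d P) (x : Zd d) :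
    (P x).map (shf d) = ∑ e : Fin d × Bool, (2 * d : ℝ≥0∞)⁻¹ • P (x + stp e) := by
  have := hP.1
  have hfin : IsFiniteMeasure ((P x).map (shf d)) := by
    have := Measure.isProbabilityMeasure_map (μ := P x) (shf_meas (d := d)).aemeasurable
    infer_instance
  refine ext_of_generate_finite (cyls d) (cyls_gen d) (cyls_pi d) ?_ ?_
  · rintro _ ⟨N, γ, rfl⟩
    rw [Measure.map_apply shf_meas (cyl_meas d N γ)]
    have e1 : P x (shf d ⁻¹' cyl d N γ) = P x (cyl d (N + 1) (fun n => Nat.casesOn n x γ)) := by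
      apply measure_congr
      filter_upwards [start_ae hP x] with w hw
      apply propext
      change (∀ k ≤ N, w (k + 1) = γ k) ↔ (∀ k ≤ N + 1, w k = _)
      constructor
      · intro h k hk
        cases k with
        | zero => exact hw
        | succ k => exact h k (by omega)
      · intro h k hk
        exact h (k + 1) (by omega)
    rw [e1, cyl_prob hP]
    simp only [Measure.coe_finsetSum, Finset.sum_apply, Measure.smul_apply, smul_eq_mul, cyl_prob hP, mul_ite, mul_zero]
    rw [sum_stp, if_pos (show (Nat.rec x (fun n _ => γ n) 0 : Zd d) = x from rfl)]
    have e2 : (∀ k < N + 1, adj (γ k) (Nat.rec x (fun n _ => γ n) k)) ↔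
        (adj (γ 0) x ∧ ∀ k < N, adj (γ (k + 1)) (γ k)) := Nat.forall_lt_succ_left
    simp only [e2]
    by_cases h1 : adj (γ 0) x <;> by_cases h2 : ∀ k < N, adj (γ (k + 1)) (γ k)
    · simp only [h1, true_and, if_true]
      rw [if_pos h2, if_pos h2, pow_succ']
    · simp only [h1, true_and, if_true]
      rw [if_neg h2, if_neg h2]
    · simp [h1]
    · simp [h1]
  · rw [Measure.map_apply shf_meas MeasurableSet.univ]
    simp
    rw [mul_comm (d : ℝ≥0∞) 2, ENNReal.mul_inv_cancel]
    · simp [hd]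
    · exact ENNReal.mul_ne_top (by simp) (by simp)

end SRW

section SRW2
variable {d : ℕ} {P : Zd d → Measure (ℕ → Zd d)}

def hitS (d : ℕ) (B : Finset (Zd d)) : Set (ℕ → Zd d) := {w | ∃ n, w n ∈ B}

lemma coord_meas (n : ℕ) (B : Set (Zd d)) : MeasurableSet {w : ℕ → Zd d | w n ∈ B} :=
  measurable_pi_apply (X := fun _ : ℕ => Zd d) n (Set.to_countable B).measurableSet

lemma esc_meas (B : Finset (Zd d)) : MeasurableSet (escSet d B) := by
  have : escSet d B = ⋂ n : ℕ, ⋂ _ : 1 ≤ n, {w : ℕ → Zd d | w n ∈ (B : Set (Zd d))}ᶜ := by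
    ext w; simp [escSet]
  rw [this]
  exact MeasurableSet.iInter fun n => MeasurableSet.iInter fun _ => (coord_meas n _).compl

lemma hit_meas (B : Finset (Zd d)) : MeasurableSet (hitS d B) := by
  have : hitS d B = ⋃ n : ℕ, {w : ℕ → Zd d | w n ∈ (B : Set (Zd d))} := by
    ext w; simp [hitS]
  rw [this]
  exact MeasurableSet.iUnion fun n => coord_meas n _

def evn (n : ℕ) (y : Zd d) (S : Set (ℕ → Zd d)) : Set (ℕ → Zd d) :=
  {w | w n = y ∧ (fun k => w (n + k)) ∈ S}

lemma evn_meas (n : ℕ) (y : Zd d) {S : Set (ℕ → Zd d)} (hS : MeasurableSet S) :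
    MeasurableSet (evn n y S) := by
  have h1 : Measurable (fun (w : ℕ → Zd d) (k : ℕ) => w (n + k)) := by
    rw [measurable_pi_iff]
    exact fun k => measurable_pi_apply (n + k)
  exact (coord_meas n {y}).inter (h1 hS)

lemma markovn (hd : d ≠ 0) (hP : IsSRW d P) (n : ℕ) (x y : Zd d) {S : Set (ℕ → Zd d)}
    (hS : MeasurableSet S) : P x (evn n y S) = rr d n (y - x) * P y S := by
  induction n generalizing x with
  | zero =>
    simp only [rr, sub_eq_zero]
    split_ifs with h
    · subst h
      rw [one_mul]
      apply measure_congr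
      filter_upwards [start_ae hP y] with w hw
      apply propext
      change (w 0 = y ∧ (fun k => w (0 + k)) ∈ S) ↔ w ∈ S
      simp [hw]
    · rw [zero_mul]
      have h2 := start_ae hP x
      rw [ae_iff] at h2
      refine measure_mono_null ?_ h2
      intro w hw hw0
      exact h (by rw [← hw.1, hw0])
  | succ n ih =>
    have e1 : evn (n + 1) y S = shf d ⁻¹' (evn n y S) := by
      ext w
      change (w (n + 1) = y ∧ (fun k => w (n + 1 + k)) ∈ S) ↔
        (w (n + 1) = y ∧ (fun k => w (n + k + 1)) ∈ S)
      simp only [add_right_comm]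
    rw [e1, ← Measure.map_apply shf_meas (evn_meas n y hS), markov1 hd hP]
    simp only [Measure.coe_finsetSum, Finset.sum_apply, Measure.smul_apply, smul_eq_mul, ih, rr, Finset.sum_mul]
    refine Finset.sum_congr rfl fun e _ => ?_
    rw [mul_assoc, sub_sub]

lemma hitn (hd : d ≠ 0) (hP : IsSRW d P) (n : ℕ) (x y : Zd d) :
    P x {w | w n = y} = rr d n (y - x) := by
  have := hP.1 y
  have h := markovn hd hP n x y (S := Set.univ) MeasurableSet.univ
  simpa [evn] using h

lemma GG_ne_top (hd : 3 ≤ d) (z : Zd d) : GG d z ≠ ∞ := by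
  obtain ⟨M, -, h, -⟩ := GG_bound d hd
  exact ((h z).trans_lt ENNReal.ofReal_lt_top).ne

lemma fin_visits (hd : 3 ≤ d) (hP : IsSRW d P) (x : Zd d) (B : Finset (Zd d)) :
    ∀ᵐ w ∂(P x), ∀ᶠ n in Filter.atTop, w n ∉ B := by
  have h : ∀ y ∈ B, ∀ᵐ w ∂(P x), ∀ᶠ n in Filter.atTop, w n ≠ y := by
    intro y _
    apply ae_eventually_notMem (s := fun n => {w : ℕ → Zd d | w n = y})
    simp only [hitn (show d ≠ 0 by omega) hP]
    exact GG_ne_top hd _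
  rw [← Finset.eventually_all] at h
  filter_upwards [h] with w hw
  rw [← Finset.eventually_all] at hw
  filter_upwards [hw] with n hn hmem
  exact hn _ hmem rfl

lemma last_exit (hd : 3 ≤ d) (hP : IsSRW d P) (x : Zd d) (B : Finset (Zd d)) :
    P x (hitS d B) = ∑ y ∈ B, GG d (y - x) * eqm d P B y := by
  have hd0 : d ≠ 0 := by omega
  have e1 : P x (hitS d B) = P x (⋃ y ∈ B, ⋃ n, evn n y (escSet d B)) := by
    apply measure_congr
    filter_upwards [fin_visits hd hP x B] with w hw
    apply propext
    change (∃ n, w n ∈ B) ↔ w ∈ (⋃ y ∈ B, ⋃ n, evn n y (escSet d B))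
    simp only [Set.mem_iUnion]
    constructor
    · rintro ⟨m, hm⟩
      rw [Filter.eventually_atTop] at hw
      obtain ⟨N, hN⟩ := hw
      classical
      have hmN : m ≤ N := by
        by_contra hc
        exact hN m (by omega) hm
      set n := Nat.findGreatest (fun k => w k ∈ B) N with hn
      have h1 : w n ∈ B := Nat.findGreatest_spec (P := fun k => w k ∈ B) hmN hm
      refine ⟨w n, h1, n, rfl, ?_⟩
      intro k hk hmem
      have h2 : n + k ≤ N := by
        by_contra hc
        exact hN (n + k) (by omega) hmem
      have := Nat.le_findGreatest (P := fun k => w k ∈ B) h2 hmem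
      omega
    · rintro ⟨y, hy, n, hn, -⟩
      exact ⟨n, by rw [hn]; exact hy⟩
  have key : ∀ n m y y' w, y ∈ B → y' ∈ B → w ∈ evn n y (escSet d B) → w ∈ evn m y' (escSet d B) → ¬ n < m := by
    intro n m y y' w hy hy' h1 h2 hlt
    apply h1.2 (m - n) (by omega)
    change w (n + (m - n)) ∈ B
    rw [Nat.add_sub_cancel' hlt.le, h2.1]
    exact hy'
  have key2 : ∀ n m y y' w, y ∈ B → y' ∈ B → w ∈ evn n y (escSet d B) → w ∈ evn m y' (escSet d B) → n = m := by
    intro n m y y' w hy hy' h1 h2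
    have := key n m y y' w hy hy' h1 h2
    have := key m n y' y w hy' hy h2 h1
    omega
  rw [e1, measure_biUnion_finset]
  · refine Finset.sum_congr rfl fun y hy => ?_
    rw [measure_iUnion]
    · simp only [markovn hd0 hP _ _ _ (esc_meas B), ENNReal.tsum_mul_right, eqm, if_pos hy, GG]
    · intro n m hnm
      rw [Function.onFun, Set.disjoint_left]
      exact fun w h1 h2 => hnm (key2 n m y y w hy hy h1 h2)
    · exact fun n => evn_meas n y (esc_meas B)
  · intro y hy y' hy' hne
    rw [Function.onFun, Set.disjoint_left]
    intro w h1 h2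
    simp only [Set.mem_iUnion] at h1 h2
    obtain ⟨n, hn⟩ := h1
    obtain ⟨m, hm⟩ := h2
    have := key2 n m y y' w hy hy' hn hm
    subst this
    exact hne (by rw [← hn.1, hm.1])
  · exact fun y _ => MeasurableSet.iUnion fun n => evn_meas n y (esc_meas B)

lemma hit_self (hP : IsSRW d P) (x : Zd d) (B : Finset (Zd d)) (hx : x ∈ B) :
    P x (hitS d B) = 1 := by
  have := hP.1 x
  rw [← measure_univ (μ := P x)]
  apply measure_congr
  filter_upwards [start_ae hP x] with w hw
  apply propext
  change (∃ n, w n ∈ B) ↔ True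
  simp only [iff_true]
  exact ⟨0, by rw [hw]; exact hx⟩

lemma sweep (hd : 3 ≤ d) (hP : IsSRW d P) (B K : Finset (Zd d)) (hBK : B ⊆ K) :
    ∑ x ∈ K, eqm d P K x * P x (hitS d B) = capa d P B := by
  simp only [last_exit hd hP, Finset.mul_sum]
  rw [Finset.sum_comm, capa]
  refine Finset.sum_congr rfl fun y hy => ?_
  calc _ = eqm d P B y * ∑ x ∈ K, GG d (x - y) * eqm d P K x := by
        rw [Finset.mul_sum]
        refine Finset.sum_congr rfl fun x _ => ?_
        rw [← GG_neg d (y - x), neg_sub]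
        ring
    _ = eqm d P B y := by
      rw [← last_exit hd hP, hit_self hP y K (hBK hy), mul_one]

lemma eqm_le_one (hP : IsSRW d P) (K : Finset (Zd d)) (x : Zd d) : eqm d P K x ≤ 1 := by
  have := hP.1 x
  unfold eqm
  split_ifs
  · exact prob_le_one
  · simp

lemma capa_ne_top (hP : IsSRW d P) (K : Finset (Zd d)) : capa d P K ≠ ∞ := by
  unfold capa
  refine ENNReal.sum_ne_top.2 fun x _ => ((eqm_le_one hP K x).trans_lt (by simp)).ne

lemma eqm_mono (B K : Finset (Zd d)) (hBK : B ⊆ K) (x : Zd d) (hx : x ∈ B) :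
    eqm d P K x ≤ eqm d P B x := by
  rw [eqm, eqm, if_pos hx, if_pos (hBK hx)]
  exact measure_mono fun w hw n hn hmem => hw n hn (hBK hmem)

lemma transl (hP : IsSRW d P) (x a : Zd d) :
    (P x).map (fun w n => w n + a) = P (x + a) := by
  have := hP.1
  have hm : Measurable (fun (w : ℕ → Zd d) n => w n + a) := by
    rw [measurable_pi_iff]
    exact fun k => (measurable_pi_apply (X := fun _ : ℕ => Zd d) k).add_const a
  have hfin : IsProbabilityMeasure ((P x).map (fun w n => w n + a)) :=
    Measure.isProbabilityMeasure_map hm.aemeasurable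
  refine ext_of_generate_finite (cyls d) (cyls_gen d) (cyls_pi d) ?_ (by simp)
  rintro _ ⟨N, γ, rfl⟩
  rw [Measure.map_apply hm (cyl_meas d N γ)]
  have : (fun (w : ℕ → Zd d) n => w n + a) ⁻¹' cyl d N γ = cyl d N (fun n => γ n - a) := by
    ext w
    change (∀ k ≤ N, w k + a = γ k) ↔ (∀ k ≤ N, w k = γ k - a)
    simp only [eq_sub_iff_add_eq]
  rw [this, cyl_prob hP, cyl_prob hP]
  have e : ∀ p q : Zd d, adj (p - a) (q - a) ↔ adj p q := by
    intro p q; simp [adj]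
  simp only [e, sub_eq_iff_eq_add]

lemma capa_transl (hP : IsSRW d P) (K : Finset (Zd d)) (a : Zd d) :
    capa d P (K.image (fun z => z + a)) = capa d P K := by
  have hm : Measurable (fun (w : ℕ → Zd d) n => w n + a) := by
    rw [measurable_pi_iff]
    exact fun k => (measurable_pi_apply (X := fun _ : ℕ => Zd d) k).add_const a
  unfold capa
  rw [Finset.sum_image (fun x _ y _ h => add_right_cancel h)]
  refine Finset.sum_congr rfl fun x hx => ?_
  rw [eqm, eqm, if_pos hx, if_pos (Finset.mem_image_of_mem _ hx), ← transl hP x a,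
    Measure.map_apply hm (esc_meas _)]
  congr 1
  ext w
  simp [escSet]

end SRW2

section Abstract
open ProbabilityTheory
variable {ι : Type*}

def trueS (B : Finset ι) : Set (ι → Bool) := {ω | ∀ z ∈ B, ω z = true}

lemma trueS_meas (B : Finset ι) : MeasurableSet (trueS B) := by
  have : trueS B = ⋂ z ∈ B, (fun ω : ι → Bool => ω z) ⁻¹' {true} := by
    ext; simp [trueS]
  rw [this]
  exact Finset.measurableSet_biInter _ fun z _ => measurable_pi_apply z (measurableSet_singleton _)

lemma trueS_gen : (inferInstance : MeasurableSpace (ι → Bool)) =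
    MeasurableSpace.generateFrom {s | ∃ B : Finset ι, s = trueS B} := by
  apply le_antisymm
  · change MeasurableSpace.pi ≤ _
    refine iSup_le fun z => ?_
    rw [← measurable_iff_comap_le]
    refine @measurable_to_bool _ (MeasurableSpace.generateFrom {s | ∃ B : Finset ι, s = trueS B}) _ ?_
    refine MeasurableSpace.measurableSet_generateFrom ⟨{z}, ?_⟩
    ext; simp [trueS]
  · apply MeasurableSpace.generateFrom_le
    rintro _ ⟨B, rfl⟩
    exact trueS_meas B

lemma trueS_pi : IsPiSystem {s : Set (ι → Bool) | ∃ B : Finset ι, s = trueS B} := by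
  classical
  rintro _ ⟨A, rfl⟩ _ ⟨B, rfl⟩ -
  refine ⟨A ∪ B, ?_⟩
  ext ω
  simp only [trueS, Set.mem_inter_iff, Set.mem_ofPred_eq, Finset.mem_union]
  constructor
  · rintro ⟨h1, h2⟩ z (hz | hz)
    exacts [h1 z hz, h2 z hz]
  · exact fun h => ⟨fun z hz => h z (Or.inl hz), fun z hz => h z (Or.inr hz)⟩

noncomputable def bern (p : ℝ) : Measure Bool :=
  ENNReal.ofReal (Real.exp (-p)) • Measure.dirac false
    + ENNReal.ofReal (1 - Real.exp (-p)) • Measure.dirac true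

lemma bern_prob {p : ℝ} (hp : 0 ≤ p) : IsProbabilityMeasure (bern p) := by
  constructor
  have : Real.exp (-p) ≤ 1 := Real.exp_le_one_iff.2 (by linarith)
  simp [bern]
  rw [← ENNReal.ofReal_add (by positivity) (by linarith)]
  simp

lemma bern_false (p : ℝ) : bern p {false} = ENNReal.ofReal (Real.exp (-p)) := by
  simp [bern]

lemma bern_true (p : ℝ) : bern p {true} ≤ ENNReal.ofReal p := by
  simp [bern]
  apply ENNReal.ofReal_le_ofReal
  have := Real.add_one_le_exp (-p)
  linarith

lemma abs_int_le {Ω : Type*} [MeasurableSpace Ω] {μ : Measure Ω} [IsProbabilityMeasure μ]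
    {a b : Ω → ℝ} (ha : Measurable a) (hb : Measurable b) (ha1 : ∀ w, a w ∈ Set.Icc (0:ℝ) 1)
    (hb1 : ∀ w, b w ∈ Set.Icc (0:ℝ) 1) {E : Set Ω} (hE : MeasurableSet E)
    (hab : ∀ w, w ∉ E → a w = b w) : |∫ w, a w ∂μ - ∫ w, b w ∂μ| ≤ μ.real E := by
  have ia : Integrable a μ := Integrable.of_bound ha.aestronglyMeasurable 1
    (Filter.Eventually.of_forall fun w => by rw [Real.norm_eq_abs, abs_le]; constructor <;> linarith [(ha1 w).1, (ha1 w).2])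
  have ib : Integrable b μ := Integrable.of_bound hb.aestronglyMeasurable 1
    (Filter.Eventually.of_forall fun w => by rw [Real.norm_eq_abs, abs_le]; constructor <;> linarith [(hb1 w).1, (hb1 w).2])
  rw [← integral_sub ia ib]
  refine (abs_integral_le_integral_abs).trans ?_
  rw [← integral_indicator_one hE]
  refine integral_mono (ia.sub ib).abs ((integrable_const (1:ℝ)).indicator hE) ?_
  intro w
  by_cases hw : w ∈ E
  · simp only [Set.indicator_of_mem hw]
    simp only [Pi.one_apply]
    rw [abs_le]; constructor <;> linarith [(ha1 w).1, (ha1 w).2, (hb1 w).1, (hb1 w).2]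
  · simp [Set.indicator_of_notMem hw, hab w hw]

open Classical in
noncomputable def VV (T : Finset (Finset ι)) (D : Finset ι → Prop) (η : T → Bool) : ι → Bool :=
  fun z => decide (∀ A : T, D A → η A = true → z ∉ A.1)

lemma VV_meas (T : Finset (Finset ι)) (D : Finset ι → Prop) : Measurable (VV T D) := by
  exact Measurable.of_discrete

set_option maxHeartbeats 1000000 in
open Classical in
lemma abstract_decor [DecidableEq ι] (K₁ K₂ : Finset ι) (hK : Disjoint K₁ K₂) (ν : Finset ι → ℝ) (hν : ∀ A, 0 ≤ ν A)
    (Q : Measure (ι → Bool)) [IsProbabilityMeasure Q]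
    (hQ : ∀ B ⊆ K₁ ∪ K₂, Q (trueS B) = ENNReal.ofReal (Real.exp
      (- ∑ A ∈ (K₁ ∪ K₂).powerset with ¬ Disjoint A B, ν A)))
    (f h : (ι → Bool) → ℝ) (hf : Measurable f) (hh : Measurable h)
    (hf1 : ∀ ω, f ω ∈ Set.Icc (0 : ℝ) 1) (hh1 : ∀ ω, h ω ∈ Set.Icc (0 : ℝ) 1)
    (hfK : ∀ ω ω', (∀ z ∈ K₁, ω z = ω' z) → f ω = f ω')
    (hhK : ∀ ω ω', (∀ z ∈ K₂, ω z = ω' z) → h ω = h ω') :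
    |(∫ ω, f ω * h ω ∂Q) - (∫ ω, f ω ∂Q) * ∫ ω, h ω ∂Q| ≤
      3 * ∑ A ∈ (K₁ ∪ K₂).powerset with (¬ Disjoint A K₁ ∧ ¬ Disjoint A K₂), ν A := by
  set K := K₁ ∪ K₂ with hKdef
  set T := K.powerset with hT
  have hbp : ∀ A : T, IsProbabilityMeasure (bern (ν A)) := fun A => bern_prob (hν A)
  set μ : Measure (T → Bool) := Measure.pi (fun A : T => bern (ν A)) with hμ
  have hμp : IsProbabilityMeasure μ := by rw [hμ]; infer_instance
  set V := VV T (fun _ => True) with hV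
  set V1 := VV T (fun A => ¬ Disjoint A K₁ ∧ Disjoint A K₂) with hV1
  set V2 := VV T (fun A => Disjoint A K₁ ∧ ¬ Disjoint A K₂) with hV2
  have mV : Measurable V := VV_meas _ _
  have mV1 : Measurable V1 := VV_meas _ _
  have mV2 : Measurable V2 := VV_meas _ _
  -- law of V
  let res : (ι → Bool) → (ι → Bool) := fun ω z => if z ∈ K then ω z else true
  have mres : Measurable res := by
    rw [measurable_pi_iff]
    intro z
    by_cases hz : z ∈ K
    · simp only [res, hz, if_true]; exact measurable_pi_apply z
    · simp only [res, hz, if_false]; exact measurable_const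
  have law : Q.map res = μ.map V := by
    have p1 : IsProbabilityMeasure (Q.map res) := Measure.isProbabilityMeasure_map mres.aemeasurable
    have p2 : IsProbabilityMeasure (μ.map V) := Measure.isProbabilityMeasure_map mV.aemeasurable
    refine ext_of_generate_finite _ trueS_gen trueS_pi ?_ (by simp)
    rintro _ ⟨B, rfl⟩
    rw [Measure.map_apply mres (trueS_meas B), Measure.map_apply mV (trueS_meas B)]
    have e1 : res ⁻¹' trueS B = trueS (B ∩ K) := by
      ext ω
      simp only [trueS, Set.mem_preimage, Set.mem_ofPred_eq, Finset.mem_inter, res]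
      constructor
      · rintro h z ⟨hz, hzK⟩
        simpa [hzK] using h z hz
      · intro h z hz
        split_ifs with hzK
        · exact h z ⟨hz, hzK⟩
        · rfl
    have e2 : V ⁻¹' trueS B = Set.pi Set.univ (fun A : T => if ¬ Disjoint A.1 (B ∩ K) then {false} else Set.univ) := by
      ext η
      simp only [trueS, Set.mem_preimage, Set.mem_ofPred_eq, hV, VV, Set.mem_univ_pi, decide_eq_true_eq]
      constructor
      · intro h A
        by_cases hA : ¬ Disjoint A.1 (B ∩ K)
        · rw [if_pos hA]
          rw [Finset.not_disjoint_iff] at hA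
          obtain ⟨z, hzA, hzB⟩ := hA
          have := h z (Finset.mem_inter.1 hzB).1 A trivial
          simp only [Set.mem_singleton_iff]
          by_contra hc
          exact this (by simpa using hc) hzA
        · rw [if_neg hA]
          trivial
      · intro h z hz A _ hA hzA
        have h1 := h A
        have hzK : z ∈ K := Finset.mem_powerset.1 A.2 hzA
        rw [if_pos (Finset.not_disjoint_iff.2 ⟨z, hzA, Finset.mem_inter.2 ⟨hz, hzK⟩⟩)] at h1
        simp [hA] at h1
    rw [e1, e2, hQ _ Finset.inter_subset_right, hμ, Measure.pi_pi, ← Finset.sum_neg_distrib, Real.exp_sum,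
      ENNReal.ofReal_prod_of_nonneg (fun _ _ => by positivity), Finset.prod_filter, ← Finset.prod_coe_sort]
    refine Finset.prod_congr rfl fun A _ => ?_
    by_cases hA : ¬ Disjoint A.1 (B ∩ K)
    · rw [if_pos hA, if_pos hA, bern_false]
    · rw [if_neg hA, if_neg hA, measure_univ]
  have intQ : ∀ F : (ι → Bool) → ℝ, Measurable F → (∀ ω ω', (∀ z ∈ K, ω z = ω' z) → F ω = F ω') →
      ∫ ω, F ω ∂Q = ∫ η, F (V η) ∂μ := by
    intro F mF hF
    rw [← integral_map mV.aemeasurable mF.aestronglyMeasurable, ← law,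
      integral_map mres.aemeasurable mF.aestronglyMeasurable]
    refine integral_congr_ae (Filter.Eventually.of_forall fun ω => ?_)
    apply hF
    intro z hz
    simp [res, hz]
  -- the bad event
  set E : Set (T → Bool) := {η | ∃ A : T, (¬ Disjoint A.1 K₁ ∧ ¬ Disjoint A.1 K₂) ∧ η A = true} with hE
  have mE : MeasurableSet E := MeasurableSet.of_discrete
  set m := ∑ A ∈ T with (¬ Disjoint A K₁ ∧ ¬ Disjoint A K₂), ν A with hm
  have hm0 : 0 ≤ m := Finset.sum_nonneg fun A _ => hν A
  have hEm : μ.real E ≤ m := by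
    apply ENNReal.toReal_le_of_le_ofReal hm0
    have : E ⊆ ⋃ A ∈ (Finset.univ : Finset T).filter (fun A => ¬ Disjoint A.1 K₁ ∧ ¬ Disjoint A.1 K₂),
        {η : T → Bool | η A = true} := by
      rintro η ⟨A, hA, hη⟩
      simp only [Set.mem_iUnion]
      exact ⟨A, by simpa using hA, hη⟩
    refine (measure_mono this).trans ((measure_biUnion_finset_le _ _).trans ?_)
    rw [hm, ENNReal.ofReal_sum_of_nonneg (fun A _ => hν A), Finset.sum_filter, Finset.sum_filter, ← Finset.sum_coe_sort T]
    refine Finset.sum_le_sum fun A _ => ?_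
    split_ifs with hA
    · have : μ {η : T → Bool | η A = true} = bern (ν A) {true} :=
        (measurePreserving_eval (fun A : T => bern (ν A)) A).measure_preimage
          (measurableSet_singleton true).nullMeasurableSet
      rw [this]
      exact bern_true _
    · simp
  have hfV : ∀ η, η ∉ E → f (V η) = f (V1 η) := by
    intro η hη
    apply hfK
    intro z hz
    simp only [hV, hV1, VV, decide_eq_decide]
    constructor
    · intro h A _; exact h A trivial
    · intro h A _ hA hzA
      have h1 : ¬ Disjoint A.1 K₁ := Finset.not_disjoint_iff.2 ⟨z, hzA, hz⟩
      by_cases h2 : Disjoint A.1 K₂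
      · exact h A ⟨h1, h2⟩ hA hzA
      · exact hη ⟨A, ⟨h1, h2⟩, hA⟩
  have hhV : ∀ η, η ∉ E → h (V η) = h (V2 η) := by
    intro η hη
    apply hhK
    intro z hz
    simp only [hV, hV2, VV, decide_eq_decide]
    constructor
    · intro h A _; exact h A trivial
    · intro h A _ hA hzA
      have h1 : ¬ Disjoint A.1 K₂ := Finset.not_disjoint_iff.2 ⟨z, hzA, hz⟩
      by_cases h2 : Disjoint A.1 K₁
      · exact h A ⟨h2, h1⟩ hA hzA
      · exact hη ⟨A, ⟨h2, h1⟩, hA⟩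
  have indep : ∫ η, f (V1 η) * h (V2 η) ∂μ = (∫ η, f (V1 η) ∂μ) * ∫ η, h (V2 η) ∂μ := by
    set S1 := (Finset.univ : Finset T).filter (fun A => ¬ Disjoint A.1 K₁ ∧ Disjoint A.1 K₂)
    set S2 := (Finset.univ : Finset T).filter (fun A => Disjoint A.1 K₁ ∧ ¬ Disjoint A.1 K₂)
    have hS : Disjoint S1 S2 := by
      rw [Finset.disjoint_filter]
      rintro A - h1 h2
      exact h2.2 h1.2
    have ind := (iIndepFun_pi (μ := fun A : T => bern (ν A)) (X := fun _ b => b)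
      (fun _ => aemeasurable_id)).indepFun_finset S1 S2 hS (fun A => measurable_pi_apply A)
    let g1 : (S1 → Bool) → ℝ := fun ξ => f (fun z => decide (∀ A : S1, ξ A = true → z ∉ A.1.1))
    let g2 : (S2 → Bool) → ℝ := fun ξ => h (fun z => decide (∀ A : S2, ξ A = true → z ∉ A.1.1))
    have ind2 := ind.comp (φ := g1) (ψ := g2) Measurable.of_discrete Measurable.of_discrete
    have c1 : (fun η => f (V1 η)) = g1 ∘ (fun (η : T → Bool) (A : S1) => η A) := by
      funext η
      simp only [g1, Function.comp]
      congr 1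
      funext z
      simp only [hV1, VV, decide_eq_decide]
      constructor
      · intro h A
        exact h A.1 (by have := A.2; simpa [S1] using this)
      · intro h A hA
        exact h ⟨A, by simpa [S1] using hA⟩
    have c2 : (fun η => h (V2 η)) = g2 ∘ (fun (η : T → Bool) (A : S2) => η A) := by
      funext η
      simp only [g2, Function.comp]
      congr 1
      funext z
      simp only [hV2, VV, decide_eq_decide]
      constructor
      · intro h A
        exact h A.1 (by have := A.2; simpa [S2] using this)
      · intro h A hA
        exact h ⟨A, by simpa [S2] using hA⟩
    rw [← c1, ← c2] at ind2
    exact ind2.integral_fun_mul_eq_mul_integral (hf.comp mV1).aestronglyMeasurable (hh.comp mV2).aestronglyMeasurable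
  have mul01 : ∀ a b : ℝ, a ∈ Set.Icc (0:ℝ) 1 → b ∈ Set.Icc (0:ℝ) 1 → a * b ∈ Set.Icc (0:ℝ) 1 :=
    fun a b ha hb => ⟨mul_nonneg ha.1 hb.1, mul_le_one₀ ha.2 hb.1 hb.2⟩
  have B1 := abs_int_le (μ := μ) ((hf.comp mV).mul (hh.comp mV)) ((hf.comp mV1).mul (hh.comp mV2))
    (fun w => mul01 _ _ (hf1 _) (hh1 _)) (fun w => mul01 _ _ (hf1 _) (hh1 _)) mE
    (fun w hw => by simp [hfV w hw, hhV w hw])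
  have B2 := abs_int_le (μ := μ) (hf.comp mV) (hf.comp mV1) (fun w => hf1 _) (fun w => hf1 _) mE hfV
  have B3 := abs_int_le (μ := μ) (hh.comp mV) (hh.comp mV2) (fun w => hh1 _) (fun w => hh1 _) mE hhV
  simp only [Function.comp, Pi.mul_apply] at B1 B2 B3
  rw [indep] at B1
  rw [intQ (fun ω => f ω * h ω) (hf.mul hh) (fun ω ω' hω => by
      rw [hfK ω ω' (fun z hz => hω z (Finset.mem_union_left _ hz)),
        hhK ω ω' (fun z hz => hω z (Finset.mem_union_right _ hz))]),
    intQ f hf (fun ω ω' hω => hfK ω ω' (fun z hz => hω z (Finset.mem_union_left _ hz))),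
    intQ h hh (fun ω ω' hω => hhK ω ω' (fun z hz => hω z (Finset.mem_union_right _ hz)))]
  have bd : ∀ (F : (T → Bool) → ℝ), (∀ w, F w ∈ Set.Icc (0:ℝ) 1) → |∫ w, F w ∂μ| ≤ 1 := by
    intro F h1
    have h := norm_integral_le_of_norm_le_const (μ := μ) (f := F) (C := 1)
      (Filter.Eventually.of_forall fun w => by
        rw [Real.norm_eq_abs, abs_le]; constructor <;> linarith [(h1 w).1, (h1 w).2])
    simpa using h
  have bb := bd (fun η => h (V2 η)) (fun w => hh1 _)
  have ba := bd (fun η => f (V η)) (fun w => hf1 _)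
  set a := ∫ η, f (V η) ∂μ
  set b := ∫ η, h (V η) ∂μ
  set a1 := ∫ η, f (V1 η) ∂μ
  set b1 := ∫ η, h (V2 η) ∂μ
  set c := ∫ η, f (V η) * h (V η) ∂μ
  have e : c - a * b = (c - a1 * b1) - (a - a1) * b1 - a * (b - b1) := by ring
  rw [e]
  have t1 : |(a - a1) * b1| ≤ m := by
    rw [abs_mul]
    calc _ ≤ m * 1 := mul_le_mul (B2.trans hEm) bb (abs_nonneg _) hm0
      _ = m := mul_one m
  have t2 : |a * (b - b1)| ≤ m := by
    rw [abs_mul]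
    calc _ ≤ 1 * m := mul_le_mul ba (B3.trans hEm) (abs_nonneg _) zero_le_one
      _ = m := one_mul m
  have t0 := B1.trans hEm
  rw [abs_le] at t0 t1 t2 ⊢
  constructor <;> linarith [t0.1, t0.2, t1.1, t1.2, t2.1, t2.2]

end Abstract

section Final
variable {d : ℕ} {P : Zd d → Measure (ℕ → Zd d)}

def trS (K A : Finset (Zd d)) : Set (ℕ → Zd d) := {w | ∀ z ∈ K, (∃ n, w n = z) ↔ z ∈ A}

lemma trS_meas (K A : Finset (Zd d)) : MeasurableSet (trS K A) := by
  have : trS K A = ⋂ z ∈ K, {w | (∃ n, w n = z) ↔ z ∈ A} := by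
    ext w; simp [trS]
  rw [this]
  refine Finset.measurableSet_biInter _ fun z _ => ?_
  have h1 : MeasurableSet {w : ℕ → Zd d | ∃ n, w n = z} := by
    have := hit_meas ({z} : Finset (Zd d))
    simpa [hitS] using this
  by_cases hz : z ∈ A
  · simpa [hz] using h1
  · have := h1.compl
    simpa [hz, Set.compl_ofPred] using this

open Classical in
lemma trS_sum (K B : Finset (Zd d)) (hB : B ⊆ K) (x : Zd d) :
    ∑ A ∈ K.powerset with ¬ Disjoint A B, P x (trS K A) = P x (hitS d B) := by
  rw [← measure_biUnion_finset]
  · congr 1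
    ext w
    simp only [Set.mem_iUnion, Finset.mem_filter, Finset.mem_powerset]
    constructor
    · rintro ⟨A, ⟨hA, hAB⟩, hw⟩
      rw [Finset.not_disjoint_iff] at hAB
      obtain ⟨z, hzA, hzB⟩ := hAB
      obtain ⟨n, hn⟩ := (hw z (hA hzA)).2 hzA
      exact ⟨n, by rw [hn]; exact hzB⟩
    · rintro ⟨n, hn⟩
      refine ⟨K.filter (fun z => ∃ n, w n = z), ⟨Finset.filter_subset _ _, ?_⟩, ?_⟩
      · rw [Finset.not_disjoint_iff]
        exact ⟨w n, by simp only [Finset.mem_filter]; exact ⟨hB hn, n, rfl⟩, hn⟩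
      · intro z hz
        simp [hz]
  · intro A hA A' hA' hne
    rw [Function.onFun, Set.disjoint_left]
    intro w h1 h2
    apply hne
    have hA := Finset.mem_powerset.1 (Finset.mem_filter.1 hA).1
    have hA' := Finset.mem_powerset.1 (Finset.mem_filter.1 hA').1
    ext z
    constructor
    · intro hz; exact (h2 z (hA hz)).1 ((h1 z (hA hz)).2 hz)
    · intro hz; exact (h1 z (hA' hz)).1 ((h2 z (hA' hz)).2 hz)
  · exact fun A _ => trS_meas K A

noncomputable def nuE (P : Zd d → Measure (ℕ → Zd d)) (K A : Finset (Zd d)) : ℝ≥0∞ :=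
  ∑ x ∈ K, eqm d P K x * P x (trS K A)

lemma nuE_ne_top (hP : IsSRW d P) (K A : Finset (Zd d)) : nuE P K A ≠ ∞ := by
  have := hP.1
  refine ENNReal.sum_ne_top.2 fun x _ => ENNReal.mul_ne_top ((eqm_le_one hP K x).trans_lt (by simp)).ne ?_
  exact measure_ne_top _ _

open Classical in
lemma nuE_sum (hd : 3 ≤ d) (hP : IsSRW d P) (K B : Finset (Zd d)) (hB : B ⊆ K) :
    ∑ A ∈ K.powerset with ¬ Disjoint A B, (nuE P K A).toReal = (capa d P B).toReal := by
  rw [← ENNReal.toReal_sum (fun A _ => nuE_ne_top hP K A)]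
  congr 1
  unfold nuE
  rw [Finset.sum_comm, ← sweep hd hP B K hB]
  refine Finset.sum_congr rfl fun x _ => ?_
  rw [← Finset.mul_sum, trS_sum K B hB]

lemma cross (hd : 3 ≤ d) (hP : IsSRW d P) (K B C : Finset (Zd d)) (hC : C ⊆ K)
    (g : ℝ≥0∞) (hg : ∀ y ∈ B, ∀ x ∈ C, GG d (y - x) ≤ g) :
    ∑ x ∈ C, eqm d P K x * P x (hitS d B) ≤ g * capa d P B * capa d P C := by
  have e : g * capa d P B * capa d P C = ∑ x ∈ C, g * capa d P B * eqm d P C x := by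
    rw [← Finset.mul_sum]; rfl
  rw [e]
  refine Finset.sum_le_sum fun x hx => ?_
  rw [mul_comm]
  refine mul_le_mul' ?_ (eqm_mono C K hC x hx)
  rw [last_exit hd hP, capa, Finset.mul_sum]
  refine Finset.sum_le_sum fun y hy => ?_
  exact mul_le_mul' (hg y hy x hx) le_rfl

lemma cap_two (hd : 3 ≤ d) (hP : IsSRW d P) (K₁ K₂ : Finset (Zd d)) (hK : Disjoint K₁ K₂)
    (g : ℝ≥0∞) (hg : ∀ y ∈ K₁, ∀ x ∈ K₂, GG d (y - x) ≤ g) :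
    capa d P K₁ + capa d P K₂ ≤ capa d P (K₁ ∪ K₂) + 2 * (g * capa d P K₁ * capa d P K₂) := by
  have hg' : ∀ y ∈ K₂, ∀ x ∈ K₁, GG d (y - x) ≤ g := by
    intro y hy x hx
    rw [← GG_neg, neg_sub]
    exact hg x hx y hy
  have c1 := cross hd hP (K₁ ∪ K₂) K₁ K₂ Finset.subset_union_right g hg
  have c2 := cross hd hP (K₁ ∪ K₂) K₂ K₁ Finset.subset_union_left g hg'
  have s1 := sweep hd hP K₁ (K₁ ∪ K₂) Finset.subset_union_left
  have s2 := sweep hd hP K₂ (K₁ ∪ K₂) Finset.subset_union_right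
  rw [Finset.sum_union hK] at s1 s2
  have t1 : ∑ x ∈ K₁, eqm d P (K₁ ∪ K₂) x * P x (hitS d K₁) = ∑ x ∈ K₁, eqm d P (K₁ ∪ K₂) x :=
    Finset.sum_congr rfl fun x hx => by rw [hit_self hP x K₁ hx, mul_one]
  have t2 : ∑ x ∈ K₂, eqm d P (K₁ ∪ K₂) x * P x (hitS d K₂) = ∑ x ∈ K₂, eqm d P (K₁ ∪ K₂) x :=
    Finset.sum_congr rfl fun x hx => by rw [hit_self hP x K₂ hx, mul_one]
  have e : capa d P (K₁ ∪ K₂) = ∑ x ∈ K₁, eqm d P (K₁ ∪ K₂) x + ∑ x ∈ K₂, eqm d P (K₁ ∪ K₂) x := by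
    rw [capa, Finset.sum_union hK]
  rw [t1] at s1
  rw [t2] at s2
  calc capa d P K₁ + capa d P K₂ = (∑ x ∈ K₁, eqm d P (K₁ ∪ K₂) x + ∑ x ∈ K₂, eqm d P (K₁ ∪ K₂) x) +
        (∑ x ∈ K₂, eqm d P (K₁ ∪ K₂) x * P x (hitS d K₁) + ∑ x ∈ K₁, eqm d P (K₁ ∪ K₂) x * P x (hitS d K₂)) := by
          rw [← s1, ← s2]; ring
    _ ≤ (∑ x ∈ K₁, eqm d P (K₁ ∪ K₂) x + ∑ x ∈ K₂, eqm d P (K₁ ∪ K₂) x) +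
        (g * capa d P K₁ * capa d P K₂ + g * capa d P K₂ * capa d P K₁) := by gcongr
    _ = _ := by rw [e]; ring

end Final


/-- **(2.15): quantitative decorrelation for the vacant set.** There is `c = c(d) > 0`
such that for disjoint `K` and `K + x`, `[0,1]`-valued functions depending respectively
only on the coordinates in `K` and in `K + x` have covariance at most
`c·u·cap(K)²/d(K,K+x)^{d−2}`. -/
theorem vacant_decorrelation (d : ℕ) (hd : 3 ≤ d) :
    ∃ c : ℝ, 0 < c ∧
      ∀ (P : Zd d → Measure (ℕ → Zd d)), IsSRW d P →
      ∀ u : ℝ, 0 ≤ u →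
      ∀ Q : Measure (Zd d → Bool), IsVacantLaw d P u Q →
      ∀ (K : Finset (Zd d)) (x : Zd d),
        Disjoint K (K.image (fun z => z + x)) →
        ∀ f h : (Zd d → Bool) → ℝ, Measurable f → Measurable h →
          (∀ ω, f ω ∈ Set.Icc (0 : ℝ) 1) → (∀ ω, h ω ∈ Set.Icc (0 : ℝ) 1) →
          (∀ ω ω', (∀ z ∈ K, ω z = ω' z) → f ω = f ω') →
          (∀ ω ω', (∀ z ∈ K.image (fun z => z + x), ω z = ω' z) → h ω = h ω') →
          |(∫ ω, f ω * h ω ∂Q) - (∫ ω, f ω ∂Q) * ∫ ω, h ω ∂Q|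
            ≤ c * u * (capa d P K).toReal ^ 2
                / (setDist d K (K.image (fun z => z + x)) : ℝ) ^ (d - 2) := by
  obtain ⟨M, hM, -, hG⟩ := GG_bound d hd
  refine ⟨6 * M, by positivity, ?_⟩
  intro P hP u hu Q hQ K x hdisj f h hf hh hf1 hh1 hfK hhK
  have := hQ.1
  classical
  set K₂ := K.image (fun z => z + x) with hK₂
  have hcap2 : capa d P K₂ = capa d P K := capa_transl hP K x
  rcases K.eq_empty_or_nonempty with hKe | hne
  · have hfc : ∀ ω, f ω = f (fun _ => true) := fun ω => hfK _ _ (by simp [hKe])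
    have hhc : ∀ ω, h ω = h (fun _ => true) := fun ω => hhK _ _ (by simp [hK₂, hKe])
    have h0 : capa d P K = 0 := by simp [capa, hKe]
    rw [h0]
    simp [hfc, hhc]
  set D := setDist d K K₂ with hD
  have hD0 : 0 < D := by
    obtain ⟨z, hz⟩ := hne
    have hmem : D ∈ {m : ℕ | ∃ a ∈ K, ∃ b ∈ K₂, linfDist a b = m} :=
      Nat.sInf_mem ⟨_, z, hz, z + x, Finset.mem_image_of_mem _ hz, rfl⟩
    obtain ⟨a, ha, b, hb, hab⟩ := hmem
    by_contra hc
    have hD00 : linfDist a b = 0 := by omega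
    have : a = b := by
      ext i
      have h1 : (a i - b i).natAbs ≤ linfDist a b :=
        Finset.le_sup (f := fun i => (a i - b i).natAbs) (Finset.mem_univ i)
      omega
    subst this
    exact Finset.disjoint_left.1 hdisj ha hb
  have hg : ∀ y ∈ K, ∀ x ∈ K₂, GG d (y - x) ≤ ENNReal.ofReal (M / (D : ℝ) ^ (d - 2)) := by
    intro a ha b hb
    apply hG _ _ hD0
    have e : linfDist (a - b) 0 = linfDist a b := by simp [linfDist]
    rw [e]
    exact Nat.sInf_le ⟨a, ha, b, hb, rfl⟩
  have hcap := cap_two hd hP K K₂ hdisj _ hg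
  rw [hcap2] at hcap
  have fin1 := capa_ne_top hP K
  have fin2 := capa_ne_top hP (K ∪ K₂)
  have hcapR : (capa d P K).toReal + (capa d P K).toReal ≤ (capa d P (K ∪ K₂)).toReal
      + 2 * (M / (D : ℝ) ^ (d - 2) * (capa d P K).toReal * (capa d P K).toReal) := by
    have hfin : 2 * (ENNReal.ofReal (M / (D : ℝ) ^ (d - 2)) * capa d P K * capa d P K) ≠ ∞ :=
      ENNReal.mul_ne_top (by simp)
        (ENNReal.mul_ne_top (ENNReal.mul_ne_top ENNReal.ofReal_ne_top fin1) fin1)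
    have := ENNReal.toReal_mono (ENNReal.add_ne_top.2 ⟨fin2, hfin⟩) hcap
    rw [ENNReal.toReal_add fin1 fin1, ENNReal.toReal_add fin2 hfin] at this
    simpa only [ENNReal.toReal_mul, ENNReal.toReal_ofNat,
      ENNReal.toReal_ofReal (show 0 ≤ M / (D : ℝ) ^ (d - 2) by positivity)] using this
  have main := abstract_decor K K₂ hdisj (fun A => u * (nuE P (K ∪ K₂) A).toReal)
    (fun A => by positivity) Q (by
      intro B hB
      rw [← Finset.mul_sum, nuE_sum hd hP _ _ hB]
      exact hQ.2 B) f h hf hh hf1 hh1 hfK hhK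
  refine main.trans ?_
  rw [← Finset.mul_sum]
  have n1 := nuE_sum hd hP (K ∪ K₂) K Finset.subset_union_left
  have n2 := nuE_sum hd hP (K ∪ K₂) K₂ Finset.subset_union_right
  have n3 := nuE_sum hd hP (K ∪ K₂) (K ∪ K₂) subset_rfl
  simp only [Finset.disjoint_union_right, not_and_or] at n3
  rw [Finset.filter_or] at n3
  rw [hcap2] at n2
  have n4 := Finset.sum_union_inter (s₁ := (K ∪ K₂).powerset.filter (fun A => ¬ Disjoint A K))
    (s₂ := (K ∪ K₂).powerset.filter (fun A => ¬ Disjoint A K₂))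
    (f := fun A => (nuE P (K ∪ K₂) A).toReal)
  rw [← Finset.filter_and] at n4
  rw [n1, n2, n3] at n4
  have n5 : ∑ A ∈ (K ∪ K₂).powerset with (¬ Disjoint A K ∧ ¬ Disjoint A K₂), (nuE P (K ∪ K₂) A).toReal
    ≤ 2 * (M / (D : ℝ) ^ (d - 2) * (capa d P K).toReal * (capa d P K).toReal) := by linarith
  calc _ ≤ 3 * (u * (2 * (M / (D : ℝ) ^ (d - 2) * (capa d P K).toReal * (capa d P K).toReal))) := by gcongr
    _ = _ := by ring
end
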